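/- Kernel-form product formula for two Ferrers functions of the first kind. Let ν, μ ∈ ℂ with Re(μ+ν) > −1 and Re(μ−ν) > −2, and let x₁, x₂ be real numbers in (−1,1). For x₃ ∈ ((x₁+x₂)/(1+x₁x₂), 1) set B := (2 − x₁² − x₂² − x₃² + x₁² x₂² x₃²)/(2 √((1−x₁²)(1−x₂²)(1−x₃²))) (note B ≥ 1 on this range). Assume that the function x₃ ↦ 𝖯_ν^{−μ}(x₃) · (1−x₃²)^{−1} · P_ν(B) is absolutely integrable on ((x₁+x₂)/(1+x₁x₂), 1). Then 𝖯_ν^{−μ}(x₁) · 𝖯_ν^{−μ}(x₂) = [2^{1−μ} √π] / [Γ((μ−ν)/2) Γ((ν+μ+1)/2)] × ∫_{(x₁+x₂)/(1+x₁x₂)}^1 𝖯_ν^{−μ}(x₃) · (1−x₃²)^{−1} · P_ν(B) dx₃. -/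

import Mathlib

open MeasureTheory Set

/-- The regularized Gauss hypergeometric function `₂F̃₁(a,b;c;z)`. -/
noncomputable def hyp2F1reg (a b c z : ℂ) : ℂ :=
  ∑' n : ℕ, (ascPochhammer ℂ n).eval a * (ascPochhammer ℂ n).eval b /
      (Complex.Gamma (c + n) * (n.factorial : ℂ)) * z ^ n

/-- The Jacobi function of the second kind `Q_γ^{(α,β)}(z)` for real `z > 1`. -/
noncomputable def jacobiQ (α β γ : ℂ) (z : ℝ) : ℂ :=
  (2 : ℂ) ^ (α + β + γ) * Complex.Gamma (α + γ + 1) * Complex.Gamma (β + γ + 1) *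
    ((z : ℂ) - 1) ^ (-α) * ((z : ℂ) + 1) ^ (-β - γ - 1) *
    hyp2F1reg (γ + 1) (β + γ + 1) (α + β + 2 * γ + 2) (2 / (1 + (z : ℂ)))

/-- The Jacobi function of the first kind `P_γ^{(α,β)}(z)` for real `z > 1`. -/
noncomputable def jacobiP (α β γ : ℂ) (z : ℝ) : ℂ :=
  Complex.Gamma (α + γ + 1) / Complex.Gamma (γ + 1) * (((z : ℂ) + 1) / 2) ^ γ *
    hyp2F1reg (-γ) (-β - γ) (α + 1) (((z : ℂ) - 1) / ((z : ℂ) + 1))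

/-- The Jacobi function of the first kind on the cut `𝖯_γ^{(α,β)}(x)`, `x ∈ (−1,1)`. -/
noncomputable def jacobiPcut (α β γ : ℂ) (x : ℝ) : ℂ :=
  Complex.Gamma (α + γ + 1) / Complex.Gamma (γ + 1) *
    hyp2F1reg (-γ) (α + β + γ + 1) (α + 1) ((1 - (x : ℂ)) / 2)

/-- The Gegenbauer function of the first kind `C_λ^α(z)` for real `z > 1`. -/
noncomputable def gegenbauerC (lam α : ℂ) (z : ℝ) : ℂ :=
  (Real.sqrt Real.pi : ℂ) * Complex.Gamma (lam + 2 * α) /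
      ((2 : ℂ) ^ (2 * α - 1) * Complex.Gamma α * Complex.Gamma (lam + 1)) *
    (((z : ℂ) + 1) / 2) ^ lam *
    hyp2F1reg (-lam) (1 / 2 - α - lam) (α + 1 / 2) (((z : ℂ) - 1) / ((z : ℂ) + 1))

/-- The Gegenbauer function of the first kind on the cut `𝖢_λ^α(x)`, `x ∈ (−1,1)`. -/
noncomputable def gegenbauerCcut (lam α : ℂ) (x : ℝ) : ℂ :=
  (Real.sqrt Real.pi : ℂ) * Complex.Gamma (lam + 2 * α) /
      ((2 : ℂ) ^ (2 * α - 1) * Complex.Gamma α * Complex.Gamma (lam + 1)) *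
    hyp2F1reg (-lam) (lam + 2 * α) (α + 1 / 2) ((1 - (x : ℂ)) / 2)

/-- The Gegenbauer function of the second kind `D_λ^α(z)` for real `z > 1`. -/
noncomputable def gegenbauerD (lam α : ℂ) (z : ℝ) : ℂ :=
  Complex.exp ((Real.pi : ℂ) * Complex.I * α) * (Complex.Gamma (lam + 2 * α) / Complex.Gamma α) *
    (2 * (z : ℂ)) ^ (-lam - 2 * α) *
    hyp2F1reg (lam / 2 + α) (lam / 2 + α + 1 / 2) (lam + α + 1) (1 / (z : ℂ) ^ 2)

/-- The associated Legendre function of the second kind `Q_ν^μ(z)` for real `z > 1`. -/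
noncomputable def legendreQ (ν μ : ℂ) (z : ℝ) : ℂ :=
  (Real.sqrt Real.pi : ℂ) * Complex.exp ((Real.pi : ℂ) * Complex.I * μ) *
    Complex.Gamma (ν + μ + 1) * ((z : ℂ) ^ 2 - 1) ^ (μ / 2) * (2 : ℂ) ^ (-ν - 1) *
    (z : ℂ) ^ (-ν - μ - 1) *
    hyp2F1reg ((ν + μ + 1) / 2) ((ν + μ + 2) / 2) (ν + 3 / 2) (1 / (z : ℂ) ^ 2)

/-- The Legendre function of the first kind `P_ν(z)` for real `z ≥ 1`. -/
noncomputable def legendreP (ν : ℂ) (z : ℝ) : ℂ :=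
  (((z : ℂ) + 1) / 2) ^ ν * hyp2F1reg (-ν) (-ν) 1 (((z : ℂ) - 1) / ((z : ℂ) + 1))

/-- The associated Legendre function of the first kind of order `−μ`, `P_ν^{−μ}(z)`, `z > 1`. -/
noncomputable def legendrePa (ν μ : ℂ) (z : ℝ) : ℂ :=
  (((z : ℂ) - 1) / ((z : ℂ) + 1)) ^ (μ / 2) * (((z : ℂ) + 1) / 2) ^ ν *
    hyp2F1reg (-ν) (μ - ν) (μ + 1) (((z : ℂ) - 1) / ((z : ℂ) + 1))

/-- The Ferrers function of the first kind of order `−μ`, `𝖯_ν^{−μ}(x)`, `x ∈ (−1,1)`. -/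
noncomputable def ferrersP (ν μ : ℂ) (x : ℝ) : ℂ :=
  ((1 - (x : ℂ)) / (1 + (x : ℂ))) ^ (μ / 2) * hyp2F1reg (-ν) (ν + 1) (1 + μ) ((1 - (x : ℂ)) / 2)

/-- The Ferrers function of the second kind of order `−μ`, `𝖰_ν^{−μ}(x)`, `x ∈ (−1,1)`. -/
noncomputable def ferrersQ (ν μ : ℂ) (x : ℝ) : ℂ :=
  -((Real.pi : ℂ) / (2 * Complex.sin ((Real.pi : ℂ) * μ))) *
    (Complex.cos ((Real.pi : ℂ) * (ν - μ)) *
        (Complex.Gamma (ν - μ + 1) / Complex.Gamma (ν + μ + 1)) *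
        ((1 + (x : ℂ)) / (1 - (x : ℂ))) ^ (-μ / 2) *
        hyp2F1reg (-ν) (ν + 1) (1 - μ) ((1 + (x : ℂ)) / 2) -
      Complex.cos ((Real.pi : ℂ) * ν) * ((1 - (x : ℂ)) / (1 + (x : ℂ))) ^ (-μ / 2) *
        hyp2F1reg (-ν) (ν + 1) (1 + μ) ((1 + (x : ℂ)) / 2))


section Helpers
open MeasureTheory Set Filter Topology

theorem HasSum.cgf {f g : ℕ → ℂ} {a : ℂ} (h : HasSum f a) (e : ∀ n, g n = f n) : HasSum g a := by
  have : g = f := funext e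
  rwa [this]

/-- Coefficients of the regularized hypergeometric series. -/
noncomputable def hypA (a b c : ℂ) (n : ℕ) : ℂ :=
  (ascPochhammer ℂ n).eval a * (ascPochhammer ℂ n).eval b /
      (Complex.Gamma (c + n) * (n.factorial : ℂ))

theorem hyp_eq (a b c z : ℂ) : hyp2F1reg a b c z = ∑' n : ℕ, hypA a b c n * z ^ n := rfl

theorem hypA_rec (a b c : ℂ) (n : ℕ) :
    ((n : ℂ) + 1) * (c + n) * hypA a b c (n + 1) = (a + n) * (b + n) * hypA a b c n := by
  unfold hypA
  rw [ascPochhammer_succ_eval, ascPochhammer_succ_eval, Nat.factorial_succ]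
  have h := Complex.one_div_Gamma_eq_self_mul_one_div_Gamma_add_one (c + n)
  have h1 : (n : ℂ) + 1 ≠ 0 := by exact_mod_cast Nat.succ_ne_zero n
  have h2 : (n.factorial : ℂ) ≠ 0 := by exact_mod_cast Nat.factorial_ne_zero n
  push_cast
  rw [show c + ((n : ℂ) + 1) = c + n + 1 by ring]
  rw [mul_comm (Complex.Gamma (c + n)), ← div_div _ _ (Complex.Gamma (c + n)),
    mul_comm (Complex.Gamma _), ← div_div _ _ (Complex.Gamma (c + n + 1))]
  rw [div_eq_mul_inv _ (Complex.Gamma (c + n)), div_eq_mul_inv _ (Complex.Gamma (c + n + 1)), h]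
  field_simp

theorem hypA_succ (a b c : ℂ) (n : ℕ) :
    ((n : ℂ) + 1) * hypA a b c (n + 1) = a * b * hypA (a + 1) (b + 1) (c + 1) n := by
  unfold hypA
  have e : ∀ x : ℂ, (ascPochhammer ℂ (n+1)).eval x = x * (ascPochhammer ℂ n).eval (x + 1) := by
    intro x
    rw [ascPochhammer_succ_left]
    simp [Polynomial.eval_comp]
  rw [e, e, Nat.factorial_succ]
  have h1 : (n : ℂ) + 1 ≠ 0 := by exact_mod_cast Nat.succ_ne_zero n
  push_cast
  rw [show c + ((n : ℂ) + 1) = c + 1 + n by ring]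
  field_simp

theorem hypA_summable (a b c : ℂ) {ρ : ℝ} (h0 : 0 ≤ ρ) (h1 : ρ < 1) :
    Summable (fun n : ℕ => ‖hypA a b c n‖ * ρ ^ n) := by
  have key : Tendsto (fun n : ℕ => ‖(a + n) * (b + n) / (((n : ℂ) + 1) * (c + n))‖ * ρ) atTop
      (𝓝 (1 * ρ)) := by
    apply Tendsto.mul_const
    have e : ∀ x : ℂ, Tendsto (fun n : ℕ => x / n + 1) atTop (𝓝 (0 + 1)) := fun x =>
      (tendsto_const_div_atTop_nhds_zero_nat x).add_const 1
    have := (((e a).mul (e b)).div ((e 1).mul (e c)) (by norm_num)).norm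
    simp only [zero_add, mul_one, div_one, norm_one] at this
    refine this.congr' ?_
    filter_upwards [eventually_gt_atTop 0] with n hn
    have : (n : ℂ) ≠ 0 := by exact_mod_cast hn.ne'
    congr 1
    simp only [Pi.div_apply]
    rw [div_add_one this, div_add_one this, div_add_one this, div_add_one this,
      div_mul_div_comm, div_mul_div_comm, div_div_div_cancel_right₀ (by simp [this])]
    ring_nf
  rw [one_mul] at key
  obtain ⟨r, hr1, hr2⟩ := exists_between h1
  refine summable_of_ratio_norm_eventually_le hr2 ?_
  have hc : ∀ᶠ n : ℕ in atTop, c + n ≠ 0 := by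
    obtain ⟨N, hN⟩ := exists_nat_gt (‖c‖)
    filter_upwards [eventually_ge_atTop N] with n hn h
    have : c = -n := by linear_combination h
    rw [this] at hN
    simp at hN
    omega
  filter_upwards [key.eventually_le_const hr1, hc] with n hn hcn
  have h1 : (n : ℂ) + 1 ≠ 0 := by exact_mod_cast Nat.succ_ne_zero n
  have : hypA a b c (n+1) = (a + n) * (b + n) / (((n : ℂ) + 1) * (c + n)) * hypA a b c n := by
    field_simp
    linear_combination hypA_rec a b c n
  rw [this]
  simp only [norm_mul, norm_norm, norm_pow, Real.norm_of_nonneg h0, pow_succ]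
  calc _ = (‖(a + n) * (b + n) / (((n : ℂ) + 1) * (c + n))‖ * ρ) * (‖hypA a b c n‖ * ρ ^ n) := by
        ring
    _ ≤ _ := by gcongr

theorem hyp_hasSum (a b c : ℂ) {w : ℂ} (hw : ‖w‖ < 1) :
    HasSum (fun n : ℕ => hypA a b c n * w ^ n) (hyp2F1reg a b c w) := by
  rw [hyp_eq]
  apply Summable.hasSum
  apply Summable.of_norm
  simpa using hypA_summable a b c (norm_nonneg w) hw

theorem hyp_hasDerivAt (a b c : ℂ) {w : ℂ} (hw : ‖w‖ < 1) :
    HasDerivAt (hyp2F1reg a b c) (a * b * hyp2F1reg (a+1) (b+1) (c+1) w) w := by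
  obtain ⟨ρ, hr1, hr2⟩ := exists_between hw
  have h0 : 0 ≤ ρ := (norm_nonneg w).trans hr1.le
  have hu : Summable (fun n : ℕ => ‖(n : ℂ) * hypA a b c n‖ * ρ ^ (n-1)) := by
    rw [← summable_nat_add_iff 1]
    refine ((hypA_summable (a+1) (b+1) (c+1) h0 hr2).mul_left ‖a * b‖).congr fun n => ?_
    push_cast
    rw [hypA_succ]
    simp [mul_assoc]
  have := hasDerivAt_tsum_of_isPreconnected (g := fun n w => hypA a b c n * w ^ n)
    (g' := fun n w => hypA a b c n * (n * w ^ (n-1))) (t := Metric.ball 0 ρ) (y₀ := 0) (y := w)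
    hu Metric.isOpen_ball (convex_ball _ _).isPreconnected
    (fun n y hy => (hasDerivAt_pow n y).const_mul _)
    (fun n y hy => by
      have : ‖y‖ ≤ ρ := by simpa using (Metric.mem_ball.1 hy).le
      simp only [norm_mul, norm_pow]
      calc _ = ‖(n:ℂ)‖ * ‖hypA a b c n‖ * ‖y‖ ^ (n-1) := by ring
        _ ≤ _ := by gcongr)
    (by simpa using h0.lt_of_ne (by rintro rfl; exact absurd hr1 (norm_nonneg w).not_gt))
    (by
      have := (hyp_hasSum a b c (w := 0) (by simp)).summable
      exact this) (by simpa using hr1)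
  refine this.congr_deriv ?_
  rw [hyp_eq, ← tsum_mul_left]
  rw [← (Function.Injective.tsum_eq (g := fun n : ℕ => n + 1) (add_left_injective 1) _)]
  · apply tsum_congr
    intro n
    push_cast
    linear_combination w ^ n * hypA_succ a b c n
  · intro n hn
    rcases n with _ | n
    · simp at hn
    · exact ⟨n, rfl⟩

/-- The hypergeometric ODE. -/
theorem hyp_ode (a b c : ℂ) {w : ℂ} (hw : ‖w‖ < 1) :
    w * (1 - w) * (a * b * ((a + 1) * (b + 1) * hyp2F1reg (a+1+1) (b+1+1) (c+1+1) w))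
      + (c - (a + b + 1) * w) * (a * b * hyp2F1reg (a+1) (b+1) (c+1) w)
      - a * b * hyp2F1reg a b c w = 0 := by
  have s0 := hyp_hasSum a b c hw
  have s1 := (hyp_hasSum (a+1) (b+1) (c+1) hw).mul_left (a * b)
  have s2 := (hyp_hasSum (a+1+1) (b+1+1) (c+1+1) hw).mul_left (a * b * ((a + 1) * (b + 1)))
  have t1 : HasSum (fun n : ℕ => n * hypA a b c n * w ^ n)
      (w * (a * b * hyp2F1reg (a+1) (b+1) (c+1) w)) := by
    rw [← hasSum_nat_add_iff' 1]
    simp only [Finset.range_one, Finset.sum_singleton, Nat.cast_zero, zero_mul, sub_zero]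
    refine (s1.mul_left w).cgf fun n => ?_
    push_cast
    linear_combination (w ^ (n+1)) * hypA_succ a b c n
  have s1' : HasSum (fun n : ℕ => ((n:ℂ) + 1) * hypA a b c (n+1) * w ^ n)
      (a * b * hyp2F1reg (a+1) (b+1) (c+1) w) := by
    refine s1.cgf fun n => ?_
    linear_combination (w ^ n) * hypA_succ a b c n
  have t2 : HasSum (fun n : ℕ => n * ((n:ℂ) + 1) * hypA a b c (n+1) * w ^ n)
      (w * (a * b * ((a + 1) * (b + 1)) * hyp2F1reg (a+1+1) (b+1+1) (c+1+1) w)) := by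
    rw [← hasSum_nat_add_iff' 1]
    simp only [Finset.range_one, Finset.sum_singleton, Nat.cast_zero, zero_mul, sub_zero]
    refine (s2.mul_left w).cgf fun n => ?_
    have e1 := hypA_succ a b c (n+1)
    have e2 := hypA_succ (a+1) (b+1) (c+1) n
    push_cast at e1 ⊢
    linear_combination (w ^ (n+1)) * (((n:ℂ)+1) * e1 + a * b * e2)
  have t3 : HasSum (fun n : ℕ => n * ((n:ℂ) - 1) * hypA a b c n * w ^ n)
      (w * (w * (a * b * ((a + 1) * (b + 1)) * hyp2F1reg (a+1+1) (b+1+1) (c+1+1) w))) := by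
    rw [← hasSum_nat_add_iff' 1]
    simp only [Finset.range_one, Finset.sum_singleton, Nat.cast_zero, zero_mul, sub_zero]
    refine (t2.mul_left w).cgf fun n => ?_
    push_cast
    ring
  have key := ((t2.sub t3).add (s1'.mul_left c)).sub ((t1.mul_left (a+b+1)).add
    (s0.mul_left (a*b)))
  have z : HasSum (fun n : ℕ => (0:ℂ)) 0 (SummationFilter.unconditional ℕ) := hasSum_zero
  have := key.unique (z.cgf fun n => ?_)
  · linear_combination this
  · linear_combination (w ^ n) * hypA_rec a b c n


/-- First derivative of `legendreP`. -/
noncomputable def LP1 (ν : ℂ) (z : ℝ) : ℂ :=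
  (((z : ℂ) + 1) / 2) ^ ν * (ν / (z + 1) * hyp2F1reg (-ν) (-ν) 1 (((z : ℂ) - 1) / ((z : ℂ) + 1))
    + 2 / (z + 1) ^ 2 * (-ν * -ν * hyp2F1reg (-ν + 1) (-ν + 1) (1 + 1) (((z : ℂ) - 1) / ((z : ℂ) + 1))))

/-- Second derivative of `legendreP`. -/
noncomputable def LP2 (ν : ℂ) (z : ℝ) : ℂ :=
  (((z : ℂ) + 1) / 2) ^ ν * (ν * (ν - 1) / (z + 1) ^ 2 *
        hyp2F1reg (-ν) (-ν) 1 (((z : ℂ) - 1) / ((z : ℂ) + 1))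
    + (4 * ν / (z + 1) ^ 3 - 4 / (z + 1) ^ 3) *
      (-ν * -ν * hyp2F1reg (-ν + 1) (-ν + 1) (1 + 1) (((z : ℂ) - 1) / ((z : ℂ) + 1)))
    + 4 / (z + 1) ^ 4 * (-ν * -ν * ((-ν + 1) * (-ν + 1) *
       hyp2F1reg (-ν + 1 + 1) (-ν + 1 + 1) (1 + 1 + 1) (((z : ℂ) - 1) / ((z : ℂ) + 1)))))

theorem norm_w_lt {z : ℝ} (hz : 0 < z) : ‖((z : ℂ) - 1) / ((z : ℂ) + 1)‖ < 1 := by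
  have : ((z : ℂ) - 1) / ((z : ℂ) + 1) = ((z - 1) / (z + 1) : ℝ) := by push_cast; rfl
  rw [this, Complex.norm_real, Real.norm_eq_abs, abs_lt]
  constructor
  · rw [lt_div_iff₀ (by linarith)]; linarith
  · rw [div_lt_iff₀ (by linarith)]; linarith

theorem zp1_ne {z : ℝ} (hz : 0 < z) : (z : ℂ) + 1 ≠ 0 := by
  have : z + 1 ≠ 0 := by linarith
  exact_mod_cast this

theorem hasDerivAt_w {z : ℝ} (hz : 0 < z) :
    HasDerivAt (fun z : ℝ => ((z : ℂ) - 1) / ((z : ℂ) + 1)) (2 / ((z : ℂ) + 1) ^ 2) z := by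
  have h0 : HasDerivAt (fun z : ℝ => (z : ℂ)) 1 z := Complex.ofRealCLM.hasDerivAt
  refine ((h0.sub_const 1).div (h0.add_const 1) (zp1_ne hz)).congr_deriv ?_
  ring

theorem hasDerivAt_g (ν : ℂ) {z : ℝ} (hz : 0 < z) :
    HasDerivAt (fun z : ℝ => (((z : ℂ) + 1) / 2) ^ ν) (ν / ((z : ℂ) + 1) * (((z : ℂ) + 1) / 2) ^ ν) z := by
  have h0 : HasDerivAt (fun z : ℝ => ((z : ℂ) + 1) / 2) (1 / 2) z :=
    ((Complex.ofRealCLM.hasDerivAt (x := z)).add_const 1).div_const 2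
  have hne := zp1_ne hz
  have hs : ((z : ℂ) + 1) / 2 ∈ Complex.slitPlane := by
    rw [show ((z : ℂ) + 1) / 2 = ((z + 1) / 2 : ℝ) by push_cast; rfl]
    exact Complex.ofReal_mem_slitPlane.2 (by linarith)
  have hc : HasDerivAt (fun u : ℂ => u ^ ν) (ν * (((z : ℂ) + 1) / 2) ^ (ν - 1) * 1) (((z : ℂ) + 1) / 2) :=
    HasDerivAt.cpow_const (f := fun u => u) (hasDerivAt_id _) hs
  refine (HasDerivAt.comp z hc h0).congr_deriv ?_
  have h2 : ((z : ℂ) + 1) / 2 ≠ 0 := div_ne_zero hne two_ne_zero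
  rw [mul_one, Complex.cpow_sub _ _ h2, Complex.cpow_one]
  field_simp

theorem hasDerivAt_hypw (a b c : ℂ) {z : ℝ} (hz : 0 < z) :
    HasDerivAt (fun z : ℝ => hyp2F1reg a b c (((z : ℂ) - 1) / ((z : ℂ) + 1)))
     ((a * b * hyp2F1reg (a+1) (b+1) (c+1) (((z : ℂ) - 1) / ((z : ℂ) + 1))) * (2 / ((z : ℂ) + 1) ^ 2)) z :=
  HasDerivAt.comp z (hyp_hasDerivAt a b c (norm_w_lt hz)) (hasDerivAt_w hz)

theorem legendreP_hasDerivAt (ν : ℂ) {z : ℝ} (hz : 0 < z) :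
    HasDerivAt (legendreP ν) (LP1 ν z) z := by
  refine ((hasDerivAt_g ν hz).mul (hasDerivAt_hypw (-ν) (-ν) 1 hz)).congr_deriv ?_
  unfold LP1
  ring

theorem LP1_hasDerivAt (ν : ℂ) {z : ℝ} (hz : 0 < z) :
    HasDerivAt (LP1 ν) (LP2 ν z) z := by
  have h0 : HasDerivAt (fun z : ℝ => (z : ℂ) + 1) 1 z :=
    (Complex.ofRealCLM.hasDerivAt (x := z)).add_const 1
  have hne := zp1_ne hz
  have h1 : HasDerivAt (fun z : ℝ => ν / ((z : ℂ) + 1)) (- ν / ((z : ℂ) + 1) ^ 2) z := by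
    refine ((hasDerivAt_const z ν).div h0 hne).congr_deriv ?_
    ring
  have h2 : HasDerivAt (fun z : ℝ => 2 / ((z : ℂ) + 1) ^ 2) (- 4 / ((z : ℂ) + 1) ^ 3) z := by
    refine ((hasDerivAt_const z (2:ℂ)).div (h0.pow 2) (pow_ne_zero 2 hne)).congr_deriv ?_
    simp only [Pi.pow_apply]
    field_simp
    ring
  refine ((hasDerivAt_g ν hz).mul ((h1.mul (hasDerivAt_hypw (-ν) (-ν) 1 hz)).add
    (h2.mul ((hasDerivAt_hypw (-ν+1) (-ν+1) (1+1) hz).const_mul (-ν * -ν))))).congr_deriv ?_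
  unfold LP2
  simp only [Pi.add_apply, Pi.mul_apply]
  field_simp
  ring

theorem legendre_ode (ν : ℂ) {z : ℝ} (hz : 0 < z) :
    ((z : ℂ) ^ 2 - 1) * LP2 ν z + 2 * z * LP1 ν z = ν * (ν + 1) * legendreP ν z := by
  have h := hyp_ode (-ν) (-ν) 1 (norm_w_lt hz)
  have hne := zp1_ne hz
  unfold LP2 LP1 legendreP
  generalize hyp2F1reg (-ν) (-ν) 1 (((z : ℂ) - 1) / ((z : ℂ) + 1)) = F0 at *
  generalize hyp2F1reg (-ν+1) (-ν+1) (1+1) (((z : ℂ) - 1) / ((z : ℂ) + 1)) = F1 at *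
  generalize hyp2F1reg (-ν+1+1) (-ν+1+1) (1+1+1) (((z : ℂ) - 1) / ((z : ℂ) + 1)) = F2 at *
  generalize (((z : ℂ) + 1) / 2) ^ ν = g
  have e : ((z : ℂ) - 1) / ((z : ℂ) + 1) * (1 - ((z : ℂ) - 1) / ((z : ℂ) + 1)) =
    2 * (z - 1) / (z + 1) ^ 2 := by field_simp; ring
  rw [e] at h
  have e2 : (1 - (-ν + -ν + 1) * (((z : ℂ) - 1) / ((z : ℂ) + 1))) = (2 + 2 * ν * (z - 1)) / (z + 1) := by
    field_simp; ring
  rw [e2] at h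
  field_simp at h ⊢
  linear_combination (2 * g * (z + 1)) * h

theorem legendreP_one (ν : ℂ) : legendreP ν 1 = 1 := by
  unfold legendreP hyp2F1reg
  rw [tsum_eq_single 0]
  · norm_num
  · intro n hn
    simp [hn]

theorem LP1_continuousOn (ν : ℂ) : ContinuousOn (LP1 ν) (Ioi 0) :=
  fun _ hz => (LP1_hasDerivAt ν hz).continuousAt.continuousWithinAt

theorem legendreP_continuousOn (ν : ℂ) : ContinuousOn (legendreP ν) (Ioi 0) :=
  fun _ hz => (legendreP_hasDerivAt ν hz).continuousAt.continuousWithinAt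

theorem LP2_continuousOn (ν : ℂ) : ContinuousOn (LP2 ν) (Ioi 0) := by
  intro z hz
  have hne := zp1_ne hz
  have h0 : ContinuousAt (fun z : ℝ => (z : ℂ) + 1) z := by fun_prop
  have A := (hasDerivAt_g ν hz).continuousAt
  have B := (hasDerivAt_hypw (-ν) (-ν) 1 hz).continuousAt
  have C := (hasDerivAt_hypw (-ν+1) (-ν+1) (1+1) hz).continuousAt
  have D := (hasDerivAt_hypw (-ν+1+1) (-ν+1+1) (1+1+1) hz).continuousAt
  apply ContinuousAt.continuousWithinAt
  unfold LP2
  have k : ∀ (c : ℂ) (n : ℕ), ContinuousAt (fun z : ℝ => c / ((z : ℂ) + 1) ^ n) z := fun c n =>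
    continuousAt_const.div (h0.pow n) (pow_ne_zero _ hne)
  exact A.mul ((((k _ 2).mul B).add (((k _ 3).sub (k _ 3)).mul (continuousAt_const.mul C))).add
    ((k _ 4).mul (continuousAt_const.mul (continuousAt_const.mul D))))


/-- real coefficient (s)_n / n! -/
noncomputable def binc (s : ℝ) (n : ℕ) : ℝ := (ascPochhammer ℝ n).eval s / n.factorial

theorem binc_succ (s : ℝ) (n : ℕ) : binc s (n+1) = binc s n * ((s + n) / (n + 1)) := by
  unfold binc
  rw [ascPochhammer_succ_eval, Nat.factorial_succ]
  push_cast
  field_simp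

theorem binc_zero (s : ℝ) : binc s 0 = 1 := by simp [binc]

theorem binc_hasSum (s : ℝ) {w : ℝ} (h0 : 0 ≤ w) (h1 : w < 1) :
    HasSum (fun n => binc s n * w ^ n) ((1 - w) ^ (-s)) := by
  have := (Real.one_div_one_sub_rpow_hasFPowerSeriesOnBall_zero s).hasSum (y := w) (by
    simp only [Metric.mem_eball, edist_zero_right]
    rw [← ofReal_norm]
    simpa [abs_of_nonneg h0] using h1)
  rw [zero_add, one_div, ← Real.rpow_neg (by linarith)] at this
  suffices hfun : (fun n => binc s n * w ^ n) = fun n => (FormalMultilinearSeries.ofScalars ℝ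
      (fun n : ℕ => Ring.choose (s + n - 1) n) n) fun _ => w by
    rw [hfun]; exact this
  funext n
  rw [FormalMultilinearSeries.ofScalars_apply_eq, smul_eq_mul]
  congr 1
  have := Ring.factorial_nsmul_multichoose_eq_ascPochhammer s n
  rw [nsmul_eq_mul, Polynomial.ascPochhammer_smeval_eq_eval] at this
  unfold binc
  rw [← this, Ring.choose, show s + n - 1 - n + 1 = s by ring]
  field_simp

/-- Comparison of hypergeometric coefficients. -/
theorem coeff_bound (ν : ℂ) (s : ℝ) (hs : -1 < s) (hs0 : s ≠ 0) (hsν : -2 * ν.re ≤ 1 + s) :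
    ∃ C : ℝ, 0 < C ∧ ∀ n : ℕ, 1 ≤ n → ‖hypA (-ν) (-ν) 1 n‖ ≤ C * |binc s n| := by
  set K : ℝ := (‖ν‖ ^ 2 + 1) / min 1 ((1 + s) / 2) with hK
  have hmin : 0 < min 1 ((1 + s) / 2) := lt_min one_pos (by linarith)
  have hK0 : 0 ≤ K := by positivity
  have step : ∀ n : ℕ, 1 ≤ n → ‖-ν + n‖ ^ 2 / (n+1)^2 ≤ Real.exp (K / (n + 1) ^ 2) * (|s + n| / (n + 1)) := by
    intro n hn
    have hn' : (1:ℝ) ≤ n := by exact_mod_cast hn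
    have e : ‖-ν + n‖ ^ 2 = n ^ 2 - 2 * n * ν.re + ‖ν‖ ^ 2 := by
      rw [← Complex.normSq_eq_norm_sq, ← Complex.normSq_eq_norm_sq, Complex.normSq_apply, Complex.normSq_apply]
      simp
      ring
    rw [abs_of_pos (by linarith)]
    have h1 : (‖ν‖ ^ 2 + 1) * (n + 1) ≤ K * (s + n) := by
      have : min 1 ((1 + s) / 2) * (n + 1) ≤ s + n := by
        rcases le_total 1 ((1+s)/2) with h | h
        · rw [min_eq_left h]; linarith
        · rw [min_eq_right h]; nlinarith
      calc (‖ν‖ ^ 2 + 1) * (n + 1) = K * (min 1 ((1 + s) / 2) * (n + 1)) := by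
            rw [hK]; field_simp
        _ ≤ _ := by gcongr
    have h2 : ‖-ν + n‖ ^ 2 / (n+1)^2 ≤ (K / (n + 1) ^ 2 + 1) * ((s + n) / (n + 1)) := by
      rw [e]
      have : (K / ((n:ℝ) + 1) ^ 2 + 1) * ((s + n) / (n + 1)) = (K * (s + n) / (n+1) + (n + 1) * (s + n)) / (n+1)^2 := by
        field_simp
      rw [this]
      apply div_le_div_of_nonneg_right _ (by positivity)
      have : ‖ν‖ ^ 2 + 1 ≤ K * (s + n) / (n + 1) := by
        rw [le_div_iff₀ (by positivity)]; exact h1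
      nlinarith [mul_nonneg (show (0:ℝ) ≤ n - 1 by linarith) (show 0 ≤ 1 + s + 2 * ν.re by linarith)]
    refine h2.trans ?_
    have : 0 < s + n := by linarith
    gcongr
    exact Real.add_one_le_exp _
  have rec1 : ∀ n : ℕ, ‖hypA (-ν) (-ν) 1 (n+1)‖ = ‖-ν + n‖ ^ 2 / (n+1)^2 * ‖hypA (-ν) (-ν) 1 n‖ := by
    intro n
    have := hypA_rec (-ν) (-ν) 1 n
    have h1 : (n : ℂ) + 1 ≠ 0 := by exact_mod_cast Nat.succ_ne_zero n
    have h2 : ‖(n : ℂ) + 1‖ = n + 1 := by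
      rw [show (n:ℂ) + 1 = ((n + 1 : ℕ) : ℂ) by push_cast; rfl, Complex.norm_natCast]; push_cast; rfl
    have := congrArg norm this
    rw [add_comm (1:ℂ)] at this
    simp only [norm_mul, h2] at this
    field_simp
    linarith
  have S : Summable (fun n : ℕ => K / ((n:ℝ) + 1) ^ 2) := by
    have := (summable_nat_add_iff 1).2 (Real.summable_one_div_nat_pow.2 (one_lt_two))
    refine (this.mul_left K).congr fun n => ?_
    push_cast; ring
  set T := ∑' n : ℕ, K / ((n:ℝ) + 1) ^ 2
  have ind : ∀ n : ℕ, 1 ≤ n → ‖hypA (-ν) (-ν) 1 n‖ ≤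
      (‖hypA (-ν) (-ν) 1 1‖ / |s|) * Real.exp (∑ k ∈ Finset.range n, K / ((k:ℝ) + 1) ^ 2) * |binc s n| := by
    intro n hn
    induction n, hn using Nat.le_induction with
    | base =>
      have : |binc s 1| = |s| := by rw [binc_succ, binc_zero]; simp
      rw [this]
      have : 0 < |s| := abs_pos.2 hs0
      have h3 : (1:ℝ) ≤ Real.exp (∑ k ∈ Finset.range 1, K / ((k:ℝ) + 1) ^ 2) :=
        Real.one_le_exp (Finset.sum_nonneg fun _ _ => by positivity)
      calc _ = ‖hypA (-ν) (-ν) 1 1‖ / |s| * 1 * |s| := by field_simp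
        _ ≤ _ := by gcongr
    | succ n hn ih =>
      rw [rec1, binc_succ, Finset.sum_range_succ, Real.exp_add, abs_mul, abs_div,
        abs_of_nonneg (by positivity : (0:ℝ) ≤ n + 1)]
      calc _ ≤ (Real.exp (K / (n + 1) ^ 2) * (|s + n| / (n + 1))) * _ := by
            exact mul_le_mul_of_nonneg_right (step n hn) (norm_nonneg _)
        _ ≤ _ := mul_le_mul_of_nonneg_left ih (by positivity)
        _ = _ := by ring
  refine ⟨(‖hypA (-ν) (-ν) 1 1‖ / |s|) * Real.exp T + 1, by positivity, fun n hn => (ind n hn).trans ?_⟩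
  have : Real.exp (∑ k ∈ Finset.range n, K / ((k:ℝ) + 1) ^ 2) ≤ Real.exp T :=
    Real.exp_le_exp.2 (S.sum_le_tsum _ (fun _ _ => by positivity))
  gcongr
  calc _ ≤ ‖hypA (-ν) (-ν) 1 1‖ / |s| * Real.exp T := by gcongr
    _ ≤ _ := by linarith

theorem binc_pos {s : ℝ} (hs : 0 < s) (n : ℕ) : 0 < binc s n := by
  induction n with
  | zero => simp [binc_zero]
  | succ n ih => rw [binc_succ]; positivity

theorem hyp_bound (ν : ℂ) (s : ℝ) (hs : 0 < s) (hsν : -2 * ν.re ≤ 1 + s) :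
    ∃ C : ℝ, 0 < C ∧ ∀ w : ℝ, 0 ≤ w → w < 1 → ‖hyp2F1reg (-ν) (-ν) 1 w‖ ≤ C * (1 - w) ^ (-s) := by
  obtain ⟨C, hC, h⟩ := coeff_bound ν s (by linarith) hs.ne' hsν
  refine ⟨max C 1, by positivity, fun w h0 h1 => ?_⟩
  have hw : ‖(w:ℂ)‖ < 1 := by rw [Complex.norm_real, Real.norm_of_nonneg h0]; exact h1
  have A := (binc_hasSum s h0 h1).mul_left (max C 1)
  rw [hyp_eq]
  refine tsum_of_norm_bounded A fun n => ?_
  rw [norm_mul, norm_pow, Complex.norm_real, Real.norm_of_nonneg h0, ← mul_assoc]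
  gcongr
  rcases Nat.eq_zero_or_pos n with rfl | hn
  · simp [hypA, binc_zero]
  · refine (h n hn).trans ?_
    rw [abs_of_pos (binc_pos hs n)]
    have := binc_pos hs n
    gcongr
    exact le_max_left _ _

/-- Growth bound. -/
theorem legendreP_bound (ν : ℂ) (σ : ℝ) (h1 : ν.re < σ) (h2 : -1 - ν.re ≤ σ) :
    ∃ C : ℝ, 0 < C ∧ ∀ z : ℝ, 1 ≤ z → ‖legendreP ν z‖ ≤ C * z ^ σ := by
  obtain ⟨C, hC, h⟩ := hyp_bound ν (σ - ν.re) (by linarith) (by linarith)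
  have hσ : -1/2 ≤ σ := by linarith
  refine ⟨C * 2 ^ |σ|, by positivity, fun z hz => ?_⟩
  have hp : 0 < (z + 1) / 2 := by linarith
  unfold legendreP
  have e1 : (((z : ℂ) + 1) / 2) = ((z + 1) / 2 : ℝ) := by push_cast; rfl
  have e2 : ((z : ℂ) - 1) / ((z : ℂ) + 1) = ((z - 1) / (z + 1) : ℝ) := by push_cast; rfl
  rw [e1, e2, norm_mul, Complex.norm_cpow_eq_rpow_re_of_pos hp]
  have b := h ((z - 1) / (z + 1)) (div_nonneg (by linarith) (by linarith)) (by
    rw [div_lt_one (by linarith)]; linarith)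
  have e3 : (1 - (z - 1) / (z + 1)) = ((z + 1)/2)⁻¹ := by field_simp; ring
  rw [e3, Real.inv_rpow hp.le, ← Real.rpow_neg hp.le, neg_neg] at b
  calc _ ≤ ((z + 1) / 2) ^ ν.re * (C * ((z + 1) / 2) ^ (σ - ν.re)) := by gcongr
    _ = C * ((z + 1) / 2) ^ σ := by
      rw [mul_left_comm, ← Real.rpow_add hp]; congr 2; ring
    _ ≤ C * (2 ^ |σ| * z ^ σ) := by
      gcongr
      have h1 : (z+1)/2 = ((z+1)/(2*z)) * z := by field_simp
      have hz0 : 0 < (z+1)/(2*z) := by positivity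
      rw [h1, Real.mul_rpow hz0.le (by linarith)]
      gcongr
      rcases le_total 0 σ with h | h
      · rw [abs_of_nonneg h]
        gcongr
        rw [div_le_iff₀ (by positivity)]; nlinarith
      · rw [abs_of_nonpos h, Real.rpow_neg_eq_inv_rpow]
        apply Real.rpow_le_rpow_of_nonpos (by norm_num) _ h
        rw [le_div_iff₀ (by positivity)]; linarith
    _ = _ := by ring


theorem LP1_bound_large (ν : ℂ) (σ : ℝ) (hσ : -1 < σ) (C : ℝ)
    (h : ∀ z : ℝ, 1 ≤ z → ‖legendreP ν z‖ ≤ C * z ^ σ) (z : ℝ) (hz : 1 ≤ z) :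
    ‖((z : ℂ) ^ 2 - 1) * LP1 ν z‖ ≤ ‖ν * (ν + 1)‖ * C / (σ + 1) * z ^ (σ + 1) := by
  have hC : 0 ≤ C := by
    have := h 1 le_rfl
    rw [Real.one_rpow, mul_one] at this
    exact (norm_nonneg _).trans this
  have hd : ∀ x : ℝ, 0 < x → HasDerivAt (fun z : ℝ => ((z : ℂ) ^ 2 - 1) * LP1 ν z)
      (ν * (ν + 1) * legendreP ν x) x := by
    intro x hx
    have h0 : HasDerivAt (fun z : ℝ => (z : ℂ)) 1 x := Complex.ofRealCLM.hasDerivAt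
    refine (((h0.pow 2).sub_const 1).mul (LP1_hasDerivAt ν hx)).congr_deriv ?_
    rw [← legendre_ode ν hx]
    simp
    ring
  have hBd : ∀ x : ℝ, 0 < x → HasDerivAt (fun z : ℝ => ‖ν * (ν + 1)‖ * C / (σ + 1) * z ^ (σ + 1))
      (‖ν * (ν + 1)‖ * C * x ^ σ) x := by
    intro x hx
    refine ((Real.hasDerivAt_rpow_const (Or.inl hx.ne')).const_mul _).congr_deriv ?_
    have : σ + 1 ≠ 0 := by linarith
    rw [add_sub_cancel_right]
    field_simp
  refine image_norm_le_of_norm_deriv_right_le_deriv_boundary' (a := 1) (b := z)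
    (f := fun z : ℝ => ((z : ℂ) ^ 2 - 1) * LP1 ν z)
    (f' := fun x => ν * (ν + 1) * legendreP ν x)
    (B := fun z => ‖ν * (ν + 1)‖ * C / (σ + 1) * z ^ (σ + 1))
    (B' := fun z => ‖ν * (ν + 1)‖ * C * z ^ σ)
    ?_ ?_ ?_ ?_ ?_ ?_ (x := z) ⟨hz, le_rfl⟩
  · intro x hx
    exact (hd x (by linarith [hx.1])).continuousAt.continuousWithinAt
  · intro x hx
    exact (hd x (by linarith [hx.1])).hasDerivWithinAt
  · simp only [Complex.ofReal_one, one_pow, sub_self, zero_mul, norm_zero]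
    have : 0 < σ + 1 := by linarith
    positivity
  · intro x hx
    exact (hBd x (by linarith [hx.1])).continuousAt.continuousWithinAt
  · intro x hx
    exact (hBd x (by linarith [hx.1])).hasDerivWithinAt
  · intro x hx
    rw [norm_mul]
    have := h x hx.1
    rw [mul_assoc]
    gcongr

theorem legendre_bounds (ν : ℂ) (σ : ℝ) (h1 : ν.re < σ) (h2 : -1 - ν.re ≤ σ) (z₀ : ℝ) (hz₀ : 0 < z₀) :
    ∃ C : ℝ, 0 < C ∧ ∀ z : ℝ, z₀ ≤ z → ‖legendreP ν z‖ ≤ C * z ^ σ ∧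
      ‖LP1 ν z‖ * z ≤ C * z ^ σ ∧ ‖LP2 ν z‖ * z ^ 2 ≤ C * z ^ σ := by
  obtain ⟨C, hC, h⟩ := legendreP_bound ν σ h1 h2
  have hσ : -1 < σ := by linarith
  have hl := LP1_bound_large ν σ hσ C h
  set L := ‖ν * (ν + 1)‖ with hL
  have hσ1 : 0 < σ + 1 := by linarith
  have big : ∀ z : ℝ, 2 ≤ z → ‖legendreP ν z‖ ≤ C * z ^ σ ∧
      ‖LP1 ν z‖ * z ≤ (2 * (L * C / (σ + 1))) * z ^ σ ∧
      ‖LP2 ν z‖ * z ^ 2 ≤ (2 * (L * C + 2 * (2 * (L * C / (σ + 1))))) * z ^ σ := by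
    intro z hz
    have hzp : 0 < z := by linarith
    have e0 : ‖(z : ℂ) ^ 2 - 1‖ = z ^ 2 - 1 := by
      rw [show (z : ℂ) ^ 2 - 1 = ((z ^ 2 - 1 : ℝ) : ℂ) by push_cast; rfl, Complex.norm_real,
        Real.norm_of_nonneg (by nlinarith)]
    have e1 := hl z (by linarith)
    rw [norm_mul, e0, Real.rpow_add hzp, Real.rpow_one] at e1
    have hh : z ^ 2 ≤ 2 * (z ^ 2 - 1) := by nlinarith
    have a1 : ‖LP1 ν z‖ * z ≤ (2 * (L * C / (σ + 1))) * z ^ σ := by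
      refine le_of_mul_le_mul_right ?_ hzp
      calc ‖LP1 ν z‖ * z * z = z ^ 2 * ‖LP1 ν z‖ := by ring
        _ ≤ 2 * (z ^ 2 - 1) * ‖LP1 ν z‖ := by gcongr
        _ ≤ 2 * (L * C / (σ + 1) * (z ^ σ * z)) := by linarith
        _ = _ := by ring
    refine ⟨h z (by linarith), a1, ?_⟩
    have e2 : ((z : ℂ) ^ 2 - 1) * LP2 ν z = ν * (ν + 1) * legendreP ν z - 2 * z * LP1 ν z := by
      rw [← legendre_ode ν hzp]; ring
    have e3 : (z ^ 2 - 1) * ‖LP2 ν z‖ ≤ L * (C * z ^ σ) + 2 * ((2 * (L * C / (σ + 1))) * z ^ σ) := by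
      rw [← e0, ← norm_mul, e2]
      refine (norm_sub_le _ _).trans (add_le_add ?_ ?_)
      · rw [norm_mul]
        have := h z (by linarith)
        gcongr
      · rw [mul_assoc, norm_mul, norm_mul, Complex.norm_real, Real.norm_of_nonneg hzp.le]
        rw [show ‖(2:ℂ)‖ = 2 by simp]
        linarith
    calc ‖LP2 ν z‖ * z ^ 2 ≤ ‖LP2 ν z‖ * (2 * (z ^ 2 - 1)) := by gcongr
      _ ≤ _ := by linarith
  have hsub : Icc z₀ 2 ⊆ Ioi (0:ℝ) := fun x hx => lt_of_lt_of_le hz₀ hx.1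
  have hr : ContinuousOn (fun z : ℝ => z ^ (-σ)) (Icc z₀ 2) := fun x hx =>
    (Real.continuousAt_rpow_const _ _ (Or.inl (hsub hx).ne')).continuousWithinAt
  have cpt : ∀ g : ℝ → ℝ, ContinuousOn g (Icc z₀ 2) → ∃ D : ℝ, ∀ z ∈ Icc z₀ 2, g z ≤ D * z ^ σ := by
    intro g hg
    obtain ⟨D, hD⟩ := isCompact_Icc.exists_bound_of_continuousOn (hg.mul hr)
    refine ⟨D, fun z hz => ?_⟩
    have hzp : 0 < z := hsub hz
    have := (le_abs_self _).trans (hD z hz)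
    simp only [Pi.mul_apply, Real.rpow_neg hzp.le] at this
    rwa [← div_eq_mul_inv, div_le_iff₀ (by positivity)] at this
  obtain ⟨D0, hD0⟩ := cpt _ ((legendreP_continuousOn ν).mono hsub).norm
  obtain ⟨D1, hD1⟩ := cpt _ (((LP1_continuousOn ν).mono hsub).norm.mul continuousOn_id)
  obtain ⟨D2, hD2⟩ := cpt _ (((LP2_continuousOn ν).mono hsub).norm.mul (continuousOn_id.pow 2))
  refine ⟨C + |2 * (L * C / (σ + 1))| + |2 * (L * C + 2 * (2 * (L * C / (σ + 1))))| + |D0| + |D1| + |D2|,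
    by positivity, fun z hz => ?_⟩
  have hzp : 0 < z := by linarith
  have a0 := le_abs_self D0
  have a1 := le_abs_self D1
  have a2 := le_abs_self D2
  have a3 := le_abs_self (2 * (L * C / (σ + 1)))
  have a4 := le_abs_self (2 * (L * C + 2 * (2 * (L * C / (σ + 1)))))
  have p0 := abs_nonneg D0
  have p1 := abs_nonneg D1
  have p2 := abs_nonneg D2
  have p3 := abs_nonneg (2 * (L * C / (σ + 1)))
  have p4 := abs_nonneg (2 * (L * C + 2 * (2 * (L * C / (σ + 1)))))
  rcases le_total z 2 with h | h
  · refine ⟨(hD0 z ⟨hz, h⟩).trans ?_, (hD1 z ⟨hz, h⟩).trans ?_, (hD2 z ⟨hz, h⟩).trans ?_⟩ <;>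
    · gcongr
      linarith
  · obtain ⟨b0, b1, b2⟩ := big z h
    refine ⟨b0.trans ?_, b1.trans ?_, b2.trans ?_⟩ <;>
    · gcongr
      linarith


/-- The variable `(1 - tanh t)/2`. -/
noncomputable def wv (t : ℝ) : ℝ := 1 / (Real.exp (2 * t) + 1)

theorem wv_pos (t : ℝ) : 0 < wv t := by unfold wv; positivity

theorem wv_lt (t : ℝ) : wv t < 1 := by
  unfold wv
  rw [div_lt_one (by positivity)]
  linarith [Real.exp_pos (2 * t)]

theorem wv_norm_lt (t : ℝ) : ‖(wv t : ℂ)‖ < 1 := by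
  rw [Complex.norm_real, Real.norm_of_nonneg (wv_pos t).le]
  exact wv_lt t

theorem wv_le (t : ℝ) : wv t ≤ Real.exp (-2 * t) := by
  unfold wv
  rw [show -2 * t = -(2 * t) by ring, Real.exp_neg, ← one_div]
  exact one_div_le_one_div_of_le (Real.exp_pos _) (by linarith)

theorem wv_anti {s t : ℝ} (h : s ≤ t) : wv t ≤ wv s := by
  unfold wv
  exact one_div_le_one_div_of_le (by positivity) (by gcongr)

theorem wv_hasDerivAt (t : ℝ) : HasDerivAt wv (-2 * wv t * (1 - wv t)) t := by
  have h : HasDerivAt (fun t => Real.exp (2 * t) + 1) (Real.exp (2 * t) * 2) t :=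
    (((hasDerivAt_id t).const_mul 2).exp.add_const 1).congr_deriv (by simp)
  have hp : Real.exp (2 * t) + 1 ≠ 0 := by positivity
  refine ((hasDerivAt_const t (1:ℝ)).div h hp).congr_deriv ?_
  unfold wv
  field_simp
  ring

theorem wv_cosh (t : ℝ) : 4 * wv t * (1 - wv t) = 1 / Real.cosh t ^ 2 := by
  unfold wv
  have e1 : Real.exp (2 * t) = Real.exp t ^ 2 := by rw [← Real.exp_nat_mul]; norm_num
  have := Real.exp_pos t
  rw [Real.cosh_eq, Real.exp_neg, e1]
  field_simp
  ring

/-- The Ferrers function in the variable `t = artanh x`. -/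
noncomputable def ff (ν μ : ℂ) (t : ℝ) : ℂ :=
  Complex.exp (-μ * t) * hyp2F1reg (-ν) (ν + 1) (1 + μ) (wv t)

/-- The derivative of `ff`. -/
noncomputable def ff1 (ν μ : ℂ) (t : ℝ) : ℂ :=
  Complex.exp (-μ * t) * (-μ * hyp2F1reg (-ν) (ν + 1) (1 + μ) (wv t)
    + -2 * wv t * (1 - wv t) * (-ν * (ν + 1) * hyp2F1reg (-ν + 1) (ν + 1 + 1) (1 + μ + 1) (wv t)))

theorem wvc_hasDerivAt (t : ℝ) : HasDerivAt (fun t => (wv t : ℂ)) (-2 * wv t * (1 - wv t)) t := by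
  refine (wv_hasDerivAt t).ofReal_comp.congr_deriv ?_
  push_cast
  ring

theorem hypwv_hasDerivAt (a b c : ℂ) (t : ℝ) :
    HasDerivAt (fun t => hyp2F1reg a b c (wv t))
      (a * b * hyp2F1reg (a+1) (b+1) (c+1) (wv t) * (-2 * wv t * (1 - wv t))) t :=
  HasDerivAt.comp t (hyp_hasDerivAt a b c (wv_norm_lt t)) (wvc_hasDerivAt t)

theorem cexp_hasDerivAt (μ : ℂ) (t : ℝ) :
    HasDerivAt (fun t : ℝ => Complex.exp (-μ * t)) (-μ * Complex.exp (-μ * t)) t := by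
  have h0 : HasDerivAt (fun z : ℝ => (z : ℂ)) 1 t := Complex.ofRealCLM.hasDerivAt
  refine ((h0.const_mul (-μ)).cexp).congr_deriv ?_
  ring

theorem ff_hasDerivAt (ν μ : ℂ) (t : ℝ) : HasDerivAt (ff ν μ) (ff1 ν μ t) t := by
  refine ((cexp_hasDerivAt μ t).mul (hypwv_hasDerivAt (-ν) (ν+1) (1+μ) t)).congr_deriv ?_
  unfold ff1
  ring

theorem ff1_hasDerivAt (ν μ : ℂ) (t : ℝ) :
    HasDerivAt (ff1 ν μ) ((μ ^ 2 - ν * (ν + 1) * (1 / Real.cosh t ^ 2 : ℝ)) * ff ν μ t) t := by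
  refine ((cexp_hasDerivAt μ t).mul (((hypwv_hasDerivAt (-ν) (ν+1) (1+μ) t).const_mul (-μ)).add
    ((((wvc_hasDerivAt t).const_mul (-2)).mul ((wvc_hasDerivAt t).const_sub 1)).mul
      ((hypwv_hasDerivAt (-ν+1) (ν+1+1) (1+μ+1) t).const_mul (-ν*(ν+1)))))).congr_deriv ?_
  have h := hyp_ode (-ν) (ν+1) (1+μ) (wv_norm_lt t)
  rw [← wv_cosh]
  unfold ff
  simp only [Pi.mul_apply, Pi.add_apply]
  push_cast
  linear_combination (Complex.exp (-μ * t)) * (4 * wv t * (1 - wv t)) * h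

theorem ff_continuous (ν μ : ℂ) : Continuous (ff ν μ) :=
  continuous_iff_continuousAt.2 fun t => (ff_hasDerivAt ν μ t).continuousAt

theorem ff1_continuous (ν μ : ℂ) : Continuous (ff1 ν μ) :=
  continuous_iff_continuousAt.2 fun t => (ff1_hasDerivAt ν μ t).continuousAt

theorem norm_cexp (μ : ℂ) (t : ℝ) : ‖Complex.exp (-μ * t)‖ = Real.exp (-μ.re * t) := by
  rw [Complex.norm_exp]
  simp

theorem hypwv_bound (a b c : ℂ) (T : ℝ) : ∃ C : ℝ, 0 < C ∧ ∀ t, T ≤ t → ‖hyp2F1reg a b c (wv t)‖ ≤ C := by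
  have hc : ContinuousOn (hyp2F1reg a b c) (Metric.closedBall 0 (wv T)) := by
    intro w hw
    refine (hyp_hasDerivAt a b c ?_).continuousAt.continuousWithinAt
    exact (mem_closedBall_zero_iff.1 hw).trans_lt (wv_lt T)
  obtain ⟨C, hC⟩ := (isCompact_closedBall (0:ℂ) (wv T)).exists_bound_of_continuousOn hc
  refine ⟨|C| + 1, by positivity, fun t ht => (hC _ ?_).trans (by linarith [le_abs_self C])⟩
  rw [mem_closedBall_zero_iff, Complex.norm_real, Real.norm_of_nonneg (wv_pos t).le]
  exact wv_anti ht

theorem ff_bounds (ν μ : ℂ) (T : ℝ) : ∃ C : ℝ, 0 < C ∧ ∀ t, T ≤ t →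
    ‖ff ν μ t‖ ≤ C * Real.exp (-μ.re * t) ∧ ‖ff1 ν μ t‖ ≤ C * Real.exp (-μ.re * t) ∧
    ‖ff1 ν μ t + μ * ff ν μ t‖ ≤ C * Real.exp (-(μ.re + 2) * t) := by
  obtain ⟨C0, hC0, h0⟩ := hypwv_bound (-ν) (ν + 1) (1 + μ) T
  obtain ⟨C1, hC1, h1⟩ := hypwv_bound (-ν + 1) (ν + 1 + 1) (1 + μ + 1) T
  have hD : ∀ t, T ≤ t → ‖-2 * (wv t : ℂ) * (1 - wv t) * (-ν * (ν + 1) * hyp2F1reg (-ν + 1) (ν + 1 + 1) (1 + μ + 1) (wv t))‖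
      ≤ 2 * wv t * (‖-ν * (ν+1)‖ * C1) := by
    intro t ht
    have e : ‖-2 * (wv t : ℂ) * (1 - wv t)‖ ≤ 2 * wv t := by
      rw [show -2 * (wv t : ℂ) * (1 - wv t) = ((-2 * wv t * (1 - wv t) : ℝ) : ℂ) by push_cast; rfl,
        Complex.norm_real, Real.norm_eq_abs, abs_le]
      constructor <;> nlinarith [wv_pos t, wv_lt t, mul_pos (wv_pos t) (sub_pos.2 (wv_lt t)), sq_nonneg (wv t)]
    rw [norm_mul, norm_mul (-ν * (ν+1))]
    have := h1 t ht
    have := wv_pos t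
    gcongr
  refine ⟨C0 + ‖μ‖ * C0 + 2 * (‖-ν * (ν+1)‖ * C1), by positivity, fun t ht => ⟨?_, ?_, ?_⟩⟩
  · unfold ff
    rw [norm_mul, norm_cexp, mul_comm]
    gcongr
    refine (h0 t ht).trans ?_
    have : 0 ≤ ‖μ‖ * C0 + 2 * (‖-ν * (ν+1)‖ * C1) := by positivity
    linarith
  · unfold ff1
    rw [norm_mul, norm_cexp, mul_comm]
    gcongr
    refine (norm_add_le _ _).trans ?_
    have a1 := hD t ht
    have a2 : ‖-μ * hyp2F1reg (-ν) (ν + 1) (1 + μ) (wv t)‖ ≤ ‖μ‖ * C0 := by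
      rw [norm_mul, norm_neg]
      gcongr
      exact h0 t ht
    have a3 : 2 * wv t * (‖-ν * (ν+1)‖ * C1) ≤ 2 * 1 * (‖-ν * (ν+1)‖ * C1) := by
      gcongr
      exact (wv_lt t).le
    linarith
  · have e : ff1 ν μ t + μ * ff ν μ t = Complex.exp (-μ * t) * (-2 * wv t * (1 - wv t) * (-ν * (ν + 1) * hyp2F1reg (-ν + 1) (ν + 1 + 1) (1 + μ + 1) (wv t))) := by
      unfold ff1 ff
      ring
    rw [e, norm_mul, norm_cexp]
    have a1 := hD t ht
    have a2 := wv_le t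
    have e2 : Real.exp (-(μ.re + 2) * t) = Real.exp (-μ.re * t) * Real.exp (-2 * t) := by
      rw [← Real.exp_add]; ring_nf
    rw [e2]
    calc _ ≤ Real.exp (-μ.re * t) * (2 * Real.exp (-2 * t) * (‖-ν * (ν+1)‖ * C1)) := by
          gcongr
          refine a1.trans ?_
          gcongr
      _ = (2 * (‖-ν * (ν+1)‖ * C1)) * (Real.exp (-μ.re * t) * Real.exp (-2 * t)) := by ring
      _ ≤ _ := by
        gcongr
        have : 0 ≤ C0 + ‖μ‖ * C0 := by positivity
        linarith

theorem wv_tendsto : Tendsto (fun t => (wv t : ℂ)) atTop (𝓝 0) := by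
  have : Tendsto wv atTop (𝓝 0) := by
    refine squeeze_zero (fun t => (wv_pos t).le) wv_le ?_
    refine Real.tendsto_exp_atBot.comp ?_
    exact tendsto_id.const_mul_atTop_of_neg (by norm_num)
  rw [← Complex.ofReal_zero]
  exact (Complex.continuous_ofReal.tendsto 0).comp this

theorem hyp_zero (a b c : ℂ) : hyp2F1reg a b c 0 = 1 / Complex.Gamma c := by
  unfold hyp2F1reg
  rw [tsum_eq_single 0]
  · simp
  · intro n hn
    simp [hn]

theorem ff_lim (ν μ : ℂ) : Tendsto (fun t : ℝ => Complex.exp (μ * t) * ff ν μ t) atTop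
    (𝓝 (1 / Complex.Gamma (1 + μ))) := by
  rw [← hyp_zero (-ν) (ν + 1) (1 + μ)]
  have h := (hyp_hasDerivAt (-ν) (ν+1) (1+μ) (w := 0) (by simp)).continuousAt.tendsto.comp wv_tendsto
  refine h.congr fun t => ?_
  unfold ff
  rw [← mul_assoc, ← Complex.exp_add]
  simp


/-- The kernel argument along `t₁ = τ`, `t₃ = τ + r`, with `Y = cosh t₂`. -/
noncomputable def Bk (Y τ r : ℝ) : ℝ :=
  (Y ^ 2 + Real.cosh (2 * τ + r) * Real.cosh r) / (Y * (Real.cosh (2 * τ + r) + Real.cosh r))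

/-- `∂τ Bk`. -/
noncomputable def Bt (Y τ r : ℝ) : ℝ :=
  2 * Real.sinh (2 * τ + r) * (Real.cosh r ^ 2 - Y ^ 2) /
    (Y * (Real.cosh (2 * τ + r) + Real.cosh r) ^ 2)

/-- `∂τ Bt`. -/
noncomputable def Btt (Y τ r : ℝ) : ℝ :=
  4 * (Real.cosh r ^ 2 - Y ^ 2) * (Real.cosh (2 * τ + r) ^ 2 + Real.cosh (2 * τ + r) * Real.cosh r
    - 2 * Real.sinh (2 * τ + r) ^ 2) / (Y * (Real.cosh (2 * τ + r) + Real.cosh r) ^ 3)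

/-- `∂r Bk`. -/
noncomputable def Br (Y τ r : ℝ) : ℝ :=
  ((Real.cosh r ^ 2 - Y ^ 2) * Real.sinh (2 * τ + r) +
    (Real.cosh (2 * τ + r) ^ 2 - Y ^ 2) * Real.sinh r) /
    (Y * (Real.cosh (2 * τ + r) + Real.cosh r) ^ 2)

/-- `∂r Bt`. -/
noncomputable def Btr (Y τ r : ℝ) : ℝ :=
  2 * (Real.cosh (2 * τ + r) * (Real.cosh r ^ 2 - Y ^ 2) * (Real.cosh (2 * τ + r) + Real.cosh r)
    + 2 * Real.sinh (2 * τ + r) * Real.cosh r * Real.sinh r * (Real.cosh (2 * τ + r) + Real.cosh r)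
    - 2 * Real.sinh (2 * τ + r) * (Real.cosh r ^ 2 - Y ^ 2) * (Real.sinh (2 * τ + r) + Real.sinh r)) /
    (Y * (Real.cosh (2 * τ + r) + Real.cosh r) ^ 3)

section
variable {Y : ℝ} (τ r : ℝ)

theorem VR_pos : 0 < Real.cosh (2 * τ + r) + Real.cosh r := by
  have := Real.cosh_pos (2 * τ + r)
  have := Real.cosh_pos r
  positivity

theorem hasDerivAt_V_tau : HasDerivAt (fun τ => Real.cosh (2 * τ + r)) (2 * Real.sinh (2 * τ + r)) τ := by
  refine (((hasDerivAt_id τ).const_mul 2).add_const r).cosh.congr_deriv ?_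
  simp; ring

theorem hasDerivAt_U_tau : HasDerivAt (fun τ => Real.sinh (2 * τ + r)) (2 * Real.cosh (2 * τ + r)) τ := by
  refine (((hasDerivAt_id τ).const_mul 2).add_const r).sinh.congr_deriv ?_
  simp; ring

theorem hasDerivAt_V_r : HasDerivAt (fun r => Real.cosh (2 * τ + r)) (Real.sinh (2 * τ + r)) r := by
  refine ((hasDerivAt_id r).const_add (2 * τ)).cosh.congr_deriv ?_
  simp

theorem hasDerivAt_U_r : HasDerivAt (fun r => Real.sinh (2 * τ + r)) (Real.cosh (2 * τ + r)) r := by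
  refine ((hasDerivAt_id r).const_add (2 * τ)).sinh.congr_deriv ?_
  simp

theorem Bk_hasDerivAt_tau {Y : ℝ} (hY : 1 ≤ Y) (τ r : ℝ) : HasDerivAt (fun τ => Bk Y τ r) (Bt Y τ r) τ := by
  have h := VR_pos τ r
  have hY0 : 0 < Y := by linarith
  refine ((((hasDerivAt_V_tau τ r).mul_const (Real.cosh r)).const_add (Y ^ 2)).div
    (((hasDerivAt_V_tau τ r).add_const (Real.cosh r)).const_mul Y) (by positivity)).congr_deriv ?_
  unfold Bt
  field_simp
  ring

theorem Bt_hasDerivAt_tau {Y : ℝ} (hY : 1 ≤ Y) (τ r : ℝ) : HasDerivAt (fun τ => Bt Y τ r) (Btt Y τ r) τ := by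
  have h := VR_pos τ r
  have hY0 : 0 < Y := by linarith
  refine ((((hasDerivAt_U_tau τ r).const_mul 2).mul_const (Real.cosh r ^ 2 - Y ^ 2)).div
    ((((hasDerivAt_V_tau τ r).add_const (Real.cosh r)).pow 2).const_mul Y) (by simp only [Pi.pow_apply]; positivity)).congr_deriv ?_
  unfold Btt
  simp only [Pi.pow_apply]
  field_simp
  push_cast
  ring

theorem Bk_hasDerivAt_r {Y : ℝ} (hY : 1 ≤ Y) (τ r : ℝ) : HasDerivAt (fun r => Bk Y τ r) (Br Y τ r) r := by
  have h := VR_pos τ r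
  have hY0 : 0 < Y := by linarith
  refine ((((hasDerivAt_V_r τ r).mul (Real.hasDerivAt_cosh r)).const_add (Y ^ 2)).div
    (((hasDerivAt_V_r τ r).add (Real.hasDerivAt_cosh r)).const_mul Y) (by simp; constructor <;> positivity)).congr_deriv ?_
  unfold Br
  simp only [Pi.mul_apply, Pi.add_apply]
  field_simp
  ring

theorem Bt_hasDerivAt_r {Y : ℝ} (hY : 1 ≤ Y) (τ r : ℝ) : HasDerivAt (fun r => Bt Y τ r) (Btr Y τ r) r := by
  have h := VR_pos τ r
  have hY0 : 0 < Y := by linarith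
  refine ((((hasDerivAt_U_r τ r).const_mul 2).mul (((Real.hasDerivAt_cosh r).pow 2).sub_const (Y ^ 2))).div
    ((((hasDerivAt_V_r τ r).add (Real.hasDerivAt_cosh r)).pow 2).const_mul Y) (by simp; constructor <;> positivity)).congr_deriv ?_
  unfold Btr
  simp only [Pi.mul_apply, Pi.add_apply, Pi.pow_apply]
  field_simp
  push_cast
  ring

theorem VR_eq : Real.cosh (2 * τ + r) + Real.cosh r = 2 * Real.cosh τ * Real.cosh (τ + r) := by
  have e1 : 2 * τ + r = (τ + r) + τ := by ring
  have e2 : Real.cosh r = Real.cosh ((τ + r) - τ) := by ring_nf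
  rw [e1, e2, Real.cosh_add, Real.cosh_sub]
  ring

theorem VR_mul : Real.cosh (2 * τ + r) * Real.cosh r = Real.cosh τ ^ 2 + Real.cosh (τ + r) ^ 2 - 1 := by
  have e1 : 2 * τ + r = (τ + r) + τ := by ring
  have e2 : Real.cosh r = Real.cosh ((τ + r) - τ) := by ring_nf
  rw [e1, e2, Real.cosh_add, Real.cosh_sub]
  have h1 := Real.cosh_sq τ
  have h2 := Real.cosh_sq (τ + r)
  linear_combination (Real.sinh τ ^2) * h2 + (Real.cosh (τ+r) ^ 2 - 1) * h1

theorem US_mul : Real.sinh (2 * τ + r) * Real.sinh r = Real.cosh (τ + r) ^ 2 - Real.cosh τ ^ 2 := by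
  have e1 : 2 * τ + r = (τ + r) + τ := by ring
  have e2 : Real.sinh r = Real.sinh ((τ + r) - τ) := by ring_nf
  rw [e1, e2, Real.sinh_add, Real.sinh_sub]
  have h1 := Real.cosh_sq τ
  have h2 := Real.cosh_sq (τ + r)
  linear_combination (-Real.cosh τ ^2) * h2 + (Real.cosh (τ+r) ^ 2) * h1

theorem Bk_eq : Bk Y τ r = (Real.cosh τ ^ 2 + Y ^ 2 + Real.cosh (τ + r) ^ 2 - 1) /
    (2 * Real.cosh τ * Y * Real.cosh (τ + r)) := by
  unfold Bk
  rw [VR_eq, VR_mul]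
  congr 1 <;> ring

theorem sech_diff : 4 * Real.sinh (2 * τ + r) * Real.sinh r / (Real.cosh (2 * τ + r) + Real.cosh r) ^ 2 =
    1 / Real.cosh τ ^ 2 - 1 / Real.cosh (τ + r) ^ 2 := by
  rw [VR_eq, mul_assoc, US_mul]
  have := Real.cosh_pos τ
  have := Real.cosh_pos (τ + r)
  field_simp
  ring

theorem B_id1 {Y : ℝ} (hY : 1 ≤ Y) (τ r : ℝ) : Bt Y τ r ^ 2 - 2 * Br Y τ r * Bt Y τ r =
    -(1 / Real.cosh τ ^ 2 - 1 / Real.cosh (τ + r) ^ 2) * (Bk Y τ r ^ 2 - 1) := by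
  rw [← sech_diff]
  unfold Bt Br Bk
  have h := VR_pos τ r
  have hY0 : 0 < Y := by linarith
  field_simp
  ring

theorem B_id2 {Y : ℝ} (hY : 1 ≤ Y) (τ r : ℝ) : Btt Y τ r - 2 * Btr Y τ r =
    -(1 / Real.cosh τ ^ 2 - 1 / Real.cosh (τ + r) ^ 2) * (2 * Bk Y τ r) := by
  rw [← sech_diff]
  unfold Btt Btr Bk
  have h := VR_pos τ r
  have hY0 : 0 < Y := by linarith
  field_simp
  ring

theorem Bk_ge {Y : ℝ} (hY : 1 ≤ Y) (τ r : ℝ) : 1 / Y ≤ Bk Y τ r := by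
  unfold Bk
  have h := VR_pos τ r
  have hY0 : 0 < Y := by linarith
  have h1 := Real.one_le_cosh (2 * τ + r)
  have h2 := Real.one_le_cosh r
  rw [div_le_div_iff₀ hY0 (by positivity)]
  have : Real.cosh (2 * τ + r) + Real.cosh r ≤ Y ^ 2 + Real.cosh (2 * τ + r) * Real.cosh r := by nlinarith
  nlinarith

theorem Bk_pos {Y : ℝ} (hY : 1 ≤ Y) (τ r : ℝ) : 0 < Bk Y τ r := by
  have hY0 : 0 < Y := by linarith
  exact lt_of_lt_of_le (by positivity) (Bk_ge hY τ r)

theorem abs_sinh_le (x : ℝ) : |Real.sinh x| ≤ Real.cosh x := by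
  refine abs_le_of_sq_le_sq ?_ (Real.cosh_pos x).le
  rw [Real.sinh_sq]; linarith

theorem half_exp_le_cosh (x : ℝ) : Real.exp x / 2 ≤ Real.cosh x := by
  rw [Real.cosh_eq]; linarith [Real.exp_pos (-x)]
end

/-- Uniform bounds for the kernel argument. -/
theorem B_bounds {Y : ℝ} (hY : 1 ≤ Y) (T s : ℝ) : ∃ c C : ℝ, 0 < c ∧ 0 < C ∧ ∀ τ r, T ≤ τ → s ≤ r →
    c * Real.exp r ≤ Bk Y τ r ∧ Bk Y τ r ≤ C * Real.exp r ∧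
    |Bt Y τ r| ≤ C * Real.exp (-2 * τ) * Bk Y τ r ∧ |Btt Y τ r| ≤ C * Real.exp (-2 * τ) * Bk Y τ r := by
  have hY0 : 0 < Y := by linarith
  -- cosh r ≤ K e^r
  set K := 1 + Real.exp (-2 * s) with hK
  have hKp : 0 < K := by positivity
  have hcR : ∀ r, s ≤ r → Real.cosh r ≤ K * Real.exp r := by
    intro r hr
    have : Real.exp (-r) ≤ Real.exp (-2 * s) * Real.exp r := by
      rw [← Real.exp_add]; apply Real.exp_le_exp.2; linarith
    rw [Real.cosh_eq, hK]
    nlinarith [Real.exp_pos r, Real.exp_pos (-r)]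
  have hcV : ∀ τ r, Real.exp (2 * τ) * Real.exp r / 2 ≤ Real.cosh (2 * τ + r) := by
    intro τ r
    rw [← Real.exp_add]; exact half_exp_le_cosh _
  have hYr : ∀ r, s ≤ r → Y ≤ (Y * Real.exp (-s)) * Real.exp r := by
    intro r hr
    rw [mul_assoc, ← Real.exp_add]
    have : 1 ≤ Real.exp (-s + r) := Real.one_le_exp (by linarith)
    nlinarith
  -- R ≤ K' V
  set K' := 2 * K * Real.exp (-2 * T) with hK'
  have hK'p : 0 < K' := by positivity
  have hRV : ∀ τ r, T ≤ τ → s ≤ r → Real.cosh r ≤ K' * Real.cosh (2 * τ + r) := by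
    intro τ r hτ hr
    have h1 := hcV τ r
    have h2 := hcR r hr
    have h3 : Real.exp (2 * T) ≤ Real.exp (2 * τ) := by gcongr
    have h4 : Real.exp (-2 * T) * Real.exp (2 * T) = 1 := by rw [← Real.exp_add]; simp
    calc Real.cosh r ≤ K * Real.exp r := h2
      _ = K' * (Real.exp (2 * T) * Real.exp r / 2) := by
        rw [hK']; linear_combination (-K * Real.exp r) * h4
      _ ≤ K' * (Real.exp (2 * τ) * Real.exp r / 2) := by gcongr
      _ ≤ _ := by gcongr
  set c := 1 / (2 * Y * (1 + K')) with hc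
  have hcp : 0 < c := by positivity
  have lower : ∀ τ r, T ≤ τ → s ≤ r → c * Real.exp r ≤ Bk Y τ r := by
    intro τ r hτ hr
    have h1 := hRV τ r hτ hr
    have h2 := half_exp_le_cosh r
    have hV := Real.cosh_pos (2 * τ + r)
    have hR := Real.cosh_pos r
    unfold Bk
    rw [le_div_iff₀ (by positivity)]
    calc c * Real.exp r * (Y * (Real.cosh (2 * τ + r) + Real.cosh r))
        ≤ c * (2 * Real.cosh r) * (Y * (Real.cosh (2 * τ + r) + K' * Real.cosh (2 * τ + r))) := by
          gcongr; linarith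
      _ = Real.cosh (2 * τ + r) * Real.cosh r := by rw [hc]; field_simp
      _ ≤ _ := by nlinarith [sq_nonneg Y]
  set C1 := Y * Real.exp (-s) + K with hC1
  have upper : ∀ τ r, T ≤ τ → s ≤ r → Bk Y τ r ≤ C1 * Real.exp r := by
    intro τ r hτ hr
    have hV := Real.one_le_cosh (2 * τ + r)
    have hR := Real.one_le_cosh r
    have h1 : Bk Y τ r ≤ Y + Real.cosh r := by
      unfold Bk
      rw [div_le_iff₀ (by positivity)]
      nlinarith [mul_nonneg (sub_nonneg.2 hY) (mul_nonneg (by linarith : 0 ≤ Real.cosh (2 * τ + r)) (by linarith : 0 ≤ Real.cosh r)),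
        mul_pos hY0 hY0, mul_nonneg (mul_pos hY0 hY0).le (sub_nonneg.2 hV), mul_nonneg (mul_pos hY0 hY0).le (sub_nonneg.2 hR), mul_nonneg hY0.le (sq_nonneg (Real.cosh r))]
    have := hYr r hr
    have := hcR r hr
    rw [hC1]
    linarith [h1]
  -- (R²+Y²)/(Y V) ≤ D e^{-2τ} β
  set D := 2 * C1 ^ 2 / Y / c with hD
  have hC1p : 0 < C1 := by positivity
  have key : ∀ τ r, T ≤ τ → s ≤ r → (Real.cosh r ^ 2 + Y ^ 2) / (Y * Real.cosh (2 * τ + r)) ≤ D * Real.exp (-2 * τ) * Bk Y τ r := by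
    intro τ r hτ hr
    have h1 := hcV τ r
    have h2 : Real.cosh r ^ 2 + Y ^ 2 ≤ (C1 * Real.exp r) ^ 2 := by
      have a := hYr r hr
      have b := hcR r hr
      have hR := Real.one_le_cosh r
      have : Y + Real.cosh r ≤ C1 * Real.exp r := by rw [hC1]; linarith
      calc _ ≤ (Y + Real.cosh r) ^ 2 := by nlinarith
        _ ≤ _ := by gcongr
    have h3 := lower τ r hτ hr
    have e : Real.exp (-2 * τ) * Real.exp (2 * τ) = 1 := by rw [← Real.exp_add]; simp
    calc _ ≤ (C1 * Real.exp r) ^ 2 / (Y * (Real.exp (2 * τ) * Real.exp r / 2)) := by gcongr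
      _ = D * Real.exp (-2 * τ) * (c * Real.exp r) := by
        rw [show Real.exp (-2 * τ) = (Real.exp (2 * τ))⁻¹ from eq_inv_of_mul_eq_one_left e, hD]
        field_simp
      _ ≤ _ := by gcongr
  refine ⟨c, C1 + 12 * D, hcp, by positivity, fun τ r hτ hr => ⟨lower τ r hτ hr, ?_, ?_, ?_⟩⟩
  · refine (upper τ r hτ hr).trans ?_
    gcongr
    have : 0 < D := by positivity
    linarith
  · have hk := key τ r hτ hr
    have hV := Real.one_le_cosh (2 * τ + r)
    have hR := Real.one_le_cosh r
    have hU := abs_sinh_le (2 * τ + r)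
    have hB := Bk_pos hY τ r
    have hd : |Real.cosh r ^ 2 - Y ^ 2| ≤ Real.cosh r ^ 2 + Y ^ 2 := by
      rw [abs_le]; constructor <;> nlinarith [sq_nonneg Y, sq_nonneg (Real.cosh r)]
    have h1 : |Bt Y τ r| ≤ 2 * ((Real.cosh r ^ 2 + Y ^ 2) / (Y * Real.cosh (2 * τ + r))) := by
      unfold Bt
      rw [abs_div, abs_mul, abs_mul, abs_of_pos (by positivity : 0 < Y * (Real.cosh (2 * τ + r) + Real.cosh r) ^ 2), abs_two]
      calc _ ≤ 2 * Real.cosh (2 * τ + r) * (Real.cosh r ^ 2 + Y ^ 2) / (Y * (Real.cosh (2 * τ + r) + 0) ^ 2) := by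
            gcongr
            linarith
        _ = _ := by field_simp; ring
    refine h1.trans ((mul_le_mul_of_nonneg_left hk zero_le_two).trans ?_)
    have : 0 < D := by positivity
    rw [← mul_assoc, ← mul_assoc]
    gcongr
    linarith
  · have hk := key τ r hτ hr
    have hV := Real.one_le_cosh (2 * τ + r)
    have hR := Real.one_le_cosh r
    have hU := abs_sinh_le (2 * τ + r)
    have hB := Bk_pos hY τ r
    have hd : |Real.cosh r ^ 2 - Y ^ 2| ≤ Real.cosh r ^ 2 + Y ^ 2 := by
      rw [abs_le]; constructor <;> nlinarith [sq_nonneg Y, sq_nonneg (Real.cosh r)]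
    have hd2 : |Real.cosh (2 * τ + r) ^ 2 + Real.cosh (2 * τ + r) * Real.cosh r
        - 2 * Real.sinh (2 * τ + r) ^ 2| ≤ 3 * (Real.cosh (2 * τ + r) + Real.cosh r) ^ 2 := by
      have e := Real.sinh_sq (2 * τ + r)
      rw [e, abs_le]; constructor <;> nlinarith [sq_nonneg (Real.cosh r), mul_pos (by linarith : 0 < Real.cosh (2 * τ + r)) (by linarith : 0 < Real.cosh r)]
    have h1 : |Btt Y τ r| ≤ 12 * ((Real.cosh r ^ 2 + Y ^ 2) / (Y * Real.cosh (2 * τ + r))) := by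
      unfold Btt
      rw [abs_div, abs_mul, abs_mul, abs_of_pos (by positivity : 0 < Y * (Real.cosh (2 * τ + r) + Real.cosh r) ^ 3), abs_of_pos (by norm_num : (0:ℝ) < 4)]
      calc _ ≤ 4 * (Real.cosh r ^ 2 + Y ^ 2) * (3 * (Real.cosh (2 * τ + r) + Real.cosh r) ^ 2) / (Y * (Real.cosh (2 * τ + r) + Real.cosh r) ^ 3) := by
            gcongr
        _ = 12 * ((Real.cosh r ^ 2 + Y ^ 2) / (Y * (Real.cosh (2 * τ + r) + Real.cosh r))) := by
            have := VR_pos τ r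
            field_simp; ring
        _ ≤ _ := by gcongr; linarith
    refine h1.trans ((mul_le_mul_of_nonneg_left hk (by norm_num)).trans ?_)
    rw [← mul_assoc, ← mul_assoc]
    gcongr
    linarith


theorem rpow_two_sided {c C σ r x : ℝ} (hc : 0 < c) (hC : 0 < C) (h1 : c * Real.exp r ≤ x)
    (h2 : x ≤ C * Real.exp r) : x ^ σ ≤ (c ^ σ + C ^ σ) * Real.exp (σ * r) := by
  have he := Real.exp_pos r
  have hx : 0 < x := lt_of_lt_of_le (by positivity) h1
  have e : ∀ a : ℝ, 0 < a → (a * Real.exp r) ^ σ = a ^ σ * Real.exp (σ * r) := by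
    intro a ha
    rw [Real.mul_rpow ha.le he.le, ← Real.exp_mul, mul_comm r σ]
  have p1 := Real.rpow_pos_of_pos hc σ
  have p2 := Real.rpow_pos_of_pos hC σ
  have p3 := Real.exp_pos (σ * r)
  rcases le_total 0 σ with hs | hs
  · have := Real.rpow_le_rpow hx.le h2 hs
    rw [e C hC] at this
    nlinarith
  · have := Real.rpow_le_rpow_of_nonpos (by positivity) h1 hs
    rw [e c hc] at this
    nlinarith

theorem kerP_bounds (ν : ℂ) (σ : ℝ) (h1 : ν.re < σ) (h2 : -1 - ν.re ≤ σ) {Y : ℝ} (hY : 1 ≤ Y) (T s : ℝ) :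
    ∃ A : ℝ, 0 < A ∧ ∀ τ r, T ≤ τ → s ≤ r →
      ‖legendreP ν (Bk Y τ r)‖ ≤ A * Real.exp (σ * r) ∧
      ‖LP1 ν (Bk Y τ r)‖ * |Bt Y τ r| ≤ A * Real.exp (-2 * τ) * Real.exp (σ * r) ∧
      ‖LP1 ν (Bk Y τ r)‖ * |Btt Y τ r| ≤ A * Real.exp (-2 * τ) * Real.exp (σ * r) ∧
      ‖LP2 ν (Bk Y τ r)‖ * |Bt Y τ r| ^ 2 ≤ A * Real.exp (-2 * τ) ^ 2 * Real.exp (σ * r) := by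
  have hY0 : 0 < Y := by linarith
  obtain ⟨c, C, hc, hC, hB⟩ := B_bounds hY T s
  obtain ⟨L, hL, hl⟩ := legendre_bounds ν σ h1 h2 (1 / Y) (by positivity)
  set D := c ^ σ + C ^ σ with hD
  have hDp : 0 < D := by positivity
  refine ⟨L * D + C * (L * D) + C ^ 2 * (L * D), by positivity, fun τ r hτ hr => ?_⟩
  obtain ⟨b1, b2, b3, b4⟩ := hB τ r hτ hr
  obtain ⟨l0, l1, l2⟩ := hl _ (Bk_ge hY τ r)
  have hp := rpow_two_sided (σ := σ) hc hC b1 b2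
  rw [← hD] at hp
  have hBp := Bk_pos hY τ r
  have q : L * Bk Y τ r ^ σ ≤ L * D * Real.exp (σ * r) := by
    rw [mul_assoc]; gcongr
  have e1 := Real.exp_pos (σ * r)
  have e2 := Real.exp_pos (-2 * τ)
  refine ⟨?_, ?_, ?_, ?_⟩
  · refine (l0.trans q).trans ?_
    gcongr
    have : 0 < C * (L * D) + C ^ 2 * (L * D) := by positivity
    linarith
  · calc _ ≤ ‖LP1 ν (Bk Y τ r)‖ * (C * Real.exp (-2 * τ) * Bk Y τ r) := by gcongr
      _ = C * Real.exp (-2 * τ) * (‖LP1 ν (Bk Y τ r)‖ * Bk Y τ r) := by ring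
      _ ≤ C * Real.exp (-2 * τ) * (L * D * Real.exp (σ * r)) := by exact mul_le_mul_of_nonneg_left (l1.trans q) (by positivity)
      _ = (C * (L * D)) * Real.exp (-2 * τ) * Real.exp (σ * r) := by ring
      _ ≤ _ := by
        gcongr
        have : 0 < L * D + C ^ 2 * (L * D) := by positivity
        linarith
  · calc _ ≤ ‖LP1 ν (Bk Y τ r)‖ * (C * Real.exp (-2 * τ) * Bk Y τ r) := by gcongr
      _ = C * Real.exp (-2 * τ) * (‖LP1 ν (Bk Y τ r)‖ * Bk Y τ r) := by ring
      _ ≤ C * Real.exp (-2 * τ) * (L * D * Real.exp (σ * r)) := by exact mul_le_mul_of_nonneg_left (l1.trans q) (by positivity)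
      _ = (C * (L * D)) * Real.exp (-2 * τ) * Real.exp (σ * r) := by ring
      _ ≤ _ := by
        gcongr
        have : 0 < L * D + C ^ 2 * (L * D) := by positivity
        linarith
  · calc _ ≤ ‖LP2 ν (Bk Y τ r)‖ * (C * Real.exp (-2 * τ) * Bk Y τ r) ^ 2 := by gcongr
      _ = C ^ 2 * Real.exp (-2 * τ) ^ 2 * (‖LP2 ν (Bk Y τ r)‖ * Bk Y τ r ^ 2) := by ring
      _ ≤ C ^ 2 * Real.exp (-2 * τ) ^ 2 * (L * D * Real.exp (σ * r)) := by exact mul_le_mul_of_nonneg_left (l2.trans q) (by positivity)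
      _ = (C ^ 2 * (L * D)) * Real.exp (-2 * τ) ^ 2 * Real.exp (σ * r) := by ring
      _ ≤ _ := by
        gcongr
        have : 0 < L * D + C * (L * D) := by positivity
        linarith

/-- Integrand. -/
noncomputable def kerz (ν μ : ℂ) (Y τ r : ℝ) : ℂ := ff ν μ (τ + r) * legendreP ν (Bk Y τ r)

/-- `∂τ kerz`. -/
noncomputable def ker1 (ν μ : ℂ) (Y τ r : ℝ) : ℂ :=
  ff1 ν μ (τ + r) * legendreP ν (Bk Y τ r) + ff ν μ (τ + r) * (LP1 ν (Bk Y τ r) * Bt Y τ r)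

/-- `∂τ ker1`. -/
noncomputable def ker2 (ν μ : ℂ) (Y τ r : ℝ) : ℂ :=
  (μ ^ 2 - ν * (ν + 1) * (1 / Real.cosh (τ + r) ^ 2 : ℝ)) * ff ν μ (τ + r) * legendreP ν (Bk Y τ r)
   + 2 * (ff1 ν μ (τ + r) * (LP1 ν (Bk Y τ r) * Bt Y τ r)) +
   ff ν μ (τ + r) * (LP2 ν (Bk Y τ r) * (Bt Y τ r) ^ 2 + LP1 ν (Bk Y τ r) * Btt Y τ r)

/-- The boundary term. -/
noncomputable def kerE (ν μ : ℂ) (Y τ r : ℝ) : ℂ :=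
  2 * ff ν μ (τ + r) * (LP1 ν (Bk Y τ r) * Bt Y τ r)

theorem ker_bounds (ν μ : ℂ) (σ : ℝ) (h1 : ν.re < σ) (h2 : -1 - ν.re ≤ σ) {Y : ℝ} (hY : 1 ≤ Y) (T s : ℝ) :
    ∃ A : ℝ, 0 < A ∧ ∀ τ r, T ≤ τ → s ≤ r →
      ‖kerz ν μ Y τ r‖ ≤ A * Real.exp (-μ.re * τ) * Real.exp ((σ - μ.re) * r) ∧
      ‖ker1 ν μ Y τ r‖ ≤ A * Real.exp (-μ.re * τ) * Real.exp ((σ - μ.re) * r) ∧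
      ‖ker2 ν μ Y τ r‖ ≤ A * Real.exp (-μ.re * τ) * Real.exp ((σ - μ.re) * r) ∧
      ‖kerE ν μ Y τ r‖ ≤ A * Real.exp (-μ.re * τ) * Real.exp ((σ - μ.re) * r) ∧
      ‖ker1 ν μ Y τ r + μ * kerz ν μ Y τ r‖ ≤ A * Real.exp (-(μ.re + 2) * τ) * Real.exp ((σ - μ.re) * r) := by
  obtain ⟨A, hA, hP⟩ := kerP_bounds ν σ h1 h2 hY T s
  obtain ⟨C, hC, hf⟩ := ff_bounds ν μ (T + s)
  set q := Real.exp (-2 * T) with hq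
  have hqp : 0 < q := Real.exp_pos _
  set G := ‖μ ^ 2‖ + ‖ν * (ν + 1)‖ with hG
  have hGp : 0 ≤ G := by positivity
  set ES := Real.exp (-2 * s) with hES
  have hESp : 0 < ES := Real.exp_pos _
  refine ⟨C * A * (1 + (1 + q) + (G + 2 * q + q ^ 2 + q) + 2 * q + (ES + 1)), by positivity, fun τ r hτ hr => ?_⟩
  obtain ⟨p0, p1, p2, p3⟩ := hP τ r hτ hr
  obtain ⟨f0, f1, f2⟩ := hf (τ + r) (by linarith)
  have hqle : Real.exp (-2 * τ) ≤ q := Real.exp_le_exp.2 (by linarith)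
  have hrle : Real.exp (-2 * r) ≤ ES := Real.exp_le_exp.2 (by linarith)
  set x := Real.exp (-2 * τ)
  have hxp : 0 < x := Real.exp_pos _
  have em : Real.exp (-μ.re * (τ + r)) * Real.exp (σ * r) = Real.exp (-μ.re * τ) * Real.exp ((σ - μ.re) * r) := by
    rw [← Real.exp_add, ← Real.exp_add]; ring_nf
  have em2 : Real.exp (-(μ.re + 2) * (τ + r)) * Real.exp (σ * r) = Real.exp (-2 * r) * (Real.exp (-(μ.re + 2) * τ) * Real.exp ((σ - μ.re) * r)) := by
    rw [← Real.exp_add, ← Real.exp_add, ← Real.exp_add]; ring_nf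
  have em3 : x * (Real.exp (-μ.re * τ) * Real.exp ((σ - μ.re) * r)) = (Real.exp (-(μ.re + 2) * τ) * Real.exp ((σ - μ.re) * r)) := by
    rw [← Real.exp_add, ← Real.exp_add, ← Real.exp_add]; ring_nf
  set M := Real.exp (-μ.re * τ) * Real.exp ((σ - μ.re) * r) with hM
  have hMp : 0 < M := by positivity
  set M2 := Real.exp (-(μ.re + 2) * τ) * Real.exp ((σ - μ.re) * r) with hM2
  have hM2p : 0 < M2 := by positivity
  set eμ := Real.exp (-μ.re * (τ + r))
  set eσ := Real.exp (σ * r)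
  have heμ : 0 < eμ := Real.exp_pos _
  have heσ : 0 < eσ := Real.exp_pos _
  have n1 : ‖LP1 ν (Bk Y τ r) * Bt Y τ r‖ ≤ A * x * eσ := by
    rw [norm_mul, Complex.norm_real, Real.norm_eq_abs]; exact p1
  have n2 : ‖LP1 ν (Bk Y τ r) * Btt Y τ r‖ ≤ A * x * eσ := by
    rw [norm_mul, Complex.norm_real, Real.norm_eq_abs]; exact p2
  have n3 : ‖LP2 ν (Bk Y τ r) * (Bt Y τ r) ^ 2‖ ≤ A * x ^ 2 * eσ := by
    rw [norm_mul, norm_pow, Complex.norm_real, Real.norm_eq_abs]; exact p3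
  have fP : ∀ {a b : ℂ} {k : ℝ}, 0 ≤ k → ‖a‖ ≤ C * eμ → ‖b‖ ≤ A * k * eσ → ‖a * b‖ ≤ C * A * k * M := by
    intro a b k hk ha hb
    rw [norm_mul]
    calc ‖a‖ * ‖b‖ ≤ (C * eμ) * (A * k * eσ) := by gcongr
      _ = C * A * k * (eμ * eσ) := by ring
      _ = _ := by rw [em]
  have p0' : ‖legendreP ν (Bk Y τ r)‖ ≤ A * 1 * eσ := by rw [mul_one]; exact p0
  have a00 := fP zero_le_one f0 p0'
  have a10 := fP zero_le_one f1 p0'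
  have a01 := fP hxp.le f0 n1
  have a11 := fP hxp.le f1 n1
  have a02 := fP hxp.le f0 n2
  have a03 := fP (by positivity : 0 ≤ x ^ 2) f0 n3
  have hCA : 0 < C * A * M := by positivity
  have hxq : C * A * x * M ≤ C * A * q * M := by gcongr
  have hxq2 : C * A * x ^ 2 * M ≤ C * A * q ^ 2 * M := by gcongr
  have P1 : 0 ≤ C * A * q * M := by positivity
  have P2 : 0 ≤ C * A * q ^ 2 * M := by positivity
  have P3 : 0 ≤ C * A * G * M := by positivity
  have P4 : 0 ≤ C * A * ES * M := by positivity
  have hsech : ‖μ ^ 2 - ν * (ν + 1) * (1 / Real.cosh (τ + r) ^ 2 : ℝ)‖ ≤ G := by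
    refine (norm_sub_le _ _).trans ?_
    rw [hG]
    gcongr
    rw [norm_mul, Complex.norm_real, Real.norm_of_nonneg (by positivity)]
    refine mul_le_of_le_one_right (norm_nonneg _) ?_
    rw [div_le_one (by positivity)]
    exact one_le_pow₀ (Real.one_le_cosh _)
  rw [mul_assoc _ (Real.exp (-μ.re * τ)), ← hM, mul_assoc _ (Real.exp (-(μ.re + 2) * τ)), ← hM2]
  refine ⟨?_, ?_, ?_, ?_, ?_⟩
  · unfold kerz
    linarith [a00]
  · unfold ker1
    refine (norm_add_le _ _).trans ?_
    linarith
  · unfold ker2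
    have b1 : ‖(μ ^ 2 - ν * (ν + 1) * (1 / Real.cosh (τ + r) ^ 2 : ℝ)) * ff ν μ (τ + r) * legendreP ν (Bk Y τ r)‖ ≤ G * (C * A * 1 * M) := by
      rw [mul_assoc, norm_mul]; gcongr
    have b2 : ‖2 * (ff1 ν μ (τ + r) * (LP1 ν (Bk Y τ r) * Bt Y τ r))‖ ≤ 2 * (C * A * x * M) := by
      rw [norm_mul]; simp only [Complex.norm_ofNat]; gcongr
    rw [mul_add (ff ν μ (τ + r))]
    have b3 := norm_add_le (ff ν μ (τ + r) * (LP2 ν (Bk Y τ r) * (Bt Y τ r) ^ 2)) (ff ν μ (τ + r) * (LP1 ν (Bk Y τ r) * Btt Y τ r))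
    refine (norm_add_le _ _).trans ?_
    have b4 := norm_add_le ((μ ^ 2 - ν * (ν + 1) * (1 / Real.cosh (τ + r) ^ 2 : ℝ)) * ff ν μ (τ + r) * legendreP ν (Bk Y τ r)) (2 * (ff1 ν μ (τ + r) * (LP1 ν (Bk Y τ r) * Bt Y τ r)))
    linarith
  · unfold kerE
    rw [mul_assoc, norm_mul]; simp only [Complex.norm_ofNat]
    linarith
  · have e : ker1 ν μ Y τ r + μ * kerz ν μ Y τ r = (ff1 ν μ (τ + r) + μ * ff ν μ (τ + r)) * legendreP ν (Bk Y τ r) + ff ν μ (τ + r) * (LP1 ν (Bk Y τ r) * Bt Y τ r) := by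
      unfold kerz ker1; ring
    rw [e]
    refine (norm_add_le _ _).trans ?_
    have b1 : ‖(ff1 ν μ (τ + r) + μ * ff ν μ (τ + r)) * legendreP ν (Bk Y τ r)‖ ≤ C * A * ES * M2 := by
      rw [norm_mul]
      calc _ ≤ (C * Real.exp (-(μ.re + 2) * (τ + r))) * (A * eσ) := by gcongr
        _ = C * A * (Real.exp (-(μ.re + 2) * (τ + r)) * eσ) := by ring
        _ = C * A * Real.exp (-2 * r) * M2 := by rw [em2]; ring
        _ ≤ _ := by gcongr
    have b2 : C * A * x * M = C * A * M2 := by rw [← em3]; ring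
    rw [b2] at a01
    have : 0 ≤ C * A * (1 + (1 + q) + (G + 2 * q + q ^ 2 + q) + 2 * q) * M2 := by positivity
    linarith


section
variable (ν μ : ℂ) {Y : ℝ} (hY : 1 ≤ Y)

theorem Bkc {Y : ℝ} (hY : 1 ≤ Y) (τ : ℝ) : Continuous (fun r => Bk Y τ r) :=
  continuous_iff_continuousAt.2 fun r => (Bk_hasDerivAt_r hY τ r).continuousAt

theorem Btc {Y : ℝ} (hY : 1 ≤ Y) (τ : ℝ) : Continuous (fun r => Bt Y τ r) :=
  continuous_iff_continuousAt.2 fun r => (Bt_hasDerivAt_r hY τ r).continuousAt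

theorem Bttc {Y : ℝ} (hY : 1 ≤ Y) (τ : ℝ) : Continuous (fun r => Btt Y τ r) := by
  unfold Btt
  refine Continuous.div (by fun_prop) (by fun_prop) fun r => ?_
  have := VR_pos τ r
  positivity

theorem LPc0 (ν : ℂ) {Y : ℝ} (hY : 1 ≤ Y) (τ : ℝ) : Continuous (fun r => legendreP ν (Bk Y τ r)) :=
  (legendreP_continuousOn ν).comp_continuous (Bkc hY τ) fun r => Bk_pos hY τ r

theorem LPc1 (ν : ℂ) {Y : ℝ} (hY : 1 ≤ Y) (τ : ℝ) : Continuous (fun r => LP1 ν (Bk Y τ r)) :=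
  (LP1_continuousOn ν).comp_continuous (Bkc hY τ) fun r => Bk_pos hY τ r

theorem LPc2 (ν : ℂ) {Y : ℝ} (hY : 1 ≤ Y) (τ : ℝ) : Continuous (fun r => LP2 ν (Bk Y τ r)) :=
  (LP2_continuousOn ν).comp_continuous (Bkc hY τ) fun r => Bk_pos hY τ r

theorem kerz_cont {Y : ℝ} (hY : 1 ≤ Y) (τ : ℝ) : Continuous (fun r => kerz ν μ Y τ r) := by
  unfold kerz
  exact ((ff_continuous ν μ).comp (continuous_const.add continuous_id)).mul (LPc0 ν hY τ)

theorem ker1_cont {Y : ℝ} (hY : 1 ≤ Y) (τ : ℝ) : Continuous (fun r => ker1 ν μ Y τ r) := by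
  unfold ker1
  exact (((ff1_continuous ν μ).comp (continuous_const.add continuous_id)).mul (LPc0 ν hY τ)).add
    (((ff_continuous ν μ).comp (continuous_const.add continuous_id)).mul ((LPc1 ν hY τ).mul
      (Complex.continuous_ofReal.comp (Btc hY τ))))

theorem ker2_cont {Y : ℝ} (hY : 1 ≤ Y) (τ : ℝ) : Continuous (fun r => ker2 ν μ Y τ r) := by
  unfold ker2
  have a1 := (ff1_continuous ν μ).comp (continuous_const.add continuous_id : Continuous (fun r : ℝ => τ + r))
  have a0 := (ff_continuous ν μ).comp (continuous_const.add continuous_id : Continuous (fun r : ℝ => τ + r))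
  have b := Complex.continuous_ofReal.comp (Btc hY τ)
  have c := Complex.continuous_ofReal.comp (Bttc hY τ)
  have d : Continuous (fun r : ℝ => 1 / Real.cosh (τ + r) ^ 2) :=
    Continuous.div continuous_const (by fun_prop) fun r => by positivity
  have d' := Complex.continuous_ofReal.comp d
  exact (((continuous_const.sub (continuous_const.mul d')).mul a0).mul (LPc0 ν hY τ)).add
    (continuous_const.mul (a1.mul ((LPc1 ν hY τ).mul b))) |>.add
    (a0.mul (((LPc2 ν hY τ).mul (b.pow 2)).add ((LPc1 ν hY τ).mul c)))

theorem ff_shift_tau (τ r : ℝ) : HasDerivAt (fun τ => ff ν μ (τ + r)) (ff1 ν μ (τ + r)) τ :=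
  (ff_hasDerivAt ν μ (τ + r)).comp_add_const τ r

theorem ff1_shift_tau (τ r : ℝ) : HasDerivAt (fun τ => ff1 ν μ (τ + r))
    ((μ ^ 2 - ν * (ν + 1) * (1 / Real.cosh (τ + r) ^ 2 : ℝ)) * ff ν μ (τ + r)) τ :=
  (ff1_hasDerivAt ν μ (τ + r)).comp_add_const τ r

theorem ff_shift_r (τ r : ℝ) : HasDerivAt (fun r => ff ν μ (τ + r)) (ff1 ν μ (τ + r)) r :=
  (ff_hasDerivAt ν μ (τ + r)).comp_const_add τ r

theorem cd {f : ℝ → ℂ} {g : ℝ → ℝ} {f' : ℂ} {g' x : ℝ} (hf : HasDerivAt f f' (g x)) (hg : HasDerivAt g g' x) :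
    HasDerivAt (fun x => f (g x)) (f' * g') x := by
  refine (HasDerivAt.scomp x hf hg).congr_deriv ?_
  rw [Complex.real_smul, mul_comm]

theorem kerz_deriv {Y : ℝ} (hY : 1 ≤ Y) (τ r : ℝ) : HasDerivAt (fun τ => kerz ν μ Y τ r) (ker1 ν μ Y τ r) τ := by
  refine ((ff_shift_tau ν μ τ r).mul
    (cd (legendreP_hasDerivAt ν (Bk_pos hY τ r)) (Bk_hasDerivAt_tau hY τ r))).congr_deriv ?_
  unfold ker1
  ring

theorem ker1_deriv {Y : ℝ} (hY : 1 ≤ Y) (τ r : ℝ) : HasDerivAt (fun τ => ker1 ν μ Y τ r) (ker2 ν μ Y τ r) τ := by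
  refine (((ff1_shift_tau ν μ τ r).mul
    (cd (legendreP_hasDerivAt ν (Bk_pos hY τ r)) (Bk_hasDerivAt_tau hY τ r))).add
    ((ff_shift_tau ν μ τ r).mul ((cd (g := fun τ => Bk Y τ r) (LP1_hasDerivAt ν (Bk_pos hY τ r)) (Bk_hasDerivAt_tau hY τ r)).mul
     (Bt_hasDerivAt_tau hY τ r).ofReal_comp))).congr_deriv ?_
  unfold ker2
  simp only [Pi.mul_apply]
  ring

theorem kerE_deriv {Y : ℝ} (hY : 1 ≤ Y) (τ r : ℝ) : HasDerivAt (fun r => kerE ν μ Y τ r)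
    (ker2 ν μ Y τ r - (μ ^ 2 - ν * (ν + 1) * (1 / Real.cosh τ ^ 2 : ℝ)) * kerz ν μ Y τ r) r := by
  refine (((ff_shift_r ν μ τ r).const_mul 2).mul
    ((cd (LP1_hasDerivAt ν (Bk_pos hY τ r)) (Bk_hasDerivAt_r hY τ r)).mul
     (Bt_hasDerivAt_r hY τ r).ofReal_comp)).congr_deriv ?_
  unfold ker2 kerz
  simp only [Pi.mul_apply]
  have i1 : (Bt Y τ r : ℂ) ^ 2 - 2 * Br Y τ r * Bt Y τ r =
    -((1 / Real.cosh τ ^ 2 : ℝ) - (1 / Real.cosh (τ + r) ^ 2 : ℝ)) * ((Bk Y τ r : ℂ) ^ 2 - 1) := by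
    exact_mod_cast B_id1 hY τ r
  have i2 : (Btt Y τ r : ℂ) - 2 * Btr Y τ r =
    -((1 / Real.cosh τ ^ 2 : ℝ) - (1 / Real.cosh (τ + r) ^ 2 : ℝ)) * (2 * (Bk Y τ r : ℂ)) := by
    exact_mod_cast B_id2 hY τ r
  have o := legendre_ode ν (Bk_pos hY τ r)
  linear_combination (-(ff ν μ (τ + r) * LP2 ν (Bk Y τ r))) * i1 - (ff ν μ (τ + r) * LP1 ν (Bk Y τ r)) * i2
    + ff ν μ (τ + r) * (((1 / Real.cosh τ ^ 2 : ℝ) : ℂ) - (1 / Real.cosh (τ + r) ^ 2 : ℝ)) * o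
end

/-- The integral. -/
noncomputable def yy (ν μ : ℂ) (t₂ τ : ℝ) : ℂ := ∫ r in Ioi t₂, kerz ν μ (Real.cosh t₂) τ r
/-- Its derivative. -/
noncomputable def yy1 (ν μ : ℂ) (t₂ τ : ℝ) : ℂ := ∫ r in Ioi t₂, ker1 ν μ (Real.cosh t₂) τ r

theorem good_sigma {ν μ : ℂ} (h1 : -1 < (μ + ν).re) (h2 : 0 < (μ - ν).re) :
    ∃ σ : ℝ, ν.re < σ ∧ -1 - ν.re ≤ σ ∧ σ < μ.re ∧ -1/2 < μ.re := by
  simp only [Complex.add_re, Complex.sub_re] at h1 h2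
  refine ⟨(max ν.re (-1 - ν.re) + μ.re) / 2, ?_, ?_, ?_, by linarith⟩
  · have := le_max_left ν.re (-1 - ν.re); linarith
  · have := le_max_right ν.re (-1 - ν.re)
    have : -1 - ν.re < μ.re := by linarith
    linarith
  · have : max ν.re (-1 - ν.re) < μ.re := max_lt (by linarith) (by linarith)
    linarith

theorem exp_int {a : ℝ} (ha : a < 0) (s A : ℝ) : IntegrableOn (fun r => A * Real.exp (a * r)) (Ioi s) :=
  (integrableOn_exp_mul_Ioi ha s).const_mul A

section
variable {ν μ : ℂ} (h1 : -1 < (μ + ν).re) (h2 : 0 < (μ - ν).re) (t₂ : ℝ)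

theorem kerz_int (h1 : -1 < (μ + ν).re) (h2 : 0 < (μ - ν).re) (t₂ τ : ℝ) :
    IntegrableOn (fun r => kerz ν μ (Real.cosh t₂) τ r) (Ioi t₂) := by
  obtain ⟨σ, s1, s2, s3, s4⟩ := good_sigma h1 h2
  have hY := Real.one_le_cosh t₂
  obtain ⟨A, hA, hb⟩ := ker_bounds ν μ σ s1 s2 hY τ t₂
  refine Integrable.mono' (exp_int (a := σ - μ.re) (by linarith) t₂ (A * Real.exp (-μ.re * τ)))
    (kerz_cont ν μ hY τ).aestronglyMeasurable ?_
  filter_upwards [ae_restrict_mem measurableSet_Ioi] with r hr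
  exact (hb τ r le_rfl (le_of_lt hr)).1

theorem exp_loc_bound (m τ τ' : ℝ) (h : |τ' - τ| ≤ 1) : m * τ' ≤ m * τ + |m| := by
  have : |m * (τ' - τ)| ≤ |m| * 1 := by rw [abs_mul]; gcongr
  have := le_abs_self (m * (τ' - τ))
  nlinarith

theorem yy_deriv (h1 : -1 < (μ + ν).re) (h2 : 0 < (μ - ν).re) (t₂ τ : ℝ) :
    (IntegrableOn (fun r => ker1 ν μ (Real.cosh t₂) τ r) (Ioi t₂)) ∧ HasDerivAt (yy ν μ t₂) (yy1 ν μ t₂ τ) τ := by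
  obtain ⟨σ, s1, s2, s3, s4⟩ := good_sigma h1 h2
  have hY := Real.one_le_cosh t₂
  obtain ⟨A, hA, hb⟩ := ker_bounds ν μ σ s1 s2 hY (τ - 1) t₂
  refine hasDerivAt_integral_of_dominated_loc_of_deriv_le (s := Metric.closedBall τ 1)
    (bound := fun r => (A * Real.exp (-μ.re * τ + |-μ.re|)) * Real.exp ((σ - μ.re) * r))
    (Metric.closedBall_mem_nhds τ one_pos)
    (Eventually.of_forall fun x => (kerz_cont ν μ hY x).aestronglyMeasurable)
    (kerz_int h1 h2 t₂ τ) (ker1_cont ν μ hY τ).aestronglyMeasurable ?_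
    (exp_int (by linarith) _ _) (Eventually.of_forall fun r x _ => kerz_deriv ν μ hY x r)
  filter_upwards [ae_restrict_mem measurableSet_Ioi] with r hr x hx
  rw [Metric.mem_closedBall, Real.dist_eq] at hx
  refine (hb x r (by linarith [abs_le.1 hx]) (le_of_lt hr)).2.1.trans ?_
  gcongr
  exact exp_loc_bound _ τ x hx

theorem yy1_deriv (h1 : -1 < (μ + ν).re) (h2 : 0 < (μ - ν).re) (t₂ τ : ℝ) :
    HasDerivAt (yy1 ν μ t₂) ((μ ^ 2 - ν * (ν + 1) * (1 / Real.cosh τ ^ 2 : ℝ)) * yy ν μ t₂ τ) τ := by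
  obtain ⟨σ, s1, s2, s3, s4⟩ := good_sigma h1 h2
  have hY := Real.one_le_cosh t₂
  obtain ⟨A, hA, hb⟩ := ker_bounds ν μ σ s1 s2 hY (τ - 1) t₂
  have key := hasDerivAt_integral_of_dominated_loc_of_deriv_le (s := Metric.closedBall τ 1)
    (F := fun τ r => ker1 ν μ (Real.cosh t₂) τ r) (F' := fun τ r => ker2 ν μ (Real.cosh t₂) τ r)
    (μ := volume.restrict (Ioi t₂))
    (bound := fun r => (A * Real.exp (-μ.re * τ + |-μ.re|)) * Real.exp ((σ - μ.re) * r))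
    (Metric.closedBall_mem_nhds τ one_pos)
    (Eventually.of_forall fun x => (ker1_cont ν μ hY x).aestronglyMeasurable)
    (yy_deriv h1 h2 t₂ τ).1 (ker2_cont ν μ hY τ).aestronglyMeasurable ?_
    (exp_int (by linarith) _ _) (Eventually.of_forall fun r x _ => ker1_deriv ν μ hY x r)
  swap
  · filter_upwards [ae_restrict_mem measurableSet_Ioi] with r hr x hx
    rw [Metric.mem_closedBall, Real.dist_eq] at hx
    refine (hb x r (by linarith [abs_le.1 hx]) (le_of_lt hr)).2.2.1.trans ?_
    gcongr
    exact exp_loc_bound _ τ x hx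
  refine key.2.congr_deriv ?_
  have hz := kerz_int h1 h2 t₂ τ
  set q := (μ ^ 2 - ν * (ν + 1) * (1 / Real.cosh τ ^ 2 : ℝ)) with hq
  have hlim : Tendsto (fun r => kerE ν μ (Real.cosh t₂) τ r) atTop (𝓝 0) := by
    refine squeeze_zero_norm' (a := fun r => A * Real.exp (-μ.re * τ) * Real.exp ((σ - μ.re) * r)) ?_ ?_
    · filter_upwards [eventually_ge_atTop t₂] with r hr
      exact (hb τ r (by linarith) hr).2.2.2.1
    · have : Tendsto (fun r : ℝ => Real.exp ((σ - μ.re) * r)) atTop (𝓝 0) :=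
        Real.tendsto_exp_atBot.comp (tendsto_id.const_mul_atTop_of_neg (by linarith))
      simpa using this.const_mul (A * Real.exp (-μ.re * τ))
  have hI := integral_Ioi_of_hasDerivAt_of_tendsto' (a := t₂) (fun r _ => kerE_deriv ν μ hY τ r)
    (key.1.sub (hz.const_mul q)) hlim
  have hE0 : kerE ν μ (Real.cosh t₂) τ t₂ = 0 := by
    unfold kerE Bt
    simp
  rw [hE0, sub_zero] at hI
  have e := integral_sub key.1 (hz.const_mul q)
  rw [integral_const_mul] at e
  have : ∫ a in Ioi t₂, ker2 ν μ (Real.cosh t₂) τ a - q * kerz ν μ (Real.cosh t₂) τ a = 0 := hI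
  rw [this] at e
  unfold yy
  exact (sub_eq_zero.1 e.symm)

theorem yy_bounds (h1 : -1 < (μ + ν).re) (h2 : 0 < (μ - ν).re) (t₂ : ℝ) : ∃ C : ℝ, 0 < C ∧ ∀ τ : ℝ, 0 ≤ τ →
    ‖yy ν μ t₂ τ‖ ≤ C * Real.exp (-μ.re * τ) ∧
    ‖yy1 ν μ t₂ τ + μ * yy ν μ t₂ τ‖ ≤ C * Real.exp (-(μ.re + 2) * τ) := by
  obtain ⟨σ, s1, s2, s3, s4⟩ := good_sigma h1 h2
  have hY := Real.one_le_cosh t₂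
  obtain ⟨A, hA, hb⟩ := ker_bounds ν μ σ s1 s2 hY 0 t₂
  set J := ∫ r in Ioi t₂, Real.exp ((σ - μ.re) * r) with hJ
  have hJ0 : 0 ≤ J := integral_nonneg fun r => (Real.exp_pos _).le
  have gen : ∀ (m : ℝ) (g : ℝ → ℂ), (∀ r, t₂ ≤ r → ‖g r‖ ≤ A * m * Real.exp ((σ - μ.re) * r)) → 0 ≤ m →
      ‖∫ r in Ioi t₂, g r‖ ≤ (A * J + 1) * m := by
    intro m g hg hm
    have := norm_integral_le_of_norm_le (exp_int (a := σ - μ.re) (by linarith) t₂ (A * m))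
      (f := g) (by filter_upwards [ae_restrict_mem measurableSet_Ioi] with r hr; exact hg r (le_of_lt hr))
    rw [integral_const_mul, ← hJ] at this
    nlinarith
  refine ⟨A * J + 1, by positivity, fun τ hτ => ⟨?_, ?_⟩⟩
  · exact gen _ _ (fun r hr => (hb τ r hτ hr).1) (Real.exp_pos _).le
  · have e := integral_add (yy_deriv h1 h2 t₂ τ).1 ((kerz_int h1 h2 t₂ τ).const_mul μ)
    rw [integral_const_mul] at e
    unfold yy yy1
    rw [← e]
    exact gen _ _ (fun r hr => (hb τ r hτ hr).2.2.2.2) (Real.exp_pos _).le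
end


theorem unique_aux (q : ℝ → ℂ) (K : ℝ) (hK : ∀ t, ‖q t‖ ≤ K) (z z1 : ℝ → ℂ)
    (h0 : ∀ t, HasDerivAt z (z1 t) t) (h1 : ∀ t, HasDerivAt z1 (q t * z t) t) (t₀ : ℝ)
    (i0 : z t₀ = 0) (i1 : z1 t₀ = 0) : ∀ t, z t = 0 := by
  have hK0 : 0 ≤ K := (norm_nonneg _).trans (hK 0)
  have hv : ∀ t, LipschitzOnWith (Real.toNNReal (K + 1)) (fun p : ℂ × ℂ => (p.2, q t * p.1)) univ := by
    intro t
    refine LipschitzOnWith.of_dist_le_mul fun x _ y _ => ?_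
    rw [Real.coe_toNNReal _ (by linarith), Prod.dist_eq, Prod.dist_eq]
    simp only [dist_eq_norm]
    rw [← mul_sub, norm_mul]
    have a := le_max_left ‖x.1 - y.1‖ ‖x.2 - y.2‖
    have b := le_max_right ‖x.1 - y.1‖ ‖x.2 - y.2‖
    have c := hK t
    set m := max ‖x.1 - y.1‖ ‖x.2 - y.2‖
    have hm : 0 ≤ m := (norm_nonneg _).trans a
    refine max_le ?_ ?_
    · nlinarith
    · calc _ ≤ K * m := by gcongr
        _ ≤ _ := by nlinarith
  have := ODE_solution_unique_univ (v := fun t (p : ℂ × ℂ) => (p.2, q t * p.1)) (s := fun _ => univ)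
    (f := fun t => (z t, z1 t)) (g := fun _ => (0, 0)) (t₀ := t₀) hv
    (fun t => ⟨(h0 t).prodMk (h1 t), mem_univ _⟩)
    (fun t => ⟨(hasDerivAt_const t ((0:ℂ), (0:ℂ))).congr_deriv (by simp; rfl), mem_univ _⟩) (by simp [i0, i1])
  intro t
  have := congrFun this t
  simp only [Prod.mk.injEq] at this
  exact this.1

theorem ff_ne_zero (ν μ : ℂ) (hg : Complex.Gamma (1 + μ) ≠ 0) : ∃ t, ff ν μ t ≠ 0 := by
  by_contra! h
  have := ff_lim ν μ
  simp only [h, mul_zero] at this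
  have := tendsto_nhds_unique this tendsto_const_nhds
  exact (one_div_ne_zero hg) this

theorem yy_eq {ν μ : ℂ} (h1 : -1 < (μ + ν).re) (h2 : 0 < (μ - ν).re) (t₂ : ℝ) (t₀ : ℝ) (ht₀ : ff ν μ t₀ ≠ 0) :
    ∃ c : ℂ, ∀ t, yy ν μ t₂ t = c * ff ν μ t := by
  obtain ⟨σ, s1, s2, s3, s4⟩ := good_sigma h1 h2
  set q : ℝ → ℂ := fun τ => (μ ^ 2 - ν * (ν + 1) * (1 / Real.cosh τ ^ 2 : ℝ)) with hq
  set W : ℝ → ℂ := fun t => yy ν μ t₂ t * ff1 ν μ t - yy1 ν μ t₂ t * ff ν μ t with hW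
  have hWd : ∀ t, HasDerivAt W 0 t := by
    intro t
    refine (((yy_deriv h1 h2 t₂ t).2.mul (ff1_hasDerivAt ν μ t)).sub
      ((yy1_deriv h1 h2 t₂ t).mul (ff_hasDerivAt ν μ t))).congr_deriv ?_
    ring
  have hWc : ∀ t, W t = W t₀ := fun t =>
    is_const_of_deriv_eq_zero (fun t => (hWd t).differentiableAt) (fun t => (hWd t).deriv) t t₀
  have hWl : Tendsto W atTop (𝓝 0) := by
    obtain ⟨C, hC, hc⟩ := yy_bounds h1 h2 t₂
    obtain ⟨D, hD, hd⟩ := ff_bounds ν μ 0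
    refine squeeze_zero_norm' (a := fun t => 2 * C * D * Real.exp (-(2 * μ.re + 2) * t)) ?_ ?_
    · filter_upwards [eventually_ge_atTop 0] with t ht
      have e : W t = yy ν μ t₂ t * (ff1 ν μ t + μ * ff ν μ t) - (yy1 ν μ t₂ t + μ * yy ν μ t₂ t) * ff ν μ t := by
        simp only [hW]; ring
      obtain ⟨c0, c1⟩ := hc t ht
      obtain ⟨d0, d1, d2⟩ := hd t ht
      rw [e]
      refine (norm_sub_le _ _).trans ?_
      rw [norm_mul, norm_mul]
      have ee : Real.exp (-(2 * μ.re + 2) * t) = Real.exp (-μ.re * t) * Real.exp (-(μ.re + 2) * t) := by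
        rw [← Real.exp_add]; ring_nf
      calc _ ≤ (C * Real.exp (-μ.re * t)) * (D * Real.exp (-(μ.re + 2) * t)) +
            (C * Real.exp (-(μ.re + 2) * t)) * (D * Real.exp (-μ.re * t)) := by gcongr
        _ = _ := by rw [ee]; ring
    · have : Tendsto (fun r : ℝ => Real.exp (-(2 * μ.re + 2) * r)) atTop (𝓝 0) :=
        Real.tendsto_exp_atBot.comp (tendsto_id.const_mul_atTop_of_neg (by linarith))
      simpa using this.const_mul (2 * C * D)
  have hW0 : W t₀ = 0 := by
    refine tendsto_nhds_unique ?_ hWl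
    exact tendsto_const_nhds.congr fun t => (hWc t).symm
  set c := yy ν μ t₂ t₀ / ff ν μ t₀ with hc
  have hcy : yy ν μ t₂ t₀ = c * ff ν μ t₀ := by rw [hc]; field_simp
  refine ⟨c, fun t => ?_⟩
  have := unique_aux q (‖μ ^ 2‖ + ‖ν * (ν + 1)‖) ?_ (fun t => yy ν μ t₂ t - c * ff ν μ t)
    (fun t => yy1 ν μ t₂ t - c * ff1 ν μ t)
    (fun t => (yy_deriv h1 h2 t₂ t).2.sub ((ff_hasDerivAt ν μ t).const_mul c))
    (fun t => ((yy1_deriv h1 h2 t₂ t).sub ((ff1_hasDerivAt ν μ t).const_mul c)).congr_deriv (by simp only [hq]; ring))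
    t₀ (by simp [hcy]) ?_ t
  · exact sub_eq_zero.1 this
  · intro t
    refine (norm_sub_le _ _).trans ?_
    gcongr
    rw [norm_mul, Complex.norm_real, Real.norm_of_nonneg (by positivity)]
    refine mul_le_of_le_one_right (norm_nonneg _) ?_
    rw [div_le_one (by positivity)]
    exact one_le_pow₀ (Real.one_le_cosh _)
  · have : (yy1 ν μ t₂ t₀ - c * ff1 ν μ t₀) * ff ν μ t₀ = 0 := by
      simp only [hW] at hW0
      linear_combination (-1:ℂ) * hW0 + ff1 ν μ t₀ * hcy
    exact (mul_eq_zero.1 this).resolve_right ht₀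

/-- The kernel argument in hyperbolic variables. -/
noncomputable def BB (t₁ t₂ t₃ : ℝ) : ℝ := (Real.cosh t₁ ^ 2 + Real.cosh t₂ ^ 2 + Real.cosh t₃ ^ 2 - 1) /
    (2 * Real.cosh t₁ * Real.cosh t₂ * Real.cosh t₃)

/-- The integral in hyperbolic variables. -/
noncomputable def GG (ν μ : ℂ) (t₁ t₂ : ℝ) : ℂ :=
  ∫ t in Ioi (t₁ + t₂), ff ν μ t * legendreP ν (BB t₁ t₂ t)

theorem GG_symm (ν μ : ℂ) (t₁ t₂ : ℝ) : GG ν μ t₁ t₂ = GG ν μ t₂ t₁ := by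
  have h : ∀ t, BB t₁ t₂ t = BB t₂ t₁ t := by
    intro t
    unfold BB
    congr 1 <;> ring
  unfold GG
  rw [add_comm t₁ t₂]
  simp only [h]

theorem shift_int (g : ℝ → ℂ) (a b : ℝ) : ∫ r in Ioi b, g (a + r) = ∫ t in Ioi (a + b), g t := by
  have := (measurePreserving_add_left volume a).setIntegral_preimage_emb
    (Homeomorph.addLeft a).measurableEmbedding g (Ioi (a + b))
  rw [← this]
  congr 2
  ext x
  simp

theorem shift_int_on (g : ℝ → ℂ) (a b : ℝ) : IntegrableOn (fun r => g (a + r)) (Ioi b) ↔ IntegrableOn g (Ioi (a + b)) := by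
  have := (measurePreserving_add_left volume a).integrableOn_comp_preimage
    (Homeomorph.addLeft a).measurableEmbedding (f := g) (s := Ioi (a + b))
  rw [← this]
  have e : (fun x => a + x) ⁻¹' Ioi (a + b) = Ioi b := by ext x; simp
  rw [e]
  rfl

theorem kerz_eq (ν μ : ℂ) (t₂ τ r : ℝ) : kerz ν μ (Real.cosh t₂) τ r = ff ν μ (τ + r) * legendreP ν (BB τ t₂ (τ + r)) := by
  unfold kerz BB
  rw [Bk_eq]

theorem yy_GG (ν μ : ℂ) (t₂ τ : ℝ) : yy ν μ t₂ τ = GG ν μ τ t₂ := by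
  unfold yy GG
  simp only [kerz_eq]
  exact shift_int (fun t => ff ν μ t * legendreP ν (BB τ t₂ t)) τ t₂

theorem GG_eq {ν μ : ℂ} (h1 : -1 < (μ + ν).re) (h2 : 0 < (μ - ν).re) :
    ∃ κ : ℂ, ∀ t₁ t₂, GG ν μ t₁ t₂ = κ * (ff ν μ t₁ * ff ν μ t₂) := by
  obtain ⟨σ, s1, s2, s3, s4⟩ := good_sigma h1 h2
  obtain ⟨t₀, ht₀⟩ := ff_ne_zero ν μ (Complex.Gamma_ne_zero_of_re_pos (by simp; linarith))
  obtain ⟨c₀, hc₀⟩ := yy_eq h1 h2 t₀ t₀ ht₀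
  refine ⟨c₀ / ff ν μ t₀, fun t₁ t₂ => ?_⟩
  obtain ⟨c, hc⟩ := yy_eq h1 h2 t₂ t₀ ht₀
  have e1 := hc t₀
  have e2 := hc₀ t₂
  rw [yy_GG] at e1 e2
  rw [GG_symm] at e2
  rw [← yy_GG, hc]
  have : c = c₀ * ff ν μ t₂ / ff ν μ t₀ := by
    rw [eq_div_iff ht₀, ← e1, e2]
  rw [this]
  ring


/-- Laplace–Mellin transform of the Legendre function. -/
noncomputable def MM (ν μ : ℂ) : ℂ := ∫ r in Ioi (0:ℝ), Complex.exp (-μ * r) * legendreP ν (Real.exp r)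

/-- `p' (r)` with `p r = P (e^r)`. -/
noncomputable def pp1 (ν : ℂ) (r : ℝ) : ℂ := LP1 ν (Real.exp r) * Real.exp r

theorem pp_deriv (ν : ℂ) (r : ℝ) : HasDerivAt (fun r => legendreP ν (Real.exp r)) (pp1 ν r) r :=
  cd (legendreP_hasDerivAt ν (Real.exp_pos r)) (Real.hasDerivAt_exp r)

theorem pp1_deriv (ν : ℂ) (r : ℝ) : HasDerivAt (pp1 ν)
    (LP2 ν (Real.exp r) * Real.exp r ^ 2 + LP1 ν (Real.exp r) * Real.exp r) r := by
  refine ((cd (LP1_hasDerivAt ν (Real.exp_pos r)) (Real.hasDerivAt_exp r)).mul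
    (Real.hasDerivAt_exp r).ofReal_comp).congr_deriv ?_
  ring

theorem pp_cont (ν : ℂ) : Continuous (fun r : ℝ => legendreP ν (Real.exp r)) :=
  continuous_iff_continuousAt.2 fun r => (pp_deriv ν r).continuousAt

theorem pp1_cont (ν : ℂ) : Continuous (pp1 ν) :=
  continuous_iff_continuousAt.2 fun r => (pp1_deriv ν r).continuousAt

theorem cexp_cont (μ : ℂ) : Continuous (fun r : ℝ => Complex.exp (-μ * r)) :=
  continuous_iff_continuousAt.2 fun r => (cexp_hasDerivAt μ r).continuousAt

theorem pp_bounds (ν : ℂ) (σ : ℝ) (h1 : ν.re < σ) (h2 : -1 - ν.re ≤ σ) :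
    ∃ C : ℝ, 0 < C ∧ ∀ r : ℝ, 0 ≤ r → ‖legendreP ν (Real.exp r)‖ ≤ C * Real.exp (σ * r) ∧
      ‖pp1 ν r‖ ≤ C * Real.exp (σ * r) := by
  obtain ⟨C, hC, h⟩ := legendre_bounds ν σ h1 h2 1 one_pos
  refine ⟨C, hC, fun r hr => ?_⟩
  obtain ⟨a, b, _⟩ := h (Real.exp r) (Real.one_le_exp hr)
  rw [← Real.exp_mul, mul_comm r] at a b
  refine ⟨a, ?_⟩
  unfold pp1
  rw [norm_mul, Complex.norm_real, Real.norm_of_nonneg (Real.exp_pos r).le]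
  exact b

section
variable {ν μ : ℂ}

theorem MM_bd {σ C : ℝ} {g : ℝ → ℂ} (h : ∀ r : ℝ, 0 ≤ r → ‖g r‖ ≤ C * Real.exp (σ * r)) (μ : ℂ) (r : ℝ) (hr : 0 ≤ r) :
    ‖Complex.exp (-μ * r) * g r‖ ≤ C * Real.exp ((σ - μ.re) * r) := by
  rw [norm_mul, norm_cexp]
  calc _ ≤ Real.exp (-μ.re * r) * (C * Real.exp (σ * r)) := by gcongr; exact h r hr
    _ = C * (Real.exp (-μ.re * r) * Real.exp (σ * r)) := by ring
    _ = _ := by rw [← Real.exp_add]; ring_nf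

theorem MM_int_aux {σ C : ℝ} {g : ℝ → ℂ} (hg : Continuous g)
    (h : ∀ r : ℝ, 0 ≤ r → ‖g r‖ ≤ C * Real.exp (σ * r)) (μ : ℂ) (hσ : σ < μ.re) :
    IntegrableOn (fun r : ℝ => Complex.exp (-μ * r) * g r) (Ioi 0) := by
  refine Integrable.mono' (exp_int (a := σ - μ.re) (by linarith) 0 C)
    ((cexp_cont μ).mul hg).aestronglyMeasurable ?_
  filter_upwards [ae_restrict_mem measurableSet_Ioi] with r hr
  exact MM_bd h μ r (le_of_lt hr)

theorem MM_lim_aux {σ C : ℝ} {g : ℝ → ℂ}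
    (h : ∀ r : ℝ, 0 ≤ r → ‖g r‖ ≤ C * Real.exp (σ * r)) (μ : ℂ) (hσ : σ < μ.re) :
    Tendsto (fun r : ℝ => Complex.exp (-μ * r) * g r) atTop (𝓝 0) := by
  refine squeeze_zero_norm' (a := fun r => C * Real.exp ((σ - μ.re) * r)) ?_ ?_
  · filter_upwards [eventually_ge_atTop 0] with r hr
    exact MM_bd h μ r hr
  · have : Tendsto (fun r : ℝ => Real.exp ((σ - μ.re) * r)) atTop (𝓝 0) :=
        Real.tendsto_exp_atBot.comp (tendsto_id.const_mul_atTop_of_neg (by linarith))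
    simpa using this.const_mul C

theorem exp_m2 (r : ℝ) : HasDerivAt (fun r : ℝ => Complex.exp (-2 * r)) (-2 * Complex.exp (-2 * r)) r :=
  cexp_hasDerivAt 2 r

theorem MM_rec (h1 : -1 < (μ + ν).re) (h2 : 0 < (μ - ν).re) :
    (μ - ν) * (μ + ν + 1) * MM ν μ = (μ + 1) * (μ + 2) * MM ν (μ + 2) := by
  obtain ⟨σ, s1, s2, s3, s4⟩ := good_sigma h1 h2
  obtain ⟨C, hC, hb⟩ := pp_bounds ν σ s1 s2
  have i0 := MM_int_aux (pp_cont ν) (fun r hr => (hb r hr).1) μ s3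
  have s3' : σ < (μ + 2).re := by simp; linarith
  have i2 := MM_int_aux (pp_cont ν) (fun r hr => (hb r hr).1) (μ + 2) s3'
  have l0 := MM_lim_aux (fun r hr => (hb r hr).1) μ s3
  have l2 := MM_lim_aux (fun r hr => (hb r hr).1) (μ + 2) s3'
  have l0' := MM_lim_aux (fun r hr => (hb r hr).2) μ s3
  have l2' := MM_lim_aux (fun r hr => (hb r hr).2) (μ + 2) s3'
  have esp : ∀ r : ℝ, Complex.exp (-(μ + 2) * r) = Complex.exp (-μ * r) * Complex.exp (-2 * r) := by
    intro r; rw [← Complex.exp_add]; ring_nf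
  have hd : ∀ r ∈ Ici (0:ℝ), HasDerivAt (fun r : ℝ => Complex.exp (-μ * r) * (-(1 - Complex.exp (-2 * r)) * pp1 ν r
      - (μ + 1) * legendreP ν (Real.exp r) + (μ + 1) * Complex.exp (-2 * r) * legendreP ν (Real.exp r)))
      ((μ - ν) * (μ + ν + 1) * (Complex.exp (-μ * r) * legendreP ν (Real.exp r)) -
        (μ + 1) * (μ + 2) * (Complex.exp (-(μ + 2) * r) * legendreP ν (Real.exp r))) r := by
    intro r _
    refine ((cexp_hasDerivAt μ r).mul (((((exp_m2 r).const_sub 1).neg.mul (pp1_deriv ν r)).sub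
      ((pp_deriv ν r).const_mul (μ + 1))).add (((exp_m2 r).const_mul (μ + 1)).mul (pp_deriv ν r)))).congr_deriv ?_
    simp only [Pi.mul_apply, Pi.add_apply, Pi.sub_apply, Pi.neg_apply]
    have o := legendre_ode ν (Real.exp_pos r)
    have ee : Complex.exp (-2 * r) * (Real.exp r : ℂ) ^ 2 = 1 := by
      rw [Complex.ofReal_exp, ← Complex.exp_nat_mul, ← Complex.exp_add]; 
      push_cast; ring_nf; simp
    rw [esp]
    unfold pp1
    linear_combination (-Complex.exp (-μ * r)) * o + (Complex.exp (-μ * r) * LP2 ν (Real.exp r)) * ee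
  have hl : Tendsto (fun r : ℝ => Complex.exp (-μ * r) * (-(1 - Complex.exp (-2 * r)) * pp1 ν r
      - (μ + 1) * legendreP ν (Real.exp r) + (μ + 1) * Complex.exp (-2 * r) * legendreP ν (Real.exp r))) atTop (𝓝 0) := by
    have := ((l0'.neg.add l2').sub (l0.const_mul (μ + 1))).add (l2.const_mul (μ + 1))
    simp only [neg_zero, mul_zero, add_zero, sub_zero] at this
    refine this.congr fun r => ?_
    rw [esp]
    ring
  have hI := integral_Ioi_of_hasDerivAt_of_tendsto' hd
    ((i0.const_mul ((μ - ν) * (μ + ν + 1))).sub (i2.const_mul ((μ + 1) * (μ + 2)))) hl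
  rw [integral_sub (i0.const_mul _) (i2.const_mul _), integral_const_mul, integral_const_mul] at hI
  have e0 : Complex.exp (-μ * (0:ℝ)) * (-(1 - Complex.exp (-2 * (0:ℝ))) * pp1 ν 0
      - (μ + 1) * legendreP ν (Real.exp 0) + (μ + 1) * Complex.exp (-2 * (0:ℝ)) * legendreP ν (Real.exp 0)) = 0 := by
    simp
  rw [e0, sub_zero] at hI
  exact sub_eq_zero.1 hI

theorem MM_asymp (h1 : -1 < (μ + ν).re) (h2 : 0 < (μ - ν).re) :
    Tendsto (fun n : ℕ => (μ + 2 * n) * MM ν (μ + 2 * n)) atTop (𝓝 1) := by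
  obtain ⟨σ, s1, s2, s3, s4⟩ := good_sigma h1 h2
  obtain ⟨C, hC, hb⟩ := pp_bounds ν σ s1 s2
  have hs : ∀ n : ℕ, σ < (μ + 2 * n).re := by
    intro n; simp; have : (0:ℝ) ≤ n := Nat.cast_nonneg n; linarith
  have ibp : ∀ n : ℕ, (μ + 2 * n) * MM ν (μ + 2 * n) = 1 + ∫ r in Ioi (0:ℝ), Complex.exp (-(μ + 2 * n) * r) * pp1 ν r := by
    intro n
    set s := μ + 2 * (n : ℂ)
    have i0 := MM_int_aux (pp_cont ν) (fun r hr => (hb r hr).1) s (hs n)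
    have i1 := MM_int_aux (pp1_cont ν) (fun r hr => (hb r hr).2) s (hs n)
    have l0 := MM_lim_aux (fun r hr => (hb r hr).1) s (hs n)
    have hI := integral_Ioi_of_hasDerivAt_of_tendsto' (a := (0:ℝ))
      (f := fun r : ℝ => Complex.exp (-s * r) * legendreP ν (Real.exp r))
      (f' := fun r : ℝ => -s * (Complex.exp (-s * r) * legendreP ν (Real.exp r)) + Complex.exp (-s * r) * pp1 ν r)
      (fun r _ => ((cexp_hasDerivAt s r).mul (pp_deriv ν r)).congr_deriv (by ring))
      ((i0.const_mul (-s)).add i1) l0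
    rw [integral_add (i0.const_mul _) i1, integral_const_mul] at hI
    simp only [Complex.ofReal_zero, mul_zero, Complex.exp_zero, Real.exp_zero, legendreP_one, one_mul] at hI
    unfold MM
    linear_combination (-1:ℂ) * hI
  have hz : Tendsto (fun n : ℕ => ∫ r in Ioi (0:ℝ), Complex.exp (-(μ + 2 * n) * r) * pp1 ν r) atTop (𝓝 0) := by
    rw [show (0:ℂ) = ∫ r in Ioi (0:ℝ), (0:ℂ) by simp]
    refine tendsto_integral_of_dominated_convergence (fun r => C * Real.exp ((σ - μ.re) * r))
      (fun n => ((cexp_cont _).mul (pp1_cont ν)).aestronglyMeasurable) (exp_int (by linarith) _ _) ?_ ?_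
    · intro n
      filter_upwards [ae_restrict_mem measurableSet_Ioi] with r hr
      refine (MM_bd (fun r hr => (hb r hr).2) _ r (le_of_lt hr)).trans ?_
      have hr' : (0:ℝ) < r := hr
      have h5 : μ.re ≤ (μ + 2 * n).re := by simp
      have h6 : (σ - (μ + 2 * n).re) * r ≤ (σ - μ.re) * r := by gcongr
      gcongr
    · filter_upwards [ae_restrict_mem measurableSet_Ioi] with r hr
      have hr' : (0:ℝ) < r := hr
      refine squeeze_zero_norm (a := fun n : ℕ => C * Real.exp ((σ - μ.re) * r) * Real.exp (-2 * r) ^ n) (fun n => ?_) ?_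
      · refine (MM_bd (fun r hr => (hb r hr).2) _ r hr'.le).trans (le_of_eq ?_)
        rw [← Real.exp_nat_mul, mul_assoc, ← Real.exp_add]
        simp
        left; ring
      · have : Tendsto (fun n : ℕ => Real.exp (-2 * r) ^ n) atTop (𝓝 0) :=
          tendsto_pow_atTop_nhds_zero_of_lt_one (Real.exp_pos _).le (Real.exp_lt_one_iff.2 (by linarith))
        simpa using this.const_mul (C * Real.exp ((σ - μ.re) * r))
  simp only [ibp]
  simpa using hz.const_add 1

theorem MM_prod (h1 : -1 < (μ + ν).re) (h2 : 0 < (μ - ν).re) (n : ℕ) :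
    MM ν μ = (∏ j ∈ Finset.range n, (((μ + 1) / 2 + j) * ((μ + 2) / 2 + j)) / (((μ - ν) / 2 + j) * ((ν + μ + 1) / 2 + j)))
       * MM ν (μ + 2 * n) := by
  induction n with
  | zero => simp
  | succ n ih =>
    have hn : (0:ℝ) ≤ n := Nat.cast_nonneg n
    have g1 : -1 < ((μ + 2 * n) + ν).re := by
      simp only [Complex.add_re] at h1 ⊢; simp; linarith
    have g2 : 0 < ((μ + 2 * n) - ν).re := by
      simp only [Complex.sub_re] at h2 ⊢; simp; linarith
    have r := MM_rec g1 g2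
    rw [ih, Finset.prod_range_succ, mul_assoc]
    congr 1
    have n1 : (μ - ν) / 2 + n ≠ 0 := by
      intro h
      have := congrArg Complex.re h
      simp at this g2
      linarith
    have n2 : (ν + μ + 1) / 2 + n ≠ 0 := by
      intro h
      have := congrArg Complex.re h
      simp at this g1
      linarith
    rw [div_mul_eq_mul_div, eq_div_iff (mul_ne_zero n1 n2)]
    push_cast
    rw [show μ + 2 * ((n:ℂ) + 1) = μ + 2 * n + 2 by ring]
    linear_combination (1/4:ℂ) * r

theorem MM_eq (h1 : -1 < (μ + ν).re) (h2 : 0 < (μ - ν).re) :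
    MM ν μ = 1 / 2 * (Complex.Gamma ((μ - ν) / 2) * Complex.Gamma ((ν + μ + 1) / 2) /
      (Complex.Gamma ((μ + 1) / 2) * Complex.Gamma ((μ + 2) / 2))) := by
  obtain ⟨σ, s1, s2, s3, s4⟩ := good_sigma h1 h2
  set a := (μ - ν) / 2 with ha
  set b := (ν + μ + 1) / 2 with hb
  set c := (μ + 1) / 2 with hc
  set d := (μ + 2) / 2 with hd
  have gc : Complex.Gamma c ≠ 0 := Complex.Gamma_ne_zero_of_re_pos (by simp [hc]; linarith)
  have gd : Complex.Gamma d ≠ 0 := Complex.Gamma_ne_zero_of_re_pos (by simp [hd]; linarith)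
  have L1 := ((Complex.GammaSeq_tendsto_Gamma a).mul (Complex.GammaSeq_tendsto_Gamma b)).div
    ((Complex.GammaSeq_tendsto_Gamma c).mul (Complex.GammaSeq_tendsto_Gamma d)) (mul_ne_zero gc gd)
  have L2 := (MM_asymp h1 h2).comp (tendsto_add_atTop_nat 1)
  -- n / (μ + 2 (n+1)) → 1/2
  have L3 : Tendsto (fun n : ℕ => (n : ℂ) / (μ + 2 * (n + 1 : ℕ))) atTop (𝓝 (1/2)) := by
    have h := (tendsto_inv_atTop_nhds_zero_nat (𝕜 := ℂ)).const_mul (μ + 2) |>.const_add 2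
    have h' := h.inv₀ (by simp)
    simp only [mul_zero, add_zero] at h'
    rw [one_div]
    refine h'.congr' ?_
    filter_upwards [eventually_gt_atTop 0] with n hn
    have : (n : ℂ) ≠ 0 := by exact_mod_cast hn.ne'
    rw [inv_eq_one_div, show 2 + (μ + 2) * (n:ℂ)⁻¹ = (μ + 2 * (n + 1 : ℕ)) / n by
      field_simp; push_cast; ring, one_div_div]
  have L := (L3.mul L2).mul L1
  rw [mul_one] at L
  refine tendsto_nhds_unique ?_ L
  refine tendsto_const_nhds.congr' ?_
  filter_upwards [eventually_gt_atTop 0] with n hn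
  have hn0 : (n : ℂ) ≠ 0 := by exact_mod_cast hn.ne'
  have hs : μ + 2 * ((n + 1 : ℕ) : ℂ) ≠ 0 := by
    intro h
    have := congrArg Complex.re h
    have hn' : (0:ℝ) ≤ n := Nat.cast_nonneg n
    simp at this
    linarith
  rw [MM_prod h1 h2 (n + 1)]
  simp only [Function.comp, Pi.div_apply, Complex.GammaSeq]
  have fac : (n.factorial : ℂ) ≠ 0 := by exact_mod_cast n.factorial_ne_zero
  have pw : (n : ℂ) ^ a * (n : ℂ) ^ b * n = (n : ℂ) ^ c * (n : ℂ) ^ d := by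
    rw [← Complex.cpow_add _ _ hn0, ← Complex.cpow_add _ _ hn0]
    nth_rewrite 2 [← Complex.cpow_one (n : ℂ)]
    rw [← Complex.cpow_add _ _ hn0]
    congr 1
    rw [ha, hb, hc, hd]; ring
  have nc : (n : ℂ) ^ c ≠ 0 := by rw [Complex.cpow_def_of_ne_zero hn0]; exact Complex.exp_ne_zero _
  have nd : (n : ℂ) ^ d ≠ 0 := by rw [Complex.cpow_def_of_ne_zero hn0]; exact Complex.exp_ne_zero _
  have pz : ∀ z : ℂ, 0 < z.re → ∏ j ∈ Finset.range (n + 1), (z + j) ≠ 0 := by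
    intro z hz
    refine Finset.prod_ne_zero_iff.2 fun j _ h => ?_
    have := congrArg Complex.re h
    have hn' : (0:ℝ) ≤ j := Nat.cast_nonneg j
    simp at this
    linarith
  simp only [Complex.add_re, Complex.sub_re] at h1 h2
  have pa := pz a (by simp [ha]; linarith)
  have pb := pz b (by simp [hb]; linarith)
  have pc := pz c (by simp [hc]; linarith)
  have pd := pz d (by simp [hd]; linarith)
  rw [Finset.prod_div_distrib, Finset.prod_mul_distrib, Finset.prod_mul_distrib]
  set A := ∏ j ∈ Finset.range (n + 1), (a + j)
  set B := ∏ j ∈ Finset.range (n + 1), (b + j)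
  set C := ∏ j ∈ Finset.range (n + 1), (c + j)
  set D := ∏ j ∈ Finset.range (n + 1), (d + j)
  set X := MM ν (μ + 2 * ((n + 1 : ℕ) : ℂ))
  set S := μ + 2 * ((n + 1 : ℕ) : ℂ)
  have : (↑n / S * (S * X) * ((n:ℂ) ^ a * ↑n.factorial / A * (↑n ^ b * ↑n.factorial / B) / (↑n ^ c * ↑n.factorial / C * (↑n ^ d * ↑n.factorial / D))))
     = ((n:ℂ) ^ a * (n : ℂ) ^ b * n) / (↑n ^ c * ↑n ^ d) * (C * D / (A * B) * X) := by
    field_simp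
  rw [this, pw, div_self (mul_ne_zero nc nd), one_mul]

theorem MM_eq' (h1 : -1 < (μ + ν).re) (h2 : 0 < (μ - ν).re) :
    Complex.Gamma (1 + μ) * MM ν μ * ((2:ℂ) ^ (1 - μ) * (Real.sqrt Real.pi : ℂ)) =
      Complex.Gamma ((μ - ν) / 2) * Complex.Gamma ((ν + μ + 1) / 2) := by
  obtain ⟨σ, s1, s2, s3, s4⟩ := good_sigma h1 h2
  have d := Complex.Gamma_mul_Gamma_add_half ((μ + 1) / 2)
  rw [show (μ + 1) / 2 + 1 / 2 = (μ + 2) / 2 by ring, show 2 * ((μ + 1) / 2) = 1 + μ by ring] at d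
  have gc : Complex.Gamma ((μ + 1) / 2) ≠ 0 := Complex.Gamma_ne_zero_of_re_pos (by simp; linarith)
  have gd : Complex.Gamma ((μ + 2) / 2) ≠ 0 := Complex.Gamma_ne_zero_of_re_pos (by simp; linarith)
  have e : (2:ℂ) ^ (1 - μ) = 2 * 2 ^ (1 - (1 + μ)) := by
    rw [show (1 - μ) = 1 + (1 - (1 + μ)) by ring, Complex.cpow_add _ _ two_ne_zero, Complex.cpow_one]
  rw [MM_eq h1 h2, e]
  calc _ = (Complex.Gamma (1 + μ) * 2 ^ (1 - (1 + μ)) * (Real.sqrt Real.pi : ℂ)) / (Complex.Gamma ((μ + 1) / 2) * Complex.Gamma ((μ + 2) / 2)) * (Complex.Gamma ((μ - ν) / 2) * Complex.Gamma ((ν + μ + 1) / 2)) := by ring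
    _ = _ := by rw [← d, div_self (mul_ne_zero gc gd), one_mul]
end


theorem BB_TT (T r : ℝ) : BB T T (2 * T + r) = (Real.cosh (2 * T) + Real.cosh (2 * T + r) ^ 2) /
    ((Real.cosh (2 * T) + 1) * Real.cosh (2 * T + r)) := by
  unfold BB
  have h := Real.cosh_sq T
  have h' := Real.cosh_two_mul T
  rw [show Real.cosh T ^ 2 + Real.cosh T ^ 2 + Real.cosh (2 * T + r) ^ 2 - 1 = Real.cosh (2 * T) + Real.cosh (2 * T + r) ^ 2 by linarith]
  rw [show 2 * Real.cosh T * Real.cosh T * Real.cosh (2 * T + r) = (Real.cosh (2 * T) + 1) * Real.cosh (2 * T + r) by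
    rw [show Real.cosh (2 * T) = 2 * Real.cosh T ^ 2 - 1 by linarith]; ring]

theorem cosh_le_exp_of_nonneg {x : ℝ} (hx : 0 ≤ x) : Real.cosh x ≤ Real.exp x := by
  rw [Real.cosh_eq]
  have : Real.exp (-x) ≤ Real.exp x := Real.exp_le_exp.2 (by linarith)
  linarith

theorem BB_TT_bounds {T r : ℝ} (hT : 0 ≤ T) (hr : 0 ≤ r) :
    1 / 4 * Real.exp r ≤ BB T T (2 * T + r) ∧ BB T T (2 * T + r) ≤ 2 * Real.exp r := by
  rw [BB_TT]
  have hC := Real.one_le_cosh (2 * T)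
  have hc := Real.one_le_cosh (2 * T + r)
  have er := Real.one_le_exp hr
  have l1 : Real.exp (2 * T + r) / 2 ≤ Real.cosh (2 * T + r) := half_exp_le_cosh _
  have l2 : Real.cosh (2 * T) ≤ Real.exp (2 * T) := cosh_le_exp_of_nonneg (by linarith)
  rw [Real.exp_add] at l1
  have l3 : Real.cosh (2 * T + r) ≤ Real.cosh (2 * T) * Real.exp r := by
    rw [Real.cosh_add, ← Real.cosh_add_sinh r]
    have : Real.sinh (2 * T) ≤ Real.cosh (2 * T) := (Real.sinh_lt_cosh _).le
    have : 0 ≤ Real.sinh r := Real.sinh_nonneg_iff.2 hr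
    nlinarith
  set C := Real.cosh (2 * T)
  set c := Real.cosh (2 * T + r)
  set E := Real.exp (2 * T)
  set e := Real.exp r
  have hE : C * e ≤ E * e := by gcongr
  have hd : 0 < (C + 1) * c := by positivity
  constructor
  · rw [le_div_iff₀ hd]
    have : (C + 1) * e ≤ 4 * c := by nlinarith
    nlinarith
  · rw [div_le_iff₀ hd]
    have h1 : c * c ≤ (C * e) * c := by gcongr
    have h2 : C * 1 ≤ (C * c) * e := by
      rw [mul_assoc]; gcongr; nlinarith
    nlinarith [mul_pos (by linarith : 0 < c) (by linarith : 0 < e)]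

theorem BB_TT_lim (r : ℝ) : Tendsto (fun T : ℝ => BB T T (2 * T + r)) atTop (𝓝 (Real.exp r)) := by
  have hu : Tendsto (fun T : ℝ => Real.exp (-(2 * T))) atTop (𝓝 0) :=
    Real.tendsto_exp_neg_atTop_nhds_zero.comp (tendsto_id.const_mul_atTop (by norm_num))
  have key : ∀ T : ℝ, BB T T (2 * T + r) = (fun u : ℝ => (2 * u * (1 + u ^ 2) + (Real.exp r + u ^ 2 * Real.exp (-r)) ^ 2) /
      ((1 + u) ^ 2 * (Real.exp r + u ^ 2 * Real.exp (-r)))) (Real.exp (-(2 * T))) := by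
    intro T
    rw [BB_TT, Real.cosh_eq, Real.cosh_eq, neg_add, Real.exp_add, Real.exp_add, Real.exp_neg (2 * T)]
    have h1 := Real.exp_pos (2 * T)
    have h2 := Real.exp_pos r
    have h3 := Real.exp_pos (-r)
    set E := Real.exp (2 * T)
    set e := Real.exp r
    set e' := Real.exp (-r)
    have : 0 < e * E ^ 2 + e' := by positivity
    simp only []
    rw [div_eq_div_iff (by positivity) (by positivity)]
    field_simp
    ring
  simp only [key]
  have hc : ContinuousAt (fun u : ℝ => (2 * u * (1 + u ^ 2) + (Real.exp r + u ^ 2 * Real.exp (-r)) ^ 2) /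
      ((1 + u) ^ 2 * (Real.exp r + u ^ 2 * Real.exp (-r)))) 0 := by
    refine ContinuousAt.div (by fun_prop) (by fun_prop) ?_
    simp
  have h := hc.tendsto.comp hu
  refine Tendsto.congr (fun _ => rfl) (h.trans (le_of_eq ?_))
  congr 1
  have := (Real.exp_pos r).ne'
  simp
  field_simp

section
variable {ν μ : ℂ}

theorem GG_lim (h1 : -1 < (μ + ν).re) (h2 : 0 < (μ - ν).re) :
    Tendsto (fun T : ℝ => Complex.exp (μ * (2 * T : ℝ)) * GG ν μ T T) atTop (𝓝 (1 / Complex.Gamma (1 + μ) * MM ν μ)) := by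
  obtain ⟨σ, s1, s2, s3, s4⟩ := good_sigma h1 h2
  obtain ⟨C, hC, hb⟩ := ff_bounds ν μ 0
  obtain ⟨D, hD, hd⟩ := legendre_bounds ν σ s1 s2 (1/4) (by norm_num)
  have e1 : ∀ T : ℝ, Complex.exp (μ * (2 * T : ℝ)) * GG ν μ T T = ∫ r in Ioi (0:ℝ),
      Complex.exp (μ * (2 * T : ℝ)) * (ff ν μ (2 * T + r) * legendreP ν (BB T T (2 * T + r))) := by
    intro T
    rw [integral_const_mul]
    have := shift_int (fun t => ff ν μ t * legendreP ν (BB T T t)) (2 * T) 0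
    rw [this]
    unfold GG
    rw [add_zero, two_mul]
  simp only [e1]
  unfold MM
  rw [← integral_const_mul]
  have BBc : ∀ T r : ℝ, 0 < BB T T (2 * T + r) := by
    intro T r; rw [BB_TT]; have := Real.cosh_pos (2 * T); have := Real.cosh_pos (2 * T + r); positivity
  refine tendsto_integral_filter_of_dominated_convergence
    (fun r => (C * (D * ((1 / 4) ^ σ + 2 ^ σ))) * Real.exp ((σ - μ.re) * r)) ?_ ?_ (exp_int (by linarith) _ _) ?_
  · refine Eventually.of_forall fun T => Continuous.aestronglyMeasurable ?_
    refine continuous_const.mul (((ff_continuous ν μ).comp (by fun_prop)).mul ?_)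
    refine (legendreP_continuousOn ν).comp_continuous ?_ (fun r => BBc T r)
    have : ∀ r : ℝ, (Real.cosh (2 * T) + 1) * Real.cosh (2 * T + r) ≠ 0 := by
      intro r; have := Real.cosh_pos (2 * T); have := Real.cosh_pos (2 * T + r); positivity
    simp only [BB_TT]
    exact Continuous.div (by fun_prop) (by fun_prop) this
  · filter_upwards [eventually_ge_atTop 0] with T hT
    filter_upwards [ae_restrict_mem measurableSet_Ioi] with r hr
    have hr' : (0:ℝ) < r := hr
    obtain ⟨b1, b2⟩ := BB_TT_bounds hT hr'.le
    have a1 := (hb (2 * T + r) (by positivity)).1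
    have b0 : 1 / 4 ≤ BB T T (2 * T + r) := by
      have := Real.one_le_exp hr'.le; linarith
    have a2 := (hd _ b0).1
    have a3 := rpow_two_sided (σ := σ) (by norm_num) (by norm_num) b1 b2
    rw [norm_mul, norm_mul, show μ * ((2 * T : ℝ) : ℂ) = -(-μ) * ((2 * T : ℝ) : ℂ) by ring, norm_cexp]
    calc _ ≤ Real.exp (-(-μ).re * (2 * T)) * ((C * Real.exp (-μ.re * (2 * T + r))) *
          (D * (((1 / 4) ^ σ + 2 ^ σ) * Real.exp (σ * r)))) := by
            gcongr
            exact a2.trans (by gcongr)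
      _ = (C * (D * ((1 / 4) ^ σ + 2 ^ σ))) * (Real.exp (-(-μ).re * (2 * T)) * Real.exp (-μ.re * (2 * T + r)) * Real.exp (σ * r)) := by ring
      _ = _ := by
        rw [← Real.exp_add, ← Real.exp_add]
        congr 2
        simp
        ring
  · filter_upwards with r
    have t1 : Tendsto (fun T : ℝ => 2 * T + r) atTop atTop :=
      tendsto_atTop_add_const_right _ _ (tendsto_id.const_mul_atTop (by norm_num))
    have t2 := (ff_lim ν μ).comp t1
    have t3 := (((legendreP_continuousOn ν).continuousAt (Ioi_mem_nhds (Real.exp_pos r))).tendsto).comp (BB_TT_lim r)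
    have t4 := (t2.mul t3).const_mul (Complex.exp (-μ * r))
    have := t4.congr' (f₂ := fun T : ℝ => Complex.exp (μ * (2 * T : ℝ)) * (ff ν μ (2 * T + r) * legendreP ν (BB T T (2 * T + r)))) (by
      filter_upwards with T
      simp only [Function.comp]
      have : Complex.exp (μ * (2 * T : ℝ)) = Complex.exp (-μ * r) * Complex.exp (μ * ((2 * T + r : ℝ) : ℂ)) := by
        rw [← Complex.exp_add]; congr 1; push_cast; ring
      rw [this]; ring)
    convert this using 2
    ring

theorem GG_formula (h1 : -1 < (μ + ν).re) (h2 : 0 < (μ - ν).re) (t₁ t₂ : ℝ) :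
    ff ν μ t₁ * ff ν μ t₂ = (2 : ℂ) ^ (1 - μ) * (Real.sqrt Real.pi : ℂ) /
        (Complex.Gamma ((μ - ν) / 2) * Complex.Gamma ((ν + μ + 1) / 2)) * GG ν μ t₁ t₂ := by
  obtain ⟨σ, s1, s2, s3, s4⟩ := good_sigma h1 h2
  obtain ⟨κ, hκ⟩ := GG_eq h1 h2
  have L := GG_lim h1 h2
  have L2 : Tendsto (fun T : ℝ => κ * ((Complex.exp (μ * T) * ff ν μ T) * (Complex.exp (μ * T) * ff ν μ T))) atTop
    (𝓝 (κ * ((1 / Complex.Gamma (1 + μ)) * (1 / Complex.Gamma (1 + μ))))) :=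
    ((ff_lim ν μ).mul (ff_lim ν μ)).const_mul κ
  have L3 := L2.congr' (f₂ := fun T : ℝ => Complex.exp (μ * (2 * T : ℝ)) * GG ν μ T T) (by
    filter_upwards with T
    rw [hκ, show μ * ((2 * T : ℝ) : ℂ) = μ * T + μ * T by push_cast; ring, Complex.exp_add]
    ring)
  have hk := tendsto_nhds_unique L L3
  have g : Complex.Gamma (1 + μ) ≠ 0 := Complex.Gamma_ne_zero_of_re_pos (by simp; linarith)
  have hk2 : κ = Complex.Gamma (1 + μ) * MM ν μ := by
    field_simp at hk
    rw [hk]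
  simp only [Complex.add_re, Complex.sub_re] at h1 h2
  have ga : Complex.Gamma ((μ - ν) / 2) ≠ 0 := Complex.Gamma_ne_zero_of_re_pos (by simp; linarith)
  have gb : Complex.Gamma ((ν + μ + 1) / 2) ≠ 0 := Complex.Gamma_ne_zero_of_re_pos (by simp; linarith)
  have m := MM_eq' (ν := ν) (μ := μ) (by simpa using h1) (by simpa using h2)
  rw [← hk2] at m
  rw [hκ, div_mul_eq_mul_div, eq_div_iff (mul_ne_zero ga gb), ← m]
  ring
end


theorem one_sub_tanh_sq' (t : ℝ) : 1 - Real.tanh t ^ 2 = 1 / Real.cosh t ^ 2 := by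
  rw [Real.tanh_eq_sinh_div_cosh]
  have := (Real.cosh_pos t).ne'
  have h := Real.cosh_sq t
  field_simp
  linarith

theorem tanh_add' (s t : ℝ) : Real.tanh (s + t) = (Real.tanh s + Real.tanh t) / (1 + Real.tanh s * Real.tanh t) := by
  simp only [Real.tanh_eq_sinh_div_cosh]
  have h1 := (Real.cosh_pos s).ne'
  have h2 := (Real.cosh_pos t).ne'
  have h3 := (Real.cosh_pos (s + t)).ne'
  rw [Real.cosh_add] at h3
  rw [Real.sinh_add, Real.cosh_add]
  have : 1 + Real.sinh s / Real.cosh s * (Real.sinh t / Real.cosh t) = (Real.cosh s * Real.cosh t + Real.sinh s * Real.sinh t) / (Real.cosh s * Real.cosh t) := by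
    field_simp
  rw [this]
  field_simp

theorem tanh_hasDerivAt' (t : ℝ) : HasDerivAt Real.tanh (1 - Real.tanh t ^ 2) t := by
  have h := (Real.hasDerivAt_sinh t).div (Real.hasDerivAt_cosh t) (Real.cosh_pos t).ne'
  have e : Real.tanh = Real.sinh / Real.cosh := by
    funext x; exact Real.tanh_eq_sinh_div_cosh x
  rw [e]
  refine h.congr_deriv ?_
  have := (Real.cosh_pos t).ne'
  simp only [Pi.div_apply]
  field_simp

theorem tanh_mono' : StrictMono Real.tanh := by
  refine strictMono_of_hasDerivAt_pos (fun t => tanh_hasDerivAt' t) (fun t => ?_)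
  rw [one_sub_tanh_sq']
  have := Real.cosh_pos t
  positivity

theorem tanh_image (a : ℝ) : Real.tanh '' Ioi a = Ioo (Real.tanh a) 1 := by
  ext x
  constructor
  · rintro ⟨t, ht, rfl⟩
    exact ⟨tanh_mono' ht, Real.tanh_lt_one t⟩
  · rintro ⟨h1, h2⟩
    have h3 : x ∈ Ioo (-1:ℝ) 1 := ⟨(Real.neg_one_lt_tanh a).trans h1, h2⟩
    refine ⟨Real.artanh x, ?_, Real.tanh_artanh h3⟩
    have := Real.tanh_artanh h3
    rw [← this] at h1
    exact tanh_mono'.lt_iff_lt.1 h1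

theorem tanh_wv (t : ℝ) : (1 - Real.tanh t) / 2 = wv t := by
  unfold wv
  rw [Real.tanh_eq_sinh_div_cosh, Real.sinh_eq, Real.cosh_eq, show 2 * t = t + t by ring, Real.exp_add, Real.exp_neg]
  have := Real.exp_pos t
  field_simp
  ring

theorem ferrersP_tanh (ν μ : ℂ) (t : ℝ) : ferrersP ν μ (Real.tanh t) = ff ν μ t := by
  unfold ferrersP ff
  have e1 : (1 - (Real.tanh t : ℂ)) / 2 = (wv t : ℂ) := by rw [← tanh_wv]; push_cast; ring
  have e2 : (1 - Real.tanh t) / (1 + Real.tanh t) = Real.exp (-2 * t) := by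
    rw [Real.tanh_eq_sinh_div_cosh, Real.sinh_eq, Real.cosh_eq, show -2 * t = -t + -t by ring, Real.exp_add, Real.exp_neg]
    have := Real.exp_pos t
    field_simp
    ring_nf
  have e3 : (1 - (Real.tanh t : ℂ)) / (1 + (Real.tanh t : ℂ)) = ((Real.exp (-2 * t) : ℝ) : ℂ) := by
    rw [← e2]; push_cast; ring
  rw [e1, e3]
  congr 1
  rw [Complex.cpow_def_of_ne_zero (by exact_mod_cast (Real.exp_pos _).ne'), ← Complex.ofReal_log (Real.exp_pos _).le,
    Real.log_exp]
  congr 1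
  push_cast
  ring

theorem B_tanh (t₁ t₂ t : ℝ) : (2 - Real.tanh t₁ ^ 2 - Real.tanh t₂ ^ 2 - Real.tanh t ^ 2 + Real.tanh t₁ ^ 2 * Real.tanh t₂ ^ 2 * Real.tanh t ^ 2) /
        (2 * Real.sqrt ((1 - Real.tanh t₁ ^ 2) * (1 - Real.tanh t₂ ^ 2) * (1 - Real.tanh t ^ 2))) = BB t₁ t₂ t := by
  have h1 := Real.cosh_pos t₁
  have h2 := Real.cosh_pos t₂
  have h3 := Real.cosh_pos t
  have e : ∀ t, Real.tanh t ^ 2 = 1 - 1 / Real.cosh t ^ 2 := fun t => by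
    have := one_sub_tanh_sq' t; linarith
  simp only [e]
  have : (1 - (1 - 1 / Real.cosh t₁ ^ 2)) * (1 - (1 - 1 / Real.cosh t₂ ^ 2)) * (1 - (1 - 1 / Real.cosh t ^ 2)) =
     (1 / (Real.cosh t₁ * Real.cosh t₂ * Real.cosh t)) ^ 2 := by
    field_simp; ring
  rw [this, Real.sqrt_sq (by positivity)]
  unfold BB
  field_simp
  ring

section
variable {ν μ : ℂ}

theorem F_tanh (t₁ t₂ : ℝ) (B : ℝ → ℝ)
    (hB : ∀ x₃, B x₃ = (2 - Real.tanh t₁ ^ 2 - Real.tanh t₂ ^ 2 - x₃ ^ 2 + Real.tanh t₁ ^ 2 * Real.tanh t₂ ^ 2 * x₃ ^ 2) /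
        (2 * Real.sqrt ((1 - Real.tanh t₁ ^ 2) * (1 - Real.tanh t₂ ^ 2) * (1 - x₃ ^ 2))))
    (F : ℝ → ℂ)
    (hF : ∀ x₃, F x₃ = ferrersP ν μ x₃ * ((1 - x₃ ^ 2 : ℝ) : ℂ)⁻¹ * legendreP ν (B x₃)) :
    (IntegrableOn F (Ioo ((Real.tanh t₁ + Real.tanh t₂) / (1 + Real.tanh t₁ * Real.tanh t₂)) 1) ↔
      IntegrableOn (fun t => ff ν μ t * legendreP ν (BB t₁ t₂ t)) (Ioi (t₁ + t₂))) ∧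
    ∫ x₃ in Ioo ((Real.tanh t₁ + Real.tanh t₂) / (1 + Real.tanh t₁ * Real.tanh t₂)) 1, F x₃ = GG ν μ t₁ t₂ := by
  rw [← tanh_add', ← tanh_image]
  have e : (fun t => |1 - Real.tanh t ^ 2| • F (Real.tanh t)) = (fun t => ff ν μ t * legendreP ν (BB t₁ t₂ t)) := by
    funext t
    have hp : 0 < 1 - Real.tanh t ^ 2 := by
      rw [one_sub_tanh_sq']; have := Real.cosh_pos t; positivity
    rw [hF, hB, B_tanh, ferrersP_tanh, abs_of_pos hp, Complex.real_smul]
    have : ((1 - Real.tanh t ^ 2 : ℝ) : ℂ) ≠ 0 := by exact_mod_cast hp.ne'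
    field_simp
  constructor
  · rw [integrableOn_image_iff_integrableOn_abs_deriv_smul measurableSet_Ioi
      (fun t _ => (tanh_hasDerivAt' t).hasDerivWithinAt) tanh_mono'.injective.injOn, e]
  · rw [integral_image_eq_integral_abs_deriv_smul measurableSet_Ioi
      (fun t _ => (tanh_hasDerivAt' t).hasDerivWithinAt) tanh_mono'.injective.injOn, e]
    rfl
end


theorem binc_shift (s : ℝ) (n : ℕ) : binc s (n + 1) = s / (n + 1) * binc (s + 1) n := by
  induction n with
  | zero => rw [binc_succ, binc_zero, binc_zero]; simp
  | succ n ih =>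
    rw [binc_succ s (n + 1), ih, binc_succ (s + 1) n]
    push_cast
    field_simp
    ring

theorem binc_summable {s : ℝ} (h0 : -1 < s) (h1 : s < 0) : Summable (fun n => |binc s (n + 1)|) := by
  refine summable_of_sum_range_le (c := 1) (fun n => abs_nonneg _) (fun n => ?_)
  have : ∀ n : ℕ, |binc s (n + 1)| = binc (s + 1) n - binc (s + 1) (n + 1) := by
    intro n
    have hp := binc_pos (s := s + 1) (by linarith) n
    rw [binc_succ (s + 1) n, binc_shift, abs_mul, abs_of_pos hp, abs_of_nonpos]
    · field_simp; ring
    · exact div_nonpos_of_nonpos_of_nonneg h1.le (by positivity)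
  simp only [this]
  rw [Finset.sum_range_sub', binc_zero]
  have hp := binc_pos (s := s + 1) (by linarith) n
  linarith

/-- Value at one. -/
noncomputable def Fone (ν : ℂ) : ℂ := ∑' n : ℕ, hypA (-ν) (-ν) 1 n

theorem coeff_summable {ν : ℂ} (h : -1 / 2 < ν.re) : Summable (fun n => ‖hypA (-ν) (-ν) 1 n‖) := by
  set s := max (-1 / 2) (-1 - 2 * ν.re)
  have s0 : -1 < s := lt_of_lt_of_le (by norm_num) (le_max_left _ _)
  have s1 : s < 0 := max_lt (by norm_num) (by linarith)
  have s2 : -1 - 2 * ν.re ≤ s := le_max_right _ _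
  obtain ⟨C, hC, hb⟩ := coeff_bound ν s s0 s1.ne (by linarith)
  rw [← summable_nat_add_iff 1]
  exact Summable.of_nonneg_of_le (fun n => norm_nonneg _) (fun n => hb (n + 1) (by omega)) ((binc_summable s0 s1).mul_left C)

theorem hyp_one_lim {ν : ℂ} (h : -1 / 2 < ν.re) : 
    Tendsto (fun z : ℝ => hyp2F1reg (-ν) (-ν) 1 (((z : ℂ) - 1) / ((z : ℂ) + 1))) atTop (𝓝 (Fone ν)) := by
  have hw : Tendsto (fun z : ℝ => (z - 1) / (z + 1)) atTop (𝓝 1) := by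
    have h0 : Tendsto (fun z : ℝ => 1 - 2 * (z + 1)⁻¹) atTop (𝓝 (1 - 2 * 0)) :=
      ((tendsto_inv_atTop_zero.comp (tendsto_atTop_add_const_right _ 1 tendsto_id)).const_mul 2).const_sub 1
    rw [show (1:ℝ) - 2 * 0 = 1 by norm_num] at h0
    refine h0.congr' ?_
    filter_upwards [eventually_gt_atTop 0] with z hz
    field_simp
    ring
  simp only [hyp_eq]
  unfold Fone
  refine tendsto_tsum_of_dominated_convergence (coeff_summable h) (fun n => ?_) ?_
  · have h1 : Tendsto (fun z : ℝ => hypA (-ν) (-ν) 1 n * (((z - 1) / (z + 1) : ℝ) : ℂ) ^ n) atTop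
        (𝓝 (hypA (-ν) (-ν) 1 n * ((1:ℝ):ℂ) ^ n)) :=
      (((Complex.continuous_ofReal.tendsto 1).comp hw).pow n).const_mul _
    simp only [Complex.ofReal_one, one_pow, mul_one] at h1
    refine h1.congr fun z => ?_
    push_cast; rfl
  · filter_upwards [eventually_ge_atTop 1] with z hz n
    rw [norm_mul, norm_pow]
    have : ‖((z : ℂ) - 1) / ((z : ℂ) + 1)‖ ≤ 1 := by
      rw [show ((z : ℂ) - 1) / ((z : ℂ) + 1) = (((z - 1) / (z + 1) : ℝ) : ℂ) by push_cast; rfl, Complex.norm_real, Real.norm_of_nonneg]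
      · rw [div_le_one (by linarith)]; linarith
      · exact div_nonneg (by linarith) (by linarith)
    exact mul_le_of_le_one_right (norm_nonneg _) (pow_le_one₀ (norm_nonneg _) this)

/-- The leading coefficient of the Legendre function at infinity. -/
noncomputable def cinf (ν : ℂ) : ℂ := ((1 / 2 : ℝ) : ℂ) ^ ν * Fone ν

theorem legendre_inf {ν : ℂ} (h : -1 / 2 < ν.re) :
    Tendsto (fun z : ℝ => legendreP ν z * (z : ℂ) ^ (-ν)) atTop (𝓝 (cinf ν)) := by
  have h1 := hyp_one_lim h
  have h2 : Tendsto (fun z : ℝ => (((1 + z⁻¹) / 2 : ℝ) : ℂ) ^ ν) atTop (𝓝 (((1 / 2 : ℝ) : ℂ) ^ ν)) := by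
    have h3 : Tendsto (fun z : ℝ => (1 + z⁻¹) / 2) atTop (𝓝 (1 / 2)) := by
      simpa using (tendsto_inv_atTop_zero.const_add (1:ℝ)).div_const 2
    have h4 : ContinuousAt (fun x : ℝ => (x : ℂ) ^ ν) (1 / 2) :=
      Complex.continuousAt_ofReal_cpow_const _ _ (Or.inr (by norm_num))
    exact h4.tendsto.comp h3
  refine (h2.mul h1).congr' ?_
  filter_upwards [eventually_gt_atTop 0] with z hz
  unfold legendreP
  have e : (((z : ℂ) + 1) / 2) ^ ν = (((1 + z⁻¹) / 2 : ℝ) : ℂ) ^ ν * (z : ℂ) ^ ν := by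
    rw [← Complex.mul_cpow_ofReal_nonneg (by positivity) hz.le]
    congr 1
    have : (z : ℂ) ≠ 0 := by exact_mod_cast hz.ne'
    push_cast
    field_simp
  have e2 : (z : ℂ) ^ ν * (z : ℂ) ^ (-ν) = 1 := by
    have : (z : ℂ) ≠ 0 := by exact_mod_cast hz.ne'
    rw [← Complex.cpow_add _ _ this]; simp
  rw [e]
  linear_combination (-(((1 + z⁻¹) / 2 : ℝ) : ℂ) ^ ν * hyp2F1reg (-ν) (-ν) 1 (((z : ℂ) - 1) / ((z : ℂ) + 1))) * e2

/-- normalized Legendre function -/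
noncomputable def hh (ν : ℂ) (r : ℝ) : ℂ := Complex.exp (-ν * r) * legendreP ν (Real.exp r)

theorem exp_cpow (x : ℝ) (s : ℂ) : ((Real.exp x : ℝ) : ℂ) ^ s = Complex.exp (s * x) := by
  rw [Complex.cpow_def_of_ne_zero (by exact_mod_cast (Real.exp_pos x).ne'), ← Complex.ofReal_log (Real.exp_pos x).le,
    Real.log_exp, mul_comm]

theorem hh_lim {ν : ℂ} (h : -1 / 2 < ν.re) : Tendsto (hh ν) atTop (𝓝 (cinf ν)) := by
  refine ((legendre_inf h).comp Real.tendsto_exp_atTop).congr fun r => ?_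
  simp only [Function.comp, hh, exp_cpow]
  ring

theorem hh_cont (ν : ℂ) : Continuous (hh ν) := (cexp_cont ν).mul (pp_cont ν)

theorem hh_bdd {ν : ℂ} (h : -1 / 2 < ν.re) : ∃ C, ∀ r, 0 ≤ r → ‖hh ν r‖ ≤ C := by
  have h1 := (hh_lim h).norm.eventually (gt_mem_nhds (lt_add_one ‖cinf ν‖))
  obtain ⟨R, hR⟩ := eventually_atTop.1 h1
  obtain ⟨C, hC⟩ := (isCompact_Icc (a := (0:ℝ)) (b := R)).exists_bound_of_continuousOn (hh_cont ν).continuousOn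
  refine ⟨max C (‖cinf ν‖ + 1), fun r hr => ?_⟩
  rcases le_total r R with h2 | h2
  · exact (hC r ⟨hr, h2⟩).trans (le_max_left _ _)
  · exact (hR r h2).le.trans (le_max_right _ _)

theorem MM_hh (ν : ℂ) (n : ℕ) (hn : 0 < n) : (1 / (n : ℂ)) * MM ν (ν + 1 / n) = ∫ s in Ioi (0:ℝ), Complex.exp (-(s:ℂ)) * hh ν (n * s) := by
  have hn' : (0:ℝ) < n := by exact_mod_cast hn
  have := integral_comp_mul_left_Ioi (fun r : ℝ => Complex.exp (-(ν + 1 / n) * r) * legendreP ν (Real.exp r)) 0 hn'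
  rw [mul_zero, Complex.real_smul] at this
  unfold MM
  push_cast at this
  rw [show (1 / (n:ℂ)) = (n:ℂ)⁻¹ by ring] at *
  rw [← this]
  refine integral_congr_ae (Eventually.of_forall fun s => ?_)
  simp only [hh]
  rw [← mul_assoc (Complex.exp _) (Complex.exp _), ← Complex.exp_add]
  congr 2
  have : (n : ℂ) ≠ 0 := by exact_mod_cast hn.ne'
  push_cast
  field_simp
  ring

theorem MM_abel {ν : ℂ} (h : -1 / 2 < ν.re) :
    Tendsto (fun n : ℕ => (1 / (n : ℂ)) * MM ν (ν + 1 / n)) atTop (𝓝 (cinf ν)) := by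
  obtain ⟨C, hC⟩ := hh_bdd h
  have e : ∀ s : ℝ, ‖Complex.exp (-(s:ℂ))‖ = Real.exp (-1 * s) := by
    intro s
    rw [Complex.norm_exp]; simp
  have L : Tendsto (fun n : ℕ => ∫ s in Ioi (0:ℝ), Complex.exp (-(s:ℂ)) * hh ν (n * s)) atTop
      (𝓝 (∫ s in Ioi (0:ℝ), Complex.exp (-(s:ℂ)) * cinf ν)) := by
    refine tendsto_integral_of_dominated_convergence (fun s => C * Real.exp (-1 * s))
      (fun n => ?_) (exp_int (by norm_num) _ _) (fun n => ?_) ?_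
    · refine Continuous.aestronglyMeasurable (Continuous.mul (by fun_prop) ((hh_cont ν).comp (by fun_prop)))
    · filter_upwards [ae_restrict_mem measurableSet_Ioi] with s hs
      have hs' : (0:ℝ) < s := hs
      rw [norm_mul, e, mul_comm]
      gcongr
      exact hC _ (by positivity)
    · filter_upwards [ae_restrict_mem measurableSet_Ioi] with s hs
      have hs' : (0:ℝ) < s := hs
      refine ((hh_lim h).comp ?_).const_mul _
      exact (tendsto_natCast_atTop_atTop).atTop_mul_const hs'
  have e2 : ∫ s in Ioi (0:ℝ), Complex.exp (-(s:ℂ)) * cinf ν = cinf ν := by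
    rw [integral_mul_const]
    have : ∫ s in Ioi (0:ℝ), Complex.exp (-(s:ℂ)) = 1 := by
      have h3 : ∀ s : ℝ, Complex.exp (-(s:ℂ)) = ((Real.exp (-s) : ℝ) : ℂ) := by intro s; push_cast; rfl
      simp only [h3]
      rw [integral_complex_ofReal, integral_exp_neg_Ioi_zero]; simp
    rw [this, one_mul]
  rw [e2] at L
  refine L.congr' ?_
  filter_upwards [eventually_gt_atTop 0] with n hn
  exact (MM_hh ν n hn).symm

theorem Gamma_cont {s : ℂ} (hs : 0 < s.re) : ContinuousAt Complex.Gamma s := by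
  refine (Complex.differentiableAt_Gamma s fun m h => ?_).continuousAt
  rw [h] at hs
  simp at hs
  have : (0:ℝ) ≤ m := Nat.cast_nonneg m
  linarith

theorem cinf_ne {ν : ℂ} (h : -1 / 2 < ν.re) : cinf ν ≠ 0 := by
  have L := MM_abel h
  have i0 : Tendsto (fun n : ℕ => 1 / (n : ℂ)) atTop (𝓝 0) := by
    simpa using (tendsto_inv_atTop_nhds_zero_nat (𝕜 := ℂ))
  have key : ∀ {a : ℂ}, 0 < a.re → Tendsto (fun n : ℕ => Complex.Gamma (a + 1 / (n : ℂ) / 2)) atTop (𝓝 (Complex.Gamma a)) := by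
    intro a ha
    have : Tendsto (fun n : ℕ => a + 1 / (n : ℂ) / 2) atTop (𝓝 a) := by
      simpa using (i0.div_const 2).const_add a
    exact (Gamma_cont ha).tendsto.comp this
  have p1 : 0 < (1:ℂ).re := by simp
  have p2 : 0 < (ν + 1 / 2).re := by simp; linarith
  have p3 : 0 < ((ν + 1) / 2).re := by simp; linarith
  have p4 : 0 < ((ν + 2) / 2).re := by simp; linarith
  have g2 := Complex.Gamma_ne_zero_of_re_pos p2
  have g3 := Complex.Gamma_ne_zero_of_re_pos p3
  have g4 := Complex.Gamma_ne_zero_of_re_pos p4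
  have L2 := ((key p1).mul (key p2)).div ((key p3).mul (key p4)) (mul_ne_zero g3 g4)
  have L3 := L2.congr' (f₂ := fun n : ℕ => (1 / (n : ℂ)) * MM ν (ν + 1 / n)) (by
    filter_upwards [eventually_gt_atTop 0] with n hn
    have hn' : (0:ℝ) < n := by exact_mod_cast hn
    have hn0 : (n:ℂ) ≠ 0 := by exact_mod_cast hn.ne'
    have re1 : (1 / (n:ℂ)).re = 1 / (n:ℝ) := by
      rw [show (1 / (n:ℂ)) = ((1 / (n:ℝ) : ℝ) : ℂ) by push_cast; rfl, Complex.ofReal_re]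
    have hq : 0 < 1 / (n:ℝ) := by positivity
    rw [MM_eq]
    · have : Complex.Gamma (1 + 1 / (n:ℂ) / 2) = (1 / (n:ℂ) / 2) * Complex.Gamma (1 / (n:ℂ) / 2) := by
        rw [add_comm, Complex.Gamma_add_one _ (by simp [hn0])]
      simp only [Pi.mul_apply, Pi.div_apply]
      rw [this]
      rw [show (ν + 1 / (n:ℂ) - ν) / 2 = 1 / (n:ℂ) / 2 by ring, show (ν + (ν + 1 / (n:ℂ)) + 1) / 2 = ν + 1 / 2 + 1 / (n:ℂ) / 2 by ring,
        show (ν + 1 / (n:ℂ) + 1) / 2 = (ν + 1) / 2 + 1 / (n:ℂ) / 2 by ring, show (ν + 1 / (n:ℂ) + 2) / 2 = (ν + 2) / 2 + 1 / (n:ℂ) / 2 by ring]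
      ring
    · rw [Complex.add_re, Complex.add_re, re1]; linarith
    · rw [Complex.sub_re, Complex.add_re, re1]; linarith)
  rw [tendsto_nhds_unique L L3]
  exact div_ne_zero (mul_ne_zero (by simp) g2) (mul_ne_zero g3 g4)


theorem BB_exp_lim (t₁ t₂ : ℝ) : Tendsto (fun t : ℝ => BB t₁ t₂ t * Real.exp (-t)) atTop
    (𝓝 (1 / (4 * Real.cosh t₁ * Real.cosh t₂))) := by
  have h1 := Real.cosh_pos t₁
  have h2 := Real.cosh_pos t₂
  set K := Real.cosh t₁ ^ 2 + Real.cosh t₂ ^ 2 - 1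
  have hu : Tendsto (fun t : ℝ => Real.exp (-t)) atTop (𝓝 0) := Real.tendsto_exp_neg_atTop_nhds_zero
  have key : ∀ t : ℝ, BB t₁ t₂ t * Real.exp (-t) = (fun u : ℝ => (4 * K * u ^ 2 + (1 + u ^ 2) ^ 2) /
      (4 * Real.cosh t₁ * Real.cosh t₂ * (1 + u ^ 2))) (Real.exp (-t)) := by
    intro t
    unfold BB
    rw [show Real.cosh t₁ ^ 2 + Real.cosh t₂ ^ 2 + Real.cosh t ^ 2 - 1 = K + Real.cosh t ^ 2 by simp only [K]; ring]
    rw [Real.cosh_eq t, Real.exp_neg]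
    have h3 := Real.exp_pos t
    simp only []
    field_simp
    ring
  simp only [key]
  have hc : ContinuousAt (fun u : ℝ => (4 * K * u ^ 2 + (1 + u ^ 2) ^ 2) /
      (4 * Real.cosh t₁ * Real.cosh t₂ * (1 + u ^ 2))) 0 := by
    refine ContinuousAt.div (by fun_prop) (by fun_prop) ?_
    simp [h1.ne', h2.ne']
  have h := hc.tendsto.comp hu
  refine Tendsto.congr (fun _ => rfl) (h.trans (le_of_eq ?_))
  congr 1
  simp

theorem BB_pos' (t₁ t₂ t : ℝ) : 0 < BB t₁ t₂ t := by
  unfold BB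
  have h1 := Real.one_le_cosh t₁
  have h2 := Real.one_le_cosh t₂
  have h3 := Real.one_le_cosh t
  have : 0 < Real.cosh t₁ ^ 2 + Real.cosh t₂ ^ 2 + Real.cosh t ^ 2 - 1 := by nlinarith
  positivity

theorem BB_atTop (t₁ t₂ : ℝ) : Tendsto (fun t : ℝ => BB t₁ t₂ t) atTop atTop := by
  have h1 := Real.cosh_pos t₁
  have h2 := Real.cosh_pos t₂
  refine (Tendsto.pos_mul_atTop (C := 1 / (4 * Real.cosh t₁ * Real.cosh t₂)) (by positivity) (BB_exp_lim t₁ t₂)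
    Real.tendsto_exp_atTop).congr fun t => ?_
  rw [mul_assoc, ← Real.exp_add]; simp

section
variable {ν μ : ℂ}

theorem kernel_lim (h : -1 / 2 < ν.re) (t₁ t₂ : ℝ) :
    Tendsto (fun t : ℝ => Complex.exp ((μ - ν) * t) * (ff ν μ t * legendreP ν (BB t₁ t₂ t))) atTop
      (𝓝 (1 / Complex.Gamma (1 + μ) * (cinf ν * ((1 / (4 * Real.cosh t₁ * Real.cosh t₂) : ℝ) : ℂ) ^ ν))) := by
  have h1 := Real.cosh_pos t₁
  have h2 := Real.cosh_pos t₂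
  have a1 := ff_lim ν μ
  have a2 := (legendre_inf h).comp (BB_atTop t₁ t₂)
  have h4 : ContinuousAt (fun x : ℝ => (x : ℂ) ^ ν) (1 / (4 * Real.cosh t₁ * Real.cosh t₂)) :=
      Complex.continuousAt_ofReal_cpow_const _ _ (Or.inr (by positivity))
  have a3 := h4.tendsto.comp (BB_exp_lim t₁ t₂)
  refine (a1.mul (a2.mul a3)).congr fun t => ?_
  simp only [Function.comp]
  have hb := BB_pos' t₁ t₂ t
  rw [Complex.ofReal_mul, Complex.mul_cpow_ofReal_nonneg hb.le (Real.exp_pos _).le, exp_cpow]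
  have e2 : (BB t₁ t₂ t : ℂ) ^ (-ν) * (BB t₁ t₂ t : ℂ) ^ ν = 1 := by
    have : (BB t₁ t₂ t : ℂ) ≠ 0 := by exact_mod_cast hb.ne'
    rw [← Complex.cpow_add _ _ this]; simp
  have e3 : Complex.exp ((μ - ν) * t) = Complex.exp (μ * t) * Complex.exp (ν * ((-t : ℝ) : ℂ)) := by
    rw [← Complex.exp_add]; congr 1; push_cast; ring
  rw [e3]
  linear_combination (Complex.exp (μ * t) * Complex.exp (ν * ((-t : ℝ) : ℂ)) * (ff ν μ t * legendreP ν (BB t₁ t₂ t))) * e2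

theorem not_int (h : -1 / 2 < ν.re) (hμ : -3 / 2 < μ.re) (hμ1 : μ ≠ -1) (h2 : (μ - ν).re ≤ 0) (t₁ t₂ : ℝ) :
    ¬ IntegrableOn (fun t => ff ν μ t * legendreP ν (BB t₁ t₂ t)) (Ioi (t₁ + t₂)) := by
  intro hi
  have c1 := Real.cosh_pos t₁
  have c2 := Real.cosh_pos t₂
  have g : Complex.Gamma (1 + μ) ≠ 0 := by
    refine Complex.Gamma_ne_zero fun m hm => ?_
    rcases m with _ | m
    · apply hμ1; simp at hm; linear_combination hm
    · have := congrArg Complex.re hm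
      simp at this
      have : (0:ℝ) ≤ m := Nat.cast_nonneg m
      linarith
  have L := (kernel_lim (μ := μ) h t₁ t₂).norm
  set K := 1 / Complex.Gamma (1 + μ) * (cinf ν * ((1 / (4 * Real.cosh t₁ * Real.cosh t₂) : ℝ) : ℂ) ^ ν) with hK
  have hK0 : K ≠ 0 := by
    refine mul_ne_zero (by simpa using g) (mul_ne_zero (cinf_ne h) ?_)
    rw [Complex.cpow_def_of_ne_zero (by exact_mod_cast (by positivity : (0:ℝ) < 1 / (4 * Real.cosh t₁ * Real.cosh t₂)).ne')]
    exact Complex.exp_ne_zero _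
  clear_value K
  have hK1 : ‖K‖ / 2 < ‖K‖ := by have := norm_pos_iff.2 hK0; linarith
  obtain ⟨R, hR⟩ := eventually_atTop.1 (L.eventually (lt_mem_nhds hK1))
  set R' := max (max R 0) (t₁ + t₂)
  have hi2 : IntegrableOn (fun t => ff ν μ t * legendreP ν (BB t₁ t₂ t)) (Ioi R') :=
    hi.mono_set (Ioi_subset_Ioi (le_max_right _ _))
  have hi3 : IntegrableOn (fun _ : ℝ => ‖K‖ / 2) (Ioi R') := by
    refine Integrable.mono hi2 aestronglyMeasurable_const ?_
    filter_upwards [ae_restrict_mem measurableSet_Ioi] with t ht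
    have ht' : R' < t := ht
    have t0 : 0 ≤ t := ((le_max_right R 0).trans (le_max_left _ _)).trans ht'.le
    have tR : R ≤ t := ((le_max_left R 0).trans (le_max_left _ _)).trans ht'.le
    have := hR t tR
    rw [norm_mul, show (μ - ν) * (t:ℂ) = -(-(μ - ν)) * t by ring, norm_cexp] at this
    rw [Real.norm_of_nonneg (by positivity)]
    refine this.le.trans (mul_le_of_le_one_left (norm_nonneg _) ?_)
    rw [Real.exp_le_one_iff]
    rw [Complex.neg_re]
    nlinarith
  rw [integrableOn_const_iff] at hi3
  rcases hi3 with h3 | h3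
  · simp [hK0] at h3
  · simp at h3

theorem hypA_m1 (a b : ℂ) (hab : a + b = 1) (m : ℕ) : hypA a b 0 (m + 1) - hypA a b 0 m = a * b * hypA a b 2 m := by
  unfold hypA
  rcases m with _ | m
  · simp
  · have g1 : Complex.Gamma (0 + ((m + 1 : ℕ) : ℂ)) = (m.factorial : ℂ) := by
      rw [← Complex.Gamma_nat_eq_factorial]; push_cast; ring_nf
    have g2 : Complex.Gamma (0 + ((m + 1 + 1 : ℕ) : ℂ)) = ((m + 1).factorial : ℂ) := by
      rw [← Complex.Gamma_nat_eq_factorial]; push_cast; ring_nf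
    have g3 : Complex.Gamma (2 + ((m + 1 : ℕ) : ℂ)) = ((m + 2).factorial : ℂ) := by
      rw [← Complex.Gamma_nat_eq_factorial]; push_cast; ring_nf
    rw [g1, g2, g3, ascPochhammer_succ_eval (m + 1) a, ascPochhammer_succ_eval (m + 1) b]
    have hm : (m.factorial : ℂ) ≠ 0 := by exact_mod_cast m.factorial_ne_zero
    have h1 : (m:ℂ) + 1 ≠ 0 := by exact_mod_cast (Nat.succ_ne_zero m)
    have h2 : (m:ℂ) + 1 + 1 ≠ 0 := by exact_mod_cast (Nat.succ_ne_zero (m + 1))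
    simp only [Nat.factorial_succ]
    push_cast
    obtain rfl : b = 1 - a := by linear_combination hab
    field_simp
    ring

theorem hyp_m1 (a b : ℂ) (hab : a + b = 1) {w : ℂ} (hw : ‖w‖ < 1) :
    (1 - w) * hyp2F1reg a b 0 w = a * b * w * hyp2F1reg a b 2 w := by
  have s0 := hyp_hasSum a b 0 hw
  have s2 := hyp_hasSum a b 2 hw
  have s1 := (hasSum_nat_add_iff' 1).2 s0
  have z : hypA a b 0 0 = 0 := by simp [hypA]
  simp only [Finset.range_one, Finset.sum_singleton, z, zero_mul, sub_zero] at s1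
  have s3 := s1.sub (s0.mul_left w)
  have s4 := (s2.mul_left (a * b * w)).cgf (g := fun n => hypA a b 0 (n + 1) * w ^ (n + 1) - w * (hypA a b 0 n * w ^ n)) (by
    intro n
    have := hypA_m1 a b hab n
    rw [pow_succ]
    linear_combination (w ^ n * w) * this)
  rw [← s3.unique s4]
  ring

theorem ff_m1 (ν : ℂ) (t : ℝ) : ff ν (-1) t = (-ν * (ν + 1)) * ff ν 1 t := by
  unfold ff
  have h := hyp_m1 (-ν) (ν + 1) (by ring) (wv_norm_lt t)
  rw [show (1:ℂ) + -1 = 0 by ring, show (1:ℂ) + 1 = 2 by ring]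
  have hw : (1:ℂ) - wv t ≠ 0 := by
    have := wv_lt t
    rw [← Complex.ofReal_one, ← Complex.ofReal_sub]
    exact_mod_cast (sub_pos.2 this).ne'
  have e : (wv t : ℂ) * Complex.exp (2 * t) = 1 - wv t := by
    have h1 : wv t * Real.exp (2 * t) = 1 - wv t := by
      unfold wv
      have := Real.exp_pos (2 * t)
      field_simp
      ring
    have := congrArg (fun x : ℝ => (x : ℂ)) h1
    push_cast at this
    exact this
  have e2 : Complex.exp (-(-1) * t) = Complex.exp (2 * t) * Complex.exp (-1 * t) := by
    rw [← Complex.exp_add]; congr 1; ring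
  apply mul_left_cancel₀ hw
  rw [e2]
  linear_combination (Complex.exp (2 * t) * Complex.exp (-1 * t)) * h +
    (-ν * (ν + 1) * Complex.exp (-1 * t) * hyp2F1reg (-ν) (ν + 1) 2 (wv t)) * e

theorem GG_formula_m1 (h1 : 0 < ν.re) (h2 : ν.re < 1) (t₁ t₂ : ℝ) :
    ff ν (-1) t₁ * ff ν (-1) t₂ = (2 : ℂ) ^ (1 - (-1) : ℂ) * (Real.sqrt Real.pi : ℂ) /
        (Complex.Gamma ((-1 - ν) / 2) * Complex.Gamma ((ν + -1 + 1) / 2)) * GG ν (-1) t₁ t₂ := by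
  have f := GG_formula (ν := ν) (μ := 1) (by simp; linarith) (by simp; linarith) t₁ t₂
  have e : GG ν (-1) t₁ t₂ = (-ν * (ν + 1)) * GG ν 1 t₁ t₂ := by
    unfold GG
    rw [← integral_const_mul]
    refine integral_congr_ae (Eventually.of_forall fun t => ?_)
    simp only [ff_m1]
    ring
  rw [ff_m1, ff_m1, e]
  have n1 : (-1 - ν) / 2 ≠ 0 := by
    intro h
    have := congrArg Complex.re h
    simp at this
    linarith
  have n2 : ν / 2 ≠ 0 := by
    intro h
    have := congrArg Complex.re h
    simp at this
    rw [this] at h1; simp at h1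
  have n0 : ν ≠ 0 := by
    rintro rfl; simp at h1
  have n0' : -1 - ν ≠ 0 := by
    intro h; rw [h] at n1; simp at n1
  have G1 := Complex.Gamma_add_one _ n1
  have G2 := Complex.Gamma_add_one _ n2
  rw [show (-1 - ν) / 2 + 1 = (1 - ν) / 2 by ring] at G1
  rw [show ν / 2 + 1 = (ν + 1 + 1) / 2 by ring] at G2
  rw [G1, G2] at f
  rw [show (ν + -1 + 1) / 2 = ν / 2 by ring, show (2:ℂ) ^ (1 - (-1) : ℂ) = 4 by
    rw [show (1 - (-1) : ℂ) = ((2 : ℕ) : ℂ) by norm_num, Complex.cpow_natCast]; norm_num]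
  rw [show (1:ℂ) - 1 = 0 by ring, Complex.cpow_zero] at f
  rw [show (-ν * (ν + 1) * ff ν 1 t₁) * (-ν * (ν + 1) * ff ν 1 t₂) = (-ν * (ν + 1)) ^ 2 * (ff ν 1 t₁ * ff ν 1 t₂) by ring, f]
  have np : ν + 1 ≠ 0 := by
    intro h; apply n0'; linear_combination -h
  have : (-1 - ν) / 2 * Complex.Gamma ((-1 - ν) / 2) * (ν / 2 * Complex.Gamma (ν / 2)) =
    (-ν * (ν + 1)) / 4 * (Complex.Gamma ((-1 - ν) / 2) * Complex.Gamma (ν / 2)) := by ring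
  rw [this]
  have k0 : -ν * (ν + 1) ≠ 0 := mul_ne_zero (neg_ne_zero.2 n0) np
  set k := -ν * (ν + 1)
  rw [← div_div]
  field_simp

end

theorem main_hyp (ν μ : ℂ) (h1 : -1 < (μ + ν).re) (h2 : -2 < (μ - ν).re) (t₁ t₂ : ℝ)
    (hi : IntegrableOn (fun t => ff ν μ t * legendreP ν (BB t₁ t₂ t)) (Ioi (t₁ + t₂))) :
    ff ν μ t₁ * ff ν μ t₂ = (2 : ℂ) ^ (1 - μ) * (Real.sqrt Real.pi : ℂ) /
        (Complex.Gamma ((μ - ν) / 2) * Complex.Gamma ((ν + μ + 1) / 2)) * GG ν μ t₁ t₂ := by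
  rcases lt_or_ge 0 (μ - ν).re with h | h
  · exact GG_formula h1 h t₁ t₂
  · have a1 := h1
    have a2 := h2
    have a3 := h
    simp only [Complex.add_re, Complex.sub_re] at a1 a2 a3
    by_cases hμ : μ = -1
    · subst hμ
      simp at a1 a2 a3
      exact GG_formula_m1 (by linarith) (by linarith) t₁ t₂
    · exact absurd hi (not_int (by linarith) (by linarith) hμ h t₁ t₂)


end Helpers

/-- Kernel-form product formula for two Ferrers functions of the
first kind. -/
theorem ferrersPP_kernel_product
    (ν μ : ℂ) (h1 : -1 < (μ + ν).re) (h2 : -2 < (μ - ν).re)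
    (x₁ x₂ : ℝ) (hx₁ : -1 < x₁) (hx₁' : x₁ < 1) (hx₂ : -1 < x₂) (hx₂' : x₂ < 1)
    (B : ℝ → ℝ)
    (hB : ∀ x₃, B x₃ = (2 - x₁ ^ 2 - x₂ ^ 2 - x₃ ^ 2 + x₁ ^ 2 * x₂ ^ 2 * x₃ ^ 2) /
        (2 * Real.sqrt ((1 - x₁ ^ 2) * (1 - x₂ ^ 2) * (1 - x₃ ^ 2))))
    (F : ℝ → ℂ)
    (hF : ∀ x₃, F x₃ = ferrersP ν μ x₃ * ((1 - x₃ ^ 2 : ℝ) : ℂ)⁻¹ * legendreP ν (B x₃))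
    (hint : IntegrableOn F (Ioo ((x₁ + x₂) / (1 + x₁ * x₂)) 1)) :
    ferrersP ν μ x₁ * ferrersP ν μ x₂ =
      (2 : ℂ) ^ (1 - μ) * (Real.sqrt Real.pi : ℂ) /
        (Complex.Gamma ((μ - ν) / 2) * Complex.Gamma ((ν + μ + 1) / 2)) *
        ∫ x₃ in Ioo ((x₁ + x₂) / (1 + x₁ * x₂)) 1, F x₃ := by
  obtain ⟨t₁, rfl⟩ : ∃ t, Real.tanh t = x₁ := ⟨Real.artanh x₁, Real.tanh_artanh ⟨hx₁, hx₁'⟩⟩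
  obtain ⟨t₂, rfl⟩ : ∃ t, Real.tanh t = x₂ := ⟨Real.artanh x₂, Real.tanh_artanh ⟨hx₂, hx₂'⟩⟩
  obtain ⟨e1, e2⟩ := F_tanh (ν := ν) (μ := μ) t₁ t₂ B hB F hF
  rw [e2, ferrersP_tanh, ferrersP_tanh]
  exact main_hyp ν μ h1 h2 t₁ t₂ (e1.1 hint)
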